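/- Let q be a prime power and let G = SL_3(F_q), the group of 3×3 matrices of determinant 1 over the field with q elements. Then for every odd prime p and every irreducible complex character χ of G with p ∤ χ(1), Property 1.3 holds for (G, χ, p). -/

import Mathlib

open CategoryTheory

/-- `Qcyc N` is the `N`-th cyclotomic field `ℚ(ζ_N)`, realised as the subfield of `ℂ`
generated by all `N`-th roots of unity. -/
noncomputable def Qcyc (N : ℕ) : IntermediateField ℚ ℂ :=
  IntermediateField.adjoin ℚ {z : ℂ | z ^ N = 1}

/-- `Qadj c` is the subfield `ℚ(c)` of `ℂ` generated by a complex number `c`. -/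
noncomputable def Qadj (c : ℂ) : IntermediateField ℚ ℂ :=
  IntermediateField.adjoin ℚ {c}

/-- `f` is the conductor of the complex number `c`: the least positive integer `N`
with `c ∈ ℚ(ζ_N)`. -/
def IsConductorOf (c : ℂ) (f : ℕ) : Prop :=
  IsLeast {N : ℕ | 0 < N ∧ c ∈ Qcyc N} f

/-- `f` is the conductor of the character `χ`: the least positive integer `N` such that all
values of `χ` lie in `ℚ(ζ_N)`. -/
def IsCharConductor {G : Type*} [Monoid G] (χ : G → ℂ) (f : ℕ) : Prop :=
  IsLeast {N : ℕ | 0 < N ∧ ∀ g, χ g ∈ Qcyc N} f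

/-- Property 1.3 of Navarro–Tiep for `(G, χ, p)`: writing the conductor of `χ` as
`f = p ^ a * m` with `p ∤ m` (so that `p ^ a = p ^ (f.factorization p)` is the `p`-part of `f`),
there is a `p`-element `g ∈ G` such that `p ∤ [ℚ(ζ_{p^a}) : ℚ(χ(g))]`. -/
def Property13 {G : Type*} [Group G] (χ : G → ℂ) (p : ℕ) : Prop :=
  ∀ f : ℕ, IsCharConductor χ f →
    ∃ g : G, (∃ j : ℕ, orderOf g = p ^ j) ∧
      ¬ p ∣ (Qadj (χ g)).relfinrank (Qcyc (p ^ f.factorization p))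


section AbelianDecomp
open Module

variable {V : Type*} [AddCommGroup V] [Module ℂ V] [FiniteDimensional ℂ V]
variable {A : Type*} [CommGroup A] [Fintype A]

/-- The isotypic projection of an abelian group representation. -/
noncomputable def isoProj (ρ : A →* (V →ₗ[ℂ] V)) (ψ : A →* ℂˣ) : V →ₗ[ℂ] V :=
  (Fintype.card A : ℂ)⁻¹ • ∑ a : A, ((ψ a⁻¹ : ℂˣ) : ℂ) • ρ a

instance finite_dualHom : Finite (A →* ℂˣ) := by
  obtain ⟨e⟩ := CommGroup.monoidHom_mulEquiv_of_hasEnoughRootsOfUnity A ℂ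
  exact Finite.of_equiv A e.symm.toEquiv

lemma rho_isoProj (ρ : A →* (V →ₗ[ℂ] V)) (ψ : A →* ℂˣ) (b : A) :
    ρ b * isoProj ρ ψ = ((ψ b : ℂˣ) : ℂ) • isoProj ρ ψ := by
  unfold isoProj
  rw [mul_smul_comm, smul_comm]
  congr 1
  rw [Finset.mul_sum, Finset.smul_sum]
  refine Fintype.sum_equiv (Equiv.mulLeft b) _ _ fun a => ?_
  rw [mul_smul_comm, ← map_mul, Equiv.coe_mulLeft, smul_smul]
  congr 1
  have h0 : ((ψ b : ℂˣ) : ℂ) ≠ 0 := Units.ne_zero _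
  have h1 : ((ψ a : ℂˣ) : ℂ) ≠ 0 := Units.ne_zero _
  simp
  field_simp

lemma rho_isoProj_apply (ρ : A →* (V →ₗ[ℂ] V)) (ψ : A →* ℂˣ) (b : A) (v : V) :
    ρ b (isoProj ρ ψ v) = ((ψ b : ℂˣ) : ℂ) • isoProj ρ ψ v := by
  have := congrArg (fun f => f v) (rho_isoProj ρ ψ b)
  simpa using this

lemma isoProj_idem (ρ : A →* (V →ₗ[ℂ] V)) (ψ : A →* ℂˣ) :
    isoProj ρ ψ * isoProj ρ ψ = isoProj ρ ψ := by
  have h : isoProj ρ ψ * isoProj ρ ψ =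
      (Fintype.card A : ℂ)⁻¹ • ∑ a : A, ((ψ a⁻¹ : ℂˣ) : ℂ) • (ρ a * isoProj ρ ψ) := by
    conv_lhs => enter [1]; unfold isoProj
    rw [smul_mul_assoc, Finset.sum_mul]
    simp only [smul_mul_assoc]
  rw [h]
  have hc : ((Fintype.card A : ℕ) : ℂ) ≠ 0 := by simp
  simp only [rho_isoProj, smul_smul]
  have h2 : ∀ a : A, ((ψ a⁻¹ : ℂˣ) : ℂ) * ((ψ a : ℂˣ) : ℂ) = 1 := by
    intro a; rw [← Units.val_mul, ← map_mul]; simp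
  simp only [h2, one_smul, Finset.sum_const, Finset.card_univ]
  rw [← Nat.cast_smul_eq_nsmul ℂ, smul_smul, inv_mul_cancel₀ hc, one_smul]

lemma sum_dual_apply [Fintype (A →* ℂˣ)] {a : A} (ha : a ≠ 1) :
    ∑ ψ : A →* ℂˣ, ((ψ a : ℂˣ) : ℂ) = 0 := by
  obtain ⟨φ, hφ⟩ := CommGroup.exists_apply_ne_one_of_hasEnoughRootsOfUnity A ℂ ha
  have h : ∑ ψ : A →* ℂˣ, ((ψ a : ℂˣ) : ℂ) = ((φ a : ℂˣ) : ℂ) * ∑ ψ : A →* ℂˣ, ((ψ a : ℂˣ) : ℂ) := by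
    rw [Finset.mul_sum]
    refine (Fintype.sum_equiv (Equiv.mulLeft φ) _ _ fun ψ => ?_).symm
    simp
  have h2 : (((φ a : ℂˣ) : ℂ) - 1) * ∑ ψ : A →* ℂˣ, ((ψ a : ℂˣ) : ℂ) = 0 := by
    rw [sub_mul, ← h]; ring
  rcases mul_eq_zero.1 h2 with h3 | h3
  · exact absurd (Units.ext (by simpa [sub_eq_zero] using h3)) hφ
  · exact h3

lemma card_dualHom [Fintype (A →* ℂˣ)] : Fintype.card (A →* ℂˣ) = Fintype.card A := by
  obtain ⟨e⟩ := CommGroup.monoidHom_mulEquiv_of_hasEnoughRootsOfUnity A ℂ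
  exact Fintype.card_congr e.toEquiv

lemma sum_isoProj [Fintype (A →* ℂˣ)] (ρ : A →* (V →ₗ[ℂ] V)) :
    ∑ ψ : A →* ℂˣ, isoProj ρ ψ = 1 := by
  classical
  unfold isoProj
  rw [← Finset.smul_sum, Finset.sum_comm]
  have : ∀ a : A, ∑ ψ : A →* ℂˣ, ((ψ a⁻¹ : ℂˣ) : ℂ) • ρ a
      = if a = 1 then (Fintype.card A : ℂ) • (1 : V →ₗ[ℂ] V) else 0 := by
    intro a
    rw [← Finset.sum_smul]
    split_ifs with h
    · subst h; simp [card_dualHom]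
    · rw [sum_dual_apply (by simpa using h), zero_smul]
  simp only [this]
  simp

/-- The trace of an abelian group representation is a nonnegative combination of characters. -/
lemma exists_mult [Fintype (A →* ℂˣ)] (ρ : A →* (V →ₗ[ℂ] V)) :
    ∃ m : (A →* ℂˣ) → ℕ, ∀ a, LinearMap.trace ℂ V (ρ a) = ∑ ψ, (m ψ : ℂ) * ((ψ a : ℂˣ) : ℂ) := by
  refine ⟨fun ψ => finrank ℂ (LinearMap.range (isoProj ρ ψ)), fun a => ?_⟩
  have h1 : ρ a = ∑ ψ : A →* ℂˣ, ((ψ a : ℂˣ) : ℂ) • isoProj ρ ψ := by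
    simp only [← rho_isoProj]
    rw [← Finset.mul_sum, sum_isoProj, mul_one]
  rw [h1, map_sum]
  refine Finset.sum_congr rfl fun ψ _ => ?_
  rw [map_smul, smul_eq_mul, mul_comm]
  congr 1
  have hp : LinearMap.IsProj (LinearMap.range (isoProj ρ ψ)) (isoProj ρ ψ) := by
    refine ⟨fun x => ⟨x, rfl⟩, ?_⟩
    rintro _ ⟨y, rfl⟩
    exact congrArg (fun f => f y) (isoProj_idem ρ ψ)
  exact hp.trace

/-- Traces of powers of an element of finite order. -/
lemma exists_roots {G : Type*} [Group G] (ρ : G →* (V →ₗ[ℂ] V)) (g : G) (N : ℕ) (hN : 0 < N)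
    (hg : g ^ N = 1) : ∃ (ι : Type) (_ : Fintype ι) (m : ι → ℕ) (z : ι → ℂ),
      (∀ i, z i ^ N = 1) ∧
      ∀ k : ℕ, LinearMap.trace ℂ V (ρ (g ^ k)) = ∑ i, (m i : ℂ) * z i ^ k := by
  classical
  have : NeZero N := ⟨hN.ne'⟩
  let A := Multiplicative (ZMod N)
  let f : A →* G := AddMonoidHom.toMultiplicativeLeft
    (ZMod.lift N ⟨(zmultiplesHom (Additive G)) (Additive.ofMul g), by
      simp only [zmultiplesHom_apply, natCast_zsmul]
      rw [← ofMul_pow, hg]; rfl⟩)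
  have hf : f (Multiplicative.ofAdd 1) = g := by
    have h := ZMod.lift_coe N (⟨(zmultiplesHom (Additive G)) (Additive.ofMul g), by
      simp only [zmultiplesHom_apply, natCast_zsmul]
      rw [← ofMul_pow, hg]; rfl⟩ : {f : ℤ →+ Additive G // f N = 0}) 1
    simp only [zmultiplesHom_apply, one_smul] at h
    have h2 : ((1 : ℤ) : ZMod N) = 1 := by simp
    rw [h2] at h
    exact h
  have : Fintype (A →* ℂˣ) := Fintype.ofFinite _
  obtain ⟨m, hm⟩ := exists_mult (ρ.comp f)
  refine ⟨A →* ℂˣ, inferInstance, m, fun ψ => ((ψ (Multiplicative.ofAdd 1) : ℂˣ) : ℂ), ?_, ?_⟩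
  · intro ψ
    rw [← Units.val_pow_eq_pow_val, ← map_pow, ← ofAdd_nsmul]
    simp
  · intro k
    have := hm ((Multiplicative.ofAdd 1) ^ k)
    simp only [MonoidHom.comp_apply, map_pow, hf, Units.val_pow_eq_pow_val] at this
    rw [map_pow]; exact this

lemma root_conj {z : ℂ} {N : ℕ} (hN : 0 < N) (hz : z ^ N = 1) : z⁻¹ = (starRingEnd ℂ) z := by
  have h1 : ‖z‖ = 1 := by
    have := congrArg norm hz
    rw [norm_pow, norm_one] at this
    exact (pow_eq_one_iff_of_nonneg (norm_nonneg _) hN.ne').1 this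
  exact Complex.inv_eq_conj h1

lemma trace_inv_conj {G : Type*} [Group G] [Finite G] (ρ : G →* (V →ₗ[ℂ] V)) (g : G) :
    LinearMap.trace ℂ V (ρ g⁻¹) = (starRingEnd ℂ) (LinearMap.trace ℂ V (ρ g)) := by
  have hN : 0 < orderOf g := orderOf_pos g
  obtain ⟨ι, _, m, z, hz, h⟩ := exists_roots ρ g (orderOf g) hN (pow_orderOf_eq_one g)
  have h1 : g⁻¹ = g ^ (orderOf g - 1) := by
    rw [inv_eq_iff_mul_eq_one, ← pow_succ', Nat.sub_add_cancel hN, pow_orderOf_eq_one]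
  have h2 := h (orderOf g - 1)
  have h3 := h 1
  rw [pow_one] at h3
  rw [h1, h2, h3, map_sum]
  refine Finset.sum_congr rfl fun i _ => ?_
  rw [map_mul, map_natCast, pow_one, ← root_conj hN (hz i)]
  congr 1
  rw [eq_comm, inv_eq_iff_eq_inv, eq_comm, inv_eq_of_mul_eq_one_left]
  rw [← pow_succ', Nat.sub_add_cancel hN, hz]

end AbelianDecomp

/-- A vanishing integral combination of `p`-power roots of unity has coefficient sum divisible
by `p`. -/
lemma dvd_of_sum_roots_eq_zero {ι : Type*} (s : Finset ι) (p : ℕ) (hp : p.Prime) (k : ℕ)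
    (c : ι → ℤ) (z : ι → ℂ) (hz : ∀ i ∈ s, z i ^ p ^ k = 1)
    (h : ∑ i ∈ s, (c i : ℂ) * z i = 0) : (p : ℤ) ∣ ∑ i ∈ s, c i := by
  classical
  have := Fact.mk hp
  have hpos : 0 < p ^ (k + 1) := pow_pos hp.pos _
  obtain ⟨ζ, hζ⟩ : ∃ ζ : ℂ, IsPrimitiveRoot ζ (p ^ (k + 1)) :=
    ⟨_, Complex.isPrimitiveRoot_exp _ hpos.ne'⟩
  have he : ∀ i, ∃ e : ℕ, i ∈ s → ζ ^ e = z i := by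
    intro i
    by_cases hi : i ∈ s
    · have : NeZero (p ^ (k + 1)) := ⟨hpos.ne'⟩
      obtain ⟨e, -, he⟩ := hζ.eq_pow_of_pow_eq_one (ξ := z i)
        (by rw [pow_succ, pow_mul, hz i hi, one_pow])
      exact ⟨e, fun _ => he⟩
    · exact ⟨0, fun h => absurd h hi⟩
  choose e he using he
  let P : Polynomial ℤ := ∑ i ∈ s, Polynomial.C (c i) * Polynomial.X ^ e i
  have hP : Polynomial.aeval ζ P = 0 := by
    simp only [P, map_sum, map_mul, map_pow, Polynomial.aeval_X, Polynomial.aeval_C]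
    rw [← h]
    refine Finset.sum_congr rfl fun i hi => ?_
    rw [he i hi]; simp
  have hd : Polynomial.cyclotomic (p ^ (k + 1)) ℤ ∣ P := by
    rw [Polynomial.cyclotomic_eq_minpoly hζ hpos]
    exact minpoly.isIntegrallyClosed_dvd (hζ.isIntegral hpos) hP
  obtain ⟨Q, hQ⟩ := hd
  have h1 : Polynomial.eval 1 P = ∑ i ∈ s, c i := by
    simp [P, Polynomial.eval_finsetSum]
  rw [← h1, hQ, Polynomial.eval_mul, Polynomial.eval_one_cyclotomic_prime_pow]
  exact Dvd.intro _ rfl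

open Module CategoryTheory

lemma Qcyc_eq (M : ℕ) [NeZero M] {ζ : ℂ} (hζ : IsPrimitiveRoot ζ M) :
    Qcyc M = IntermediateField.adjoin ℚ {ζ} := by
  unfold Qcyc
  apply le_antisymm
  · rw [IntermediateField.adjoin_le_iff]
    intro z hz
    obtain ⟨k, _, rfl⟩ := hζ.eq_pow_of_pow_eq_one hz
    exact pow_mem (IntermediateField.mem_adjoin_simple_self ℚ ζ) k
  · apply IntermediateField.adjoin.mono
    rintro z rfl
    exact hζ.pow_eq_one

lemma Qcyc_cyc (M : ℕ) [NeZero M] : IsCyclotomicExtension {M} ℚ (Qcyc M) := by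
  have hζ := Complex.isPrimitiveRoot_exp M (NeZero.ne M)
  have := (IntermediateField.isCyclotomicExtension_singleton_iff_eq_adjoin
    (n := M) (F := Qcyc M) (hζ := hζ)).2 (Qcyc_eq M hζ)
  convert this
  · rfl
  · rfl

lemma pow_one_of_dvd {α : Type*} [Monoid α] {z : α} {d M : ℕ} (h : d ∣ M) (hz : z ^ d = 1) :
    z ^ M = 1 := by
  obtain ⟨k, rfl⟩ := h
  rw [pow_mul, hz, one_pow]

lemma pow_eq_of_modEq {α : Type*} [Monoid α] {z : α} {d a b : ℕ} (h : a ≡ b [MOD d])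
    (hz : z ^ d = 1) : z ^ a = z ^ b := by
  have h1 : z ^ a = z ^ (a % d) := by
    conv_lhs => rw [← Nat.mod_add_div a d, pow_add, pow_mul, hz, one_pow, mul_one]
  have h2 : z ^ b = z ^ (b % d) := by
    conv_lhs => rw [← Nat.mod_add_div b d, pow_add, pow_mul, hz, one_pow, mul_one]
  rw [h1, h2, h]

lemma Qcyc_mono {d M : ℕ} (h : d ∣ M) : Qcyc d ≤ Qcyc M := by
  unfold Qcyc
  apply IntermediateField.adjoin.mono
  intro z hz
  obtain ⟨k, rfl⟩ := h
  simp only [Set.mem_ofPred_eq] at hz ⊢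
  rw [pow_mul, hz, one_pow]

lemma mem_Qcyc_root {M : ℕ} {z : ℂ} (h : z ^ M = 1) : z ∈ Qcyc M :=
  IntermediateField.subset_adjoin _ _ h

lemma Qcyc_galois (M : ℕ) [NeZero M] : FiniteDimensional ℚ (Qcyc M) ∧ IsGalois ℚ (Qcyc M) := by
  have := Qcyc_cyc M
  exact ⟨IsCyclotomicExtension.finite_of_singleton M ℚ _, IsCyclotomicExtension.isGalois {M} ℚ _⟩

/-- every automorphism is a power map on roots of unity -/
lemma gal_pow (M : ℕ) [NeZero M] (σ : Qcyc M ≃ₐ[ℚ] Qcyc M) :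
    ∃ r : ℕ, r.Coprime M ∧ ∀ z : Qcyc M, z ^ M = 1 → σ z = z ^ r := by
  have := Qcyc_cyc M
  have hζ := IsCyclotomicExtension.zeta_spec M ℚ (Qcyc M)
  refine ⟨((hζ.autToPow ℚ σ : (ZMod M)ˣ) : ZMod M).val, ZMod.val_coe_unit_coprime _, fun z hz => ?_⟩
  obtain ⟨k, _, rfl⟩ := hζ.eq_pow_of_pow_eq_one hz
  rw [map_pow, ← hζ.autToPow_spec ℚ σ, ← pow_mul, ← pow_mul, mul_comm]

lemma gal_exists (M : ℕ) [NeZero M] (r : ℕ) (hr : r.Coprime M) :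
    ∃ σ : Qcyc M ≃ₐ[ℚ] Qcyc M, ∀ z : Qcyc M, z ^ M = 1 → σ z = z ^ r := by
  have := Qcyc_cyc M
  have hζ := IsCyclotomicExtension.zeta_spec M ℚ (Qcyc M)
  have hirr : Irreducible (Polynomial.cyclotomic M ℚ) :=
    Polynomial.cyclotomic.irreducible_rat (NeZero.pos M)
  refine ⟨IsCyclotomicExtension.fromZetaAut (hζ.pow_of_coprime r hr) hirr, fun z hz => ?_⟩
  obtain ⟨k, _, rfl⟩ := hζ.eq_pow_of_pow_eq_one hz
  rw [map_pow, IsCyclotomicExtension.fromZetaAut_spec, ← pow_mul, ← pow_mul, mul_comm]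

lemma gal_agree {M d : ℕ} (hd : d ∣ M) (σ τ : Qcyc M ≃ₐ[ℚ] Qcyc M)
    (h : ∀ z : Qcyc M, z ^ d = 1 → σ z = τ z) (c : Qcyc M) (hc : (c : ℂ) ∈ Qcyc d) :
    σ c = τ c := by
  have key : ∀ x (_ : x ∈ Qcyc d) (hM : x ∈ Qcyc M), σ ⟨x, hM⟩ = τ ⟨x, hM⟩ := by
    intro x hx
    unfold Qcyc at hx
    induction hx using IntermediateField.adjoin_induction with
    | mem x hx =>
      intro hM
      exact h _ (Subtype.ext hx)
    | algebraMap x =>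
      intro hM
      have : (⟨algebraMap ℚ ℂ x, hM⟩ : Qcyc M) = algebraMap ℚ (Qcyc M) x := rfl
      rw [this, AlgEquiv.commutes, AlgEquiv.commutes]
    | add x y hx hy ih1 ih2 =>
      intro hM
      have h1 := Qcyc_mono hd hx
      have h2 := Qcyc_mono hd hy
      have : (⟨x + y, hM⟩ : Qcyc M) = ⟨x, h1⟩ + ⟨y, h2⟩ := rfl
      rw [this, map_add, map_add, ih1, ih2]
    | inv x hx ih =>
      intro hM
      have h1 := Qcyc_mono hd hx
      have : (⟨x⁻¹, hM⟩ : Qcyc M) = ⟨x, h1⟩⁻¹ := rfl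
      rw [this, map_inv₀, map_inv₀, ih]
    | mul x y hx hy ih1 ih2 =>
      intro hM
      have h1 := Qcyc_mono hd hx
      have h2 := Qcyc_mono hd hy
      have : (⟨x * y, hM⟩ : Qcyc M) = ⟨x, h1⟩ * ⟨y, h2⟩ := rfl
      rw [this, map_mul, map_mul, ih1, ih2]
  exact key c hc c.2

lemma gal_fix {M d : ℕ} [NeZero M] (hd : d ∣ M) (c : Qcyc M)
    (h : ∀ σ : Qcyc M ≃ₐ[ℚ] Qcyc M, (∀ z : Qcyc M, z ^ d = 1 → σ z = z) → σ c = c) :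
    (c : ℂ) ∈ Qcyc d := by
  obtain ⟨_, _⟩ := Qcyc_galois M
  let K : IntermediateField ℚ (Qcyc M) := (Qcyc d).comap (Qcyc M).val
  have hK := IsGalois.fixedField_fixingSubgroup K
  have : c ∈ K := by
    rw [← hK, IntermediateField.mem_fixedField_iff]
    intro σ hσ
    apply h
    intro z hz
    rw [IntermediateField.mem_fixingSubgroup_iff] at hσ
    apply hσ
    change (z : ℂ) ∈ Qcyc d
    exact mem_Qcyc_root (by exact_mod_cast congrArg Subtype.val hz)
  exact this

lemma modEq_of_fix {M d r : ℕ} (hd : d ∣ M) (hd0 : d ≠ 0)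
    (h : ∀ z : Qcyc M, z ^ d = 1 → z ^ r = z) : r ≡ 1 [MOD d] := by
  have hζ := Complex.isPrimitiveRoot_exp _ hd0
  set ζ := Complex.exp (2 * Real.pi * Complex.I / (d : ℕ))
  let z : Qcyc M := ⟨ζ, Qcyc_mono hd (mem_Qcyc_root hζ.pow_eq_one)⟩
  have hz : z ^ d = 1 := Subtype.ext hζ.pow_eq_one
  have h3 : ζ ^ r = ζ ^ 1 := by rw [pow_one]; exact congrArg Subtype.val (h z hz)
  have hu := (hζ.isUnit hd0).pow 1
  rcases le_total 1 r with hr | hr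
  · obtain ⟨k, rfl⟩ := Nat.exists_eq_add_of_le hr
    rw [pow_add] at h3
    have h4 : ζ ^ k = 1 := by
      have := hζ.ne_zero hd0
      rw [pow_one] at h3
      exact mul_left_cancel₀ this (by rw [h3, mul_one])
    have := (hζ.pow_eq_one_iff_dvd k).1 h4
    exact ((Nat.modEq_iff_dvd' hr).2 (by simpa using this)).symm
  · interval_cases r
    · rw [pow_zero, pow_one] at h3
      have : d ∣ 1 := (hζ.pow_eq_one_iff_dvd 1).1 (by rw [pow_one, ← h3])
      exact ((Nat.modEq_iff_dvd' hr).2 (by simpa using this))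
    · rfl

lemma mem_Qcyc_gcd {A B : ℕ} (hA : 0 < A) (hB : 0 < B) {c : ℂ} (h1 : c ∈ Qcyc A)
    (h2 : c ∈ Qcyc B) : c ∈ Qcyc (A.gcd B) := by
  have : NeZero (A.lcm B) := ⟨Nat.lcm_ne_zero hA.ne' hB.ne'⟩
  have hAM : A ∣ A.lcm B := Nat.dvd_lcm_left A B
  have hBM : B ∣ A.lcm B := Nat.dvd_lcm_right A B
  have hgM : A.gcd B ∣ A.lcm B := (Nat.gcd_dvd_left A B).trans hAM
  refine gal_fix hgM ⟨c, Qcyc_mono hAM h1⟩ fun σ hσ => ?_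
  obtain ⟨r, hr, hrσ⟩ := gal_pow _ σ
  have hrg : r ≡ 1 [MOD A.gcd B] := by
    have hg : A.gcd B ≠ 0 := (Nat.gcd_pos_of_pos_left B hA).ne'
    exact modEq_of_fix hgM hg fun z hz => (hrσ z (pow_one_of_dvd hgM hz)).symm.trans (hσ z hz)
  obtain ⟨k, hk1, hk2⟩ := Nat.chineseRemainder' hrg.symm
  have hkc : k.Coprime (A.lcm B) := by
    have : k.Coprime (A * B) := by
      apply Nat.Coprime.mul_right
      · have := hk1.gcd_eq
        rw [Nat.gcd_one_left] at this
        exact this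
      · have := hk2.gcd_eq
        unfold Nat.Coprime
        rw [this]
        exact Nat.Coprime.coprime_dvd_right hBM hr
    exact this.coprime_dvd_right (Nat.lcm_dvd_mul A B)
  obtain ⟨τ, hτ⟩ := gal_exists _ k hkc
  have e1 : σ ⟨c, Qcyc_mono hAM h1⟩ = τ ⟨c, Qcyc_mono hAM h1⟩ := by
    refine gal_agree hBM σ τ (fun z hz => ?_) _ h2
    rw [hrσ z (pow_one_of_dvd hBM hz), hτ z (pow_one_of_dvd hBM hz)]
    exact pow_eq_of_modEq hk2.symm hz
  have e2 : τ ⟨c, Qcyc_mono hAM h1⟩ = (AlgEquiv.refl : Qcyc (A.lcm B) ≃ₐ[ℚ] Qcyc (A.lcm B)) ⟨c, Qcyc_mono hAM h1⟩ := by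
    refine gal_agree hAM τ _ (fun z hz => ?_) _ h1
    rw [hτ z (pow_one_of_dvd hAM hz)]
    exact (pow_eq_of_modEq hk1 hz).trans (pow_one z)
  rw [e1, e2]
  rfl

lemma pow_modEq_lift {p a r : ℕ} (ha : 1 ≤ a) (h : r ≡ 1 [MOD p ^ a]) :
    r ^ p ≡ 1 [MOD p ^ (a + 1)] := by
  have h1 : ((p : ℤ) ^ a) ∣ (r : ℤ) - 1 := by
    have := (Nat.modEq_iff_dvd.1 h.symm)
    exact_mod_cast this
  have h2 : (p : ℤ) ∣ ∑ i ∈ Finset.range p, (r : ℤ) ^ i := by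
    have h3 : (p : ℤ) ∣ ∑ i ∈ Finset.range p, ((r : ℤ) ^ i - 1 ^ i) := by
      refine Finset.dvd_sum fun i _ => ?_
      exact ((dvd_pow_self (p : ℤ) (by omega)).trans h1).trans (sub_dvd_pow_sub_pow _ _ i)
    rw [Finset.sum_sub_distrib] at h3
    simpa using h3
  apply Nat.ModEq.symm
  rw [Nat.modEq_iff_dvd]
  push_cast
  have := mul_geom_sum (r : ℤ) p
  rw [← this, pow_succ]
  exact mul_dvd_mul h1 h2

lemma mem_zpowers_of_cyclic {Γ : Type*} [Group Γ] [Finite Γ] [IsCyclic Γ] {p : ℕ} (hp : 0 < p)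
    {τ σ : Γ} (hτ : orderOf τ = p) (hσ : σ ^ p = 1) : σ ∈ Subgroup.zpowers τ := by
  classical
  have : Fintype Γ := Fintype.ofFinite Γ
  have hle := IsCyclic.card_pow_eq_one_le (α := Γ) hp
  have hsub : (Subgroup.zpowers τ : Set Γ).toFinset ⊆
      Finset.univ.filter (fun x : Γ => x ^ p = 1) := by
    intro x hx
    rw [Set.mem_toFinset] at hx
    obtain ⟨k, rfl⟩ := Subgroup.mem_zpowers_iff.1 hx
    simp only [Finset.mem_filter, Finset.mem_univ, true_and]
    rw [← zpow_natCast, ← zpow_mul, mul_comm, zpow_mul, zpow_natCast, ← hτ, pow_orderOf_eq_one,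
      one_zpow]
  have heq := Finset.eq_of_subset_of_card_le hsub (by
    refine hle.trans ?_
    rw [Set.toFinset_card, ← Nat.card_eq_fintype_card]
    erw [Nat.card_zpowers]
    rw [hτ])
  have : σ ∈ Finset.univ.filter (fun x : Γ => x ^ p = 1) := by
    simp [hσ]
  rw [← heq, Set.mem_toFinset] at this
  exact this

/-- `ψ(c)` for `c` outside the smaller field -/
lemma not_dvd_relfinrank (p : ℕ) (hp : p.Prime) (hodd : Odd p) (a : ℕ) (ha : 1 ≤ a) (c : ℂ)
    (hc : c ∈ Qcyc (p ^ (a + 1))) (hc' : c ∉ Qcyc (p ^ a)) :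
    ¬ p ∣ (Qadj c).relfinrank (Qcyc (p ^ (a + 1))) := by
  have := Fact.mk hp
  have : NeZero (p ^ (a + 1)) := ⟨pow_ne_zero _ hp.ne_zero⟩
  obtain ⟨_, _⟩ := Qcyc_galois (p ^ (a + 1))
  have hcyc := Qcyc_cyc (p ^ (a + 1))
  intro hdvd
  have hG2 : @IsGalois ℚ _ (Qcyc (p ^ (a + 1))) _ (Qcyc (p ^ (a + 1))).algebra' := by
    assumption
  have h1 := IntermediateField.finrank_comap (A := Qadj c) (Qcyc (p ^ (a + 1))).val
  rw [IntermediateField.fieldRange_val] at h1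
  rw [← h1, ← IsGalois.card_fixingSubgroup_eq_finrank] at hdvd
  have hirr : Irreducible (Polynomial.cyclotomic (p ^ (a + 1)) ℚ) :=
    Polynomial.cyclotomic.irreducible_rat (NeZero.pos _)
  have hC : IsCyclic (Qcyc (p ^ (a + 1)) ≃ₐ[ℚ] Qcyc (p ^ (a + 1))) := by
    have := ZMod.isCyclic_units_of_prime_pow p hp (by rintro rfl; exact absurd hodd (by decide)) (a + 1)
    exact isCyclic_of_surjective (IsCyclotomicExtension.autEquivPow (Qcyc (p ^ (a + 1))) hirr).symm.toMonoidHom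
      (IsCyclotomicExtension.autEquivPow (Qcyc (p ^ (a + 1))) hirr).symm.surjective
  let H : Subgroup (Qcyc (p ^ (a + 1)) ≃ₐ[ℚ] Qcyc (p ^ (a + 1))) :=
    (IntermediateField.comap (Qcyc (p ^ (a + 1))).val (Qadj c)).fixingSubgroup
  replace hdvd : p ∣ Nat.card H := hdvd
  obtain ⟨τ, hτ⟩ := exists_prime_orderOf_dvd_card' p hdvd
  have hτ2 : orderOf (τ : Qcyc (p ^ (a + 1)) ≃ₐ[ℚ] Qcyc (p ^ (a + 1))) = p := by
    exact (Subgroup.orderOf_coe τ).trans hτ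
  apply hc'
  refine gal_fix (M := p ^ (a + 1)) (pow_dvd_pow p (Nat.le_succ a)) ⟨c, hc⟩ fun σ hσ => ?_
  have hσp : σ ^ p = 1 := by
    obtain ⟨r, hr, hrσ⟩ := gal_pow _ σ
    have hd : p ^ a ∣ p ^ (a + 1) := pow_dvd_pow p (Nat.le_succ a)
    have h2 : r ≡ 1 [MOD p ^ a] := modEq_of_fix hd (pow_ne_zero _ hp.ne_zero)
      fun z hz => (hrσ z (pow_one_of_dvd hd hz)).symm.trans (hσ z hz)
    have h3 := pow_modEq_lift ha h2
    have h4 : ∀ (k : ℕ) (z : Qcyc (p ^ (a + 1))), z ^ p ^ (a + 1) = 1 → (σ ^ k) z = z ^ (r ^ k) := by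
      intro k
      induction k with
      | zero => intro z hz; simp
      | succ k ih =>
        intro z hz
        rw [pow_succ' σ, AlgEquiv.mul_apply, ih z hz, map_pow, hrσ z hz, ← pow_mul, pow_succ' r]
    ext1 c
    refine gal_agree dvd_rfl (σ ^ p) 1 (fun z hz => ?_) c c.2
    rw [h4 p z hz, AlgEquiv.one_apply]
    exact (pow_eq_of_modEq h3 hz).trans (pow_one z)
  have hmem := mem_zpowers_of_cyclic hp.pos hτ2 hσp
  have hle := (Subgroup.zpowers_le.2 τ.2) hmem
  refine (IntermediateField.mem_fixingSubgroup_iff _ _).1 hle _ ?_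
  exact IntermediateField.mem_adjoin_simple_self ℚ c

theorem property13_of_core {G : Type*} [Group G] [Finite G] {V : Type*} [AddCommGroup V]
    [Module ℂ V] [FiniteDimensional ℂ V] (ρ : G →* (V →ₗ[ℂ] V)) (p : ℕ) (hp : p.Prime)
    (hodd : Odd p) (E n' : ℕ) (hn : Nat.card G = p ^ E * n')
    (hpn : ¬ p ∣ n')
    (core : ∀ s : ℕ, n' * p ∣ s →
      (∃ g₀, LinearMap.trace ℂ V (ρ (g₀ ^ (s + 1))) ≠ LinearMap.trace ℂ V (ρ g₀)) →
      ∃ g, (∃ j : ℕ, orderOf g = p ^ j) ∧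
        LinearMap.trace ℂ V (ρ (g ^ (s + 1))) ≠ LinearMap.trace ℂ V (ρ g)) :
    Property13 (fun g => LinearMap.trace ℂ V (ρ g)) p := by
  intro f hf
  obtain ⟨⟨hf0, hfmem⟩, hmin⟩ := hf
  have hmin' : ∀ N, 0 < N → (∀ g, LinearMap.trace ℂ V (ρ g) ∈ Qcyc N) → f ≤ N :=
    fun N h1 h2 => hmin ⟨h1, h2⟩
  have hn0 : 0 < Nat.card G := Nat.card_pos
  have hn'0 : 0 < n' := by
    rcases Nat.eq_zero_or_pos n' with h | h
    · rw [hn, h] at hn0; simp at hn0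
    · exact h
  obtain ⟨m, hm⟩ : ∃ m, f = p ^ f.factorization p * m := ⟨_, (Nat.ordProj_mul_ordCompl_eq_self f p).symm⟩
  have hpm : ¬ p ∣ m := by
    have := Nat.not_dvd_ordCompl hp hf0.ne'
    have h2 : f / p ^ f.factorization p = m := by
      conv_lhs => rw [hm]
      rw [← hm]
      exact Nat.div_eq_of_eq_mul_right (pow_pos hp.pos _) hm
    rwa [h2] at this
  rcases Nat.lt_or_ge (f.factorization p) 2 with ha | ha
  · refine ⟨1, ⟨0, by simp⟩, ?_⟩
    intro hd
    set a := f.factorization p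
    have : NeZero (p ^ a) := ⟨pow_ne_zero _ hp.ne_zero⟩
    have hcyc := Qcyc_cyc (p ^ a)
    have h1 : Module.finrank ℚ (Qcyc (p ^ a)) = (p ^ a).totient :=
      IsCyclotomicExtension.finrank _ (Polynomial.cyclotomic.irreducible_rat (NeZero.pos _))
    rw [← IntermediateField.inf_relfinrank_right] at hd
    have h2 := IntermediateField.finrank_bot_mul_relfinrank
      (inf_le_right : Qadj (LinearMap.trace ℂ V (ρ 1)) ⊓ Qcyc (p ^ a) ≤ Qcyc (p ^ a))
    have h3 : p ∣ (p ^ a).totient := by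
      rw [← h1]
      exact hd.trans ⟨_, (mul_comm _ _).trans h2 |>.symm⟩
    have h2p := hp.two_le
    interval_cases a
    · simp at h3; omega
    · rw [pow_one, Nat.totient_prime hp] at h3
      have := Nat.le_of_dvd (by omega) h3
      omega
  obtain ⟨a, ha'⟩ : ∃ a, f.factorization p = a + 1 := ⟨f.factorization p - 1, by omega⟩
  rw [ha'] at hm ⊢
  have ha1 : 1 ≤ a := by omega
  -- the big modulus
  set M := f * Nat.card G with hM
  have hM0 : NeZero M := ⟨Nat.mul_ne_zero hf0.ne' hn0.ne'⟩
  set d := n' * p ^ a with hd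
  have hdM : d ∣ M := by
    rw [hM, hn, hm, hd]
    exact ⟨p * m * p ^ E, by ring⟩
  have hd0 : 0 < d := Nat.mul_pos hn'0 (pow_pos hp.pos _)
  have hcM : Nat.card G ∣ M := ⟨f, mul_comm _ _⟩
  have hact : ∀ (σ : Qcyc M ≃ₐ[ℚ] Qcyc M) (r : ℕ) (_ : ∀ z : Qcyc M, z ^ M = 1 → σ z = z ^ r) (g : G)
      (c : Qcyc M) (_ : (c : ℂ) = LinearMap.trace ℂ V (ρ g)),
      ((σ c : Qcyc M) : ℂ) = LinearMap.trace ℂ V (ρ (g ^ r)) := by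
    intro σ r hr g c hc
    obtain ⟨ι, _, mu, z, hz, h⟩ := exists_roots ρ g (Nat.card G) hn0 (pow_card_eq_one')
    let z' : ι → Qcyc M := fun i => ⟨z i, Qcyc_mono hcM (mem_Qcyc_root (hz i))⟩
    have hz' : ∀ i, z' i ^ M = 1 := fun i => Subtype.ext (pow_one_of_dvd hcM (hz i))
    have hc2 : c = ∑ i, (mu i : Qcyc M) * z' i := by
      apply Subtype.ext
      have h1 := h 1
      rw [pow_one] at h1
      rw [hc, h1]
      push_cast
      simp [z']
    rw [hc2, map_sum, h r]
    push_cast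
    refine Finset.sum_congr rfl fun i _ => ?_
    rw [map_mul, map_natCast, hr _ (hz' i)]
    simp [z']
  have hval : ∀ g, LinearMap.trace ℂ V (ρ g) ∈ Qcyc M := fun g => Qcyc_mono ⟨_, rfl⟩ (hfmem g)
  have hstep : ∃ s, d ∣ s ∧ (s + 1).Coprime M ∧
      ∃ g₀, LinearMap.trace ℂ V (ρ (g₀ ^ (s + 1))) ≠ LinearMap.trace ℂ V (ρ g₀) := by
    by_contra hcon
    push Not at hcon
    have hmem : ∀ g, LinearMap.trace ℂ V (ρ g) ∈ Qcyc d := by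
      intro g
      refine gal_fix hdM ⟨_, hval g⟩ fun σ hσ => ?_
      obtain ⟨r, hr, hrσ⟩ := gal_pow _ σ
      have hrd : r ≡ 1 [MOD d] := modEq_of_fix hdM hd0.ne'
        fun z hz => (hrσ z (pow_one_of_dvd hdM hz)).symm.trans (hσ z hz)
      have hd1 : 1 < d := by
        have : 1 < p ^ a := Nat.one_lt_pow (by omega) hp.one_lt
        exact this.trans_le (Nat.le_mul_of_pos_left _ hn'0)
      have hr0 : 1 ≤ r := by
        rcases Nat.eq_zero_or_pos r with h | h
        · rw [h] at hrd
          have := (Nat.modEq_iff_dvd' (Nat.zero_le 1)).1 hrd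
          have := Nat.le_of_dvd (by omega) this
          omega
        · exact h
      have h1 := hcon (r - 1) ((Nat.modEq_iff_dvd' hr0).1 hrd.symm) (by rwa [Nat.sub_add_cancel hr0]) g
      rw [Nat.sub_add_cancel hr0] at h1
      apply Subtype.ext
      rw [hact σ r hrσ g _ rfl, h1]
    have h2 := hmin' (f.gcd d) (Nat.gcd_pos_of_pos_left _ hf0)
      fun g => mem_Qcyc_gcd hf0 hd0 (hfmem g) (hmem g)
    have h3 : f.gcd d = f := le_antisymm (Nat.le_of_dvd hf0 (Nat.gcd_dvd_left _ _)) h2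
    have h4 : f ∣ d := by rw [← h3]; exact Nat.gcd_dvd_right _ _
    have h5 : p ^ a * p ∣ p ^ a * n' := by
      rw [← pow_succ, mul_comm _ n']
      exact (Dvd.intro _ hm.symm).trans h4
    exact hpn (Nat.dvd_of_mul_dvd_mul_left (pow_pos hp.pos _) h5)
  obtain ⟨s, hs1, hs2, hs3⟩ := hstep
  obtain ⟨g, ⟨j, hj⟩, hg⟩ := core s (dvd_trans (mul_dvd_mul_left n' (dvd_pow_self p (by omega))) hs1) hs3
  refine ⟨g, ⟨j, hj⟩, not_dvd_relfinrank p hp hodd a ha1 _ ?_ ?_⟩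
  · have h1 : LinearMap.trace ℂ V (ρ g) ∈ Qcyc (p ^ j) := by
      obtain ⟨ι, _, mu, z, hz, h⟩ := exists_roots ρ g (p ^ j) (pow_pos hp.pos _)
        (by rw [← hj, pow_orderOf_eq_one])
      have h1 := h 1
      rw [pow_one] at h1
      rw [h1]
      refine sum_mem fun i _ => mul_mem (natCast_mem _ _) (pow_mem (mem_Qcyc_root (hz i)) _)
    have h2 := mem_Qcyc_gcd hf0 (pow_pos hp.pos _) (hfmem g) h1
    refine Qcyc_mono ?_ h2
    rw [hm]
    have hc : Nat.Coprime (p ^ j) m := Nat.Coprime.pow_left _ ((Nat.Prime.coprime_iff_not_dvd hp).2 hpm)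
    rw [Nat.Coprime.gcd_mul_right_cancel _ hc.symm]
    exact Nat.gcd_dvd_left _ _
  · intro hmem
    obtain ⟨σ, hσ⟩ := gal_exists M (s + 1) hs2
    apply hg
    rw [← hact σ (s + 1) hσ g ⟨_, hval g⟩ rfl]
    have hpd : p ^ a ∣ d := ⟨n', mul_comm _ _⟩
    have := gal_agree (hpd.trans hdM) σ AlgEquiv.refl (fun z hz => by
      rw [hσ z (pow_one_of_dvd (hpd.trans hdM) hz), pow_succ,
        pow_one_of_dvd (hpd.trans hs1) hz, one_mul]; rfl) ⟨_, hval g⟩ hmem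
    rw [this]
    rfl

section ThmA
open Module

lemma sum_delta_T_le {G : Type*} [Group G] [Fintype G] (T N : Subgroup G) [Fintype T] [Fintype N]
    (δ : G → ℝ) (h0 : ∀ g, 0 ≤ δ g) (hcl : ∀ g h, δ (h * g * h⁻¹) = δ g)
    (hconj : ∀ t ∈ T, δ t ≠ 0 → ∀ n, n⁻¹ * t * n ∈ T → n ∈ N) :
    (Fintype.card G : ℝ) * ∑ t : T, δ t ≤ Fintype.card N * ∑ g, δ g := by
  classical
  have h1 : (Fintype.card G : ℝ) * ∑ t : T, δ t = ∑ h : G, ∑ g : G, if h⁻¹ * g * h ∈ T then δ g else 0 := by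
    have : ∀ h : G, ∑ g : G, (if h⁻¹ * g * h ∈ T then δ g else 0) = ∑ t : T, δ t := by
      intro h
      have e : ∑ g : G, (if h⁻¹ * g * h ∈ T then δ g else 0) = ∑ g : G, if g ∈ T then δ g else 0 := by
        refine Fintype.sum_equiv (MulAut.conj h⁻¹).toEquiv _ _ fun g => ?_
        simp only [MulEquiv.toEquiv_eq_coe, EquivLike.coe_coe, MulAut.conj_apply, inv_inv]
        have := hcl g h⁻¹
        rw [inv_inv] at this
        rw [this]
      rw [e, ← Finset.sum_filter]
      exact (Finset.sum_subtype _ (by simp) _)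
    rw [Finset.sum_congr rfl (fun h _ => this h), Finset.sum_const, Finset.card_univ, nsmul_eq_mul]
  rw [h1, Finset.sum_comm, Finset.mul_sum]
  refine Finset.sum_le_sum fun g _ => ?_
  rw [← Finset.sum_filter, Finset.sum_const, nsmul_eq_mul]
  by_cases hg : δ g = 0
  · simp [hg]
  refine mul_le_mul_of_nonneg_right ?_ (h0 g)
  norm_cast
  rcases Finset.eq_empty_or_nonempty (Finset.univ.filter fun h : G => h⁻¹ * g * h ∈ T) with he | ⟨a, ha⟩
  · rw [he]; simp
  simp only [Finset.mem_filter, Finset.mem_univ, true_and] at ha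
  rw [← Fintype.card_coe]
  have key : ∀ h : G, h⁻¹ * g * h ∈ T → a⁻¹ * h ∈ N := by
    intro h hh
    refine hconj (a⁻¹ * g * a) ha ?_ _ ?_
    · have := hcl g a⁻¹
      rw [inv_inv] at this
      rw [this]; exact hg
    · convert hh using 1
      group
  refine Fintype.card_le_of_injective
    (fun h : (Finset.univ.filter fun h : G => h⁻¹ * g * h ∈ T) => (⟨a⁻¹ * h.1, key h.1 (Finset.mem_filter.1 h.2).2⟩ : N)) ?_
  intro x y hxy
  have := congrArg Subtype.val hxy
  simp only [mul_right_inj] at this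
  exact Subtype.ext this

/-- D < 4 -/
lemma sum_delta_lt {G : Type*} [Group G] [Fintype G] (χ : G → ℂ) (r : ℕ)
    (hr : (Nat.card G).Coprime r) (hχ : ∑ g, ‖χ g‖ ^ 2 = Fintype.card G) (h1 : χ 1 ≠ 0) :
    ∑ g, ‖χ g - χ (g ^ r)‖ ^ 2 < 4 * Fintype.card G := by
  have e1 : ∑ g, ‖χ (g ^ r)‖ ^ 2 = Fintype.card G := by
    rw [← hχ]
    exact Fintype.sum_equiv (powCoprime hr) _ _ fun g => by simp
  have e2 : ∑ g, ‖χ g - χ (g ^ r)‖ ^ 2 + ∑ g, ‖χ g + χ (g ^ r)‖ ^ 2 = 4 * Fintype.card G := by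
    rw [← Finset.sum_add_distrib]
    have : ∀ g, ‖χ g - χ (g ^ r)‖ ^ 2 + ‖χ g + χ (g ^ r)‖ ^ 2 = 2 * ‖χ g‖ ^ 2 + 2 * ‖χ (g ^ r)‖ ^ 2 := by
      intro g
      have := parallelogram_law_with_norm ℝ (χ g) (χ (g ^ r))
      nlinarith [this]
    rw [Finset.sum_congr rfl fun g _ => this g, Finset.sum_add_distrib, ← Finset.mul_sum,
      ← Finset.mul_sum, hχ, e1]
    ring
  have e3 : 0 < ∑ g, ‖χ g + χ (g ^ r)‖ ^ 2 := by
    refine Finset.sum_pos' (fun g _ => by positivity) ⟨1, Finset.mem_univ _, ?_⟩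
    rw [one_pow, ← two_mul]
    have : 2 * χ 1 ≠ 0 := mul_ne_zero two_ne_zero h1
    positivity
  linarith

/-- orthogonality of characters -/
lemma sum_dual_orth {A : Type*} [CommGroup A] [Fintype A] [DecidableEq (A →* ℂˣ)] (ψ φ : A →* ℂˣ) :
    ∑ a, ((ψ a : ℂˣ) : ℂ) * ((φ a⁻¹ : ℂˣ) : ℂ) = if ψ = φ then (Fintype.card A : ℂ) else 0 := by
  classical
  have := sum_hom_units (R := ℂ) ((Units.coeHom ℂ).comp (ψ * φ⁻¹))
  have h2 : (Units.coeHom ℂ).comp (ψ * φ⁻¹) = 1 ↔ ψ = φ := by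
    constructor
    · intro h
      ext a
      have h3 := DFunLike.congr_fun h a
      simp only [MonoidHom.comp_apply, Units.coeHom_apply, MonoidHom.mul_apply, MonoidHom.inv_apply,
        MonoidHom.one_apply, Units.val_eq_one] at h3
      rw [mul_inv_eq_one] at h3
      rw [h3]
    · rintro rfl
      ext a
      simp
  simp only [h2] at this
  by_cases h : ψ = φ
  · rw [if_pos h] at this ⊢
    rw [← this]; simp
  · rw [if_neg h] at this ⊢
    rw [Nat.cast_zero] at this
    rw [← this]; simp

/-- Parseval -/
lemma dual_parseval {A : Type*} [CommGroup A] [Fintype A] [Fintype (A →* ℂˣ)] (c : (A →* ℂˣ) → ℤ)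
    (δ : A → ℂ) (hδ : ∀ a, δ a = ∑ ψ, (c ψ : ℂ) * ((ψ a : ℂˣ) : ℂ)) :
    ∑ a, ‖δ a‖ ^ 2 = Fintype.card A * ∑ ψ, (c ψ : ℝ) ^ 2 := by
  classical
  have hconj : ∀ (ψ : A →* ℂˣ) a, (starRingEnd ℂ) ((ψ a : ℂˣ) : ℂ) = ((ψ a⁻¹ : ℂˣ) : ℂ) := by
    intro ψ a
    rw [← root_conj (N := Fintype.card A) Fintype.card_pos]
    · simp
    · rw [← Units.val_pow_eq_pow_val, ← map_pow, pow_card_eq_one, map_one, Units.val_one]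
  have : (∑ a, ‖δ a‖ ^ 2 : ℂ) = Fintype.card A * ∑ ψ, (c ψ : ℂ) ^ 2 := by
    have h1 : ∀ a, ((‖δ a‖ : ℂ)) ^ 2 = ∑ ψ, ∑ φ, ((c ψ : ℂ) * c φ) * (((ψ a : ℂˣ) : ℂ) * ((φ a⁻¹ : ℂˣ) : ℂ)) := by
      intro a
      rw [← Complex.mul_conj', hδ a, map_sum, Finset.sum_mul_sum]
      refine Finset.sum_congr rfl fun ψ _ => Finset.sum_congr rfl fun φ _ => ?_
      rw [map_mul, hconj]
      rw [map_intCast]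
      ring
    rw [Finset.sum_congr rfl fun a _ => h1 a, Finset.sum_comm, Finset.mul_sum]
    refine Finset.sum_congr rfl fun ψ _ => ?_
    rw [Finset.sum_comm, Finset.sum_eq_single ψ]
    · rw [← Finset.mul_sum, sum_dual_orth, if_pos rfl]; ring
    · intro φ _ hφ
      rw [← Finset.mul_sum, sum_dual_orth, if_neg hφ.symm, mul_zero]
    · simp
  exact_mod_cast this

end ThmA

section ThmB
open Module
variable {G : Type*} [Group G]

/-- conjugation of `T` by an element of the normalizer -/
def conjT (T : Subgroup G) (n : Subgroup.normalizer (T : Set G)) : T →* T where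
  toFun t := ⟨(n : G)⁻¹ * t * n, (Subgroup.mem_normalizer_iff''.1 n.2 t).1 t.2⟩
  map_one' := by ext; simp
  map_mul' a b := by ext; simp [mul_assoc]

lemma conjT_coe (T : Subgroup G) (n : Subgroup.normalizer (T : Set G)) (t : T) :
    ((conjT T n t : T) : G) = (n : G)⁻¹ * t * n := rfl

/-- action of the normalizer on linear characters of `T` -/
@[reducible]
def twistAction (T : Subgroup G) : MulAction (Subgroup.normalizer (T : Set G)) (T →* ℂˣ) where
  smul n ψ := ψ.comp (conjT T n)
  one_smul ψ := by
    change ψ.comp (conjT T 1) = ψ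
    ext t
    simp only [MonoidHom.comp_apply]
    congr 2
    ext
    simp [conjT_coe]
  mul_smul a b ψ := by
    change ψ.comp (conjT T (a * b)) = (ψ.comp (conjT T b)).comp (conjT T a)
    ext t
    simp only [MonoidHom.comp_apply]
    congr 2
    ext
    simp [conjT_coe, mul_assoc]

lemma twist_free [Fintype G] (T : Subgroup G) (hcomm : ∀ x y : T, x * y = y * x) (q : ℕ)
    (hb : ∀ z ∈ T, z ≠ 1 → z ^ q = 1 → ∀ x, x * z = z * x → x ∈ T)
    (n : Subgroup.normalizer (T : Set G)) (μ : T →* ℂˣ) (hμ : ∃ x : T, x ^ q = 1 ∧ μ x ≠ 1)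
    (hfix : ∀ x : T, x ^ q = 1 → μ (conjT T n x) = μ x) : (n : G) ∈ T := by
  by_contra hn
  let _ : CommGroup T := { (inferInstance : Group T) with mul_comm := hcomm }
  let Tq : Subgroup T := (powMonoidHom q : T →* T).ker
  have hTq : ∀ x : T, x ∈ Tq ↔ x ^ q = 1 := fun x => by simp [Tq, MonoidHom.mem_ker]
  let f : Tq → Tq := fun x => ⟨(x : T)⁻¹ * conjT T n x, by
    refine mul_mem (inv_mem x.2) ?_
    rw [hTq, ← map_pow, (hTq _).1 x.2, map_one]⟩
  have hinj : Function.Injective f := by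
    intro x y hxy
    have h1 : (x : T)⁻¹ * conjT T n x = (y : T)⁻¹ * conjT T n y := congrArg Subtype.val hxy
    have h2 : conjT T n (x * (y : T)⁻¹) = x * (y : T)⁻¹ := by
      rw [map_mul, map_inv]
      have : conjT T n x = x * ((y : T)⁻¹ * conjT T n y) := by rw [← h1]; group
      rw [this, mul_assoc, mul_assoc, mul_inv_cancel, mul_one]
    by_contra hne
    apply hn
    have h3 : (x * (y : T)⁻¹ : T) ≠ 1 := by
      intro h
      exact hne (Subtype.ext (mul_inv_eq_one.1 h))
    refine hb _ (x * (y : T)⁻¹ : T).2 (fun h => h3 (Subtype.ext h)) ?_ n ?_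
    · have h4 : (x * (y : T)⁻¹ : T) ^ q = 1 := (hTq _).1 (mul_mem x.2 (inv_mem y.2))
      exact_mod_cast congrArg (Subtype.val) h4
    · have := congrArg Subtype.val h2
      rw [conjT_coe] at this
      rw [mul_assoc, inv_mul_eq_iff_eq_mul] at this
      exact this.symm
  obtain ⟨x, hx, hx1⟩ := hμ
  obtain ⟨y, hy⟩ := (Finite.injective_iff_surjective.1 hinj) ⟨x, (hTq x).2 hx⟩
  have hy' : (y : T)⁻¹ * conjT T n y = x := congrArg Subtype.val hy
  apply hx1
  rw [← hy', map_mul, map_inv, hfix y ((hTq _).1 y.2), inv_mul_cancel]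

/-- the combinatorial part -/
lemma orbit_unique {N X : Type*} [Group N] [Fintype N] [Fintype X] [MulAction N X] (t : ℕ)
    (c : X → ℤ) (hsum : ∑ x, c x = 0) (hsq : (t : ℤ) * ∑ x, c x ^ 2 < 4 * Fintype.card N)
    (hinv : ∀ (n : N) x, c (n • x) = c x)
    (hst : ∀ x, c x ≠ 0 → Nat.card (MulAction.stabilizer N x) ≤ t)
    (x y : X) (hx : c x < 0) (hy : c y < 0) : ∃ n : N, n • x = y := by
  classical
  by_contra hcon
  have hy' : y ∉ MulAction.orbit N x := fun ⟨n, hn⟩ => hcon ⟨n, hn⟩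
  have hdisj : Disjoint (MulAction.orbit N x).toFinset (MulAction.orbit N y).toFinset := by
    rw [Finset.disjoint_left]
    intro z hz1 hz2
    rw [Set.mem_toFinset] at hz1 hz2
    apply hy'
    rw [← MulAction.orbit_eq_iff] at hz1 hz2
    rw [← MulAction.orbit_eq_iff, ← hz2, hz1]
  have hcard : ∀ z, c z < 0 → Fintype.card N ≤ t * (MulAction.orbit N z).toFinset.card := by
    intro z hz
    rw [Set.toFinset_card, ← MulAction.card_orbit_mul_card_stabilizer_eq_card_group N z, mul_comm]
    refine Nat.mul_le_mul_right _ ?_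
    rw [← Nat.card_eq_fintype_card]
    exact hst z hz.ne
  have hneg : ∀ z, c z < 0 → ∀ u ∈ (MulAction.orbit N z).toFinset, |c u| - c u ≥ 2 := by
    intro z hz u hu
    rw [Set.mem_toFinset] at hu
    obtain ⟨n, rfl⟩ := hu
    have := hinv n z
    simp only at this ⊢
    rw [this, abs_of_neg hz]
    omega
  have h1 : ∑ x, c x ^ 2 ≥ ∑ x, (|c x| - c x) := by
    rw [Finset.sum_sub_distrib, hsum, sub_zero]
    refine Finset.sum_le_sum fun x _ => ?_
    rw [← sq_abs]
    nlinarith [abs_nonneg (c x), Int.natAbs_sq (c x), sq_nonneg (|c x|), 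
      (by rcases (abs_nonneg (c x)).eq_or_lt with h | h <;> nlinarith : 0 ≤ |c x| * (|c x| - 1))]
  have h2 : ∑ x, (|c x| - c x) ≥ 2 * (MulAction.orbit N x).toFinset.card
      + 2 * (MulAction.orbit N y).toFinset.card := by
    calc ∑ x, (|c x| - c x) ≥ ∑ u ∈ (MulAction.orbit N x).toFinset ∪ (MulAction.orbit N y).toFinset, (|c u| - c u) :=
          Finset.sum_le_sum_of_subset_of_nonneg (Finset.subset_univ _) fun i _ _ => by
            have := le_abs_self (c i); omega
      _ = ∑ u ∈ (MulAction.orbit N x).toFinset, (|c u| - c u) + ∑ u ∈ (MulAction.orbit N y).toFinset, (|c u| - c u) :=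
          Finset.sum_union hdisj
      _ ≥ _ := by
          have a1 := Finset.card_nsmul_le_sum _ _ _ (hneg x hx)
          have a2 := Finset.card_nsmul_le_sum _ _ _ (hneg y hy)
          simp only [nsmul_eq_mul] at a1 a2
          linarith
  have h3 := hcard x hx
  have h4 := hcard y hy
  zify at h3 h4
  have ht : (0 : ℤ) ≤ t := by positivity
  nlinarith [mul_le_mul_of_nonneg_left (h2.le.trans h1.le) ht]

end ThmB

section ThmC
open Module

lemma exists_inv_pow {n r : ℕ} (hn : 0 < n) (hr : r.Coprime n) :
    ∃ k, 1 ≤ k ∧ r ^ k ≡ 1 [MOD n] :=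
  ⟨n.totient, Nat.totient_pos.2 hn, Nat.ModEq.pow_totient hr⟩

lemma dvd_succ_pow_sub {d s : ℕ} (hd : d ∣ s) (k : ℕ) : ∃ S, (s + 1) ^ k = S + 1 ∧ d ∣ S := by
  induction k with
  | zero => exact ⟨0, by simp, dvd_zero _⟩
  | succ k ih =>
    obtain ⟨S, h1, h2⟩ := ih
    refine ⟨S * (s + 1) + s, by rw [pow_succ, h1]; ring, ?_⟩
    exact dvd_add (h2.mul_right _) hd

lemma exists_neg_restrict {A : Type*} [CommGroup A] [Fintype A] [Fintype (A →* ℂˣ)]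
    (c : (A →* ℂˣ) → ℤ) (δ : A → ℂ) (hδ : ∀ a, δ a = ∑ ψ, (c ψ : ℂ) * ((ψ a : ℂˣ) : ℂ))
    (H : Subgroup A) (hH : ∀ x ∈ H, δ x = 0) (ψ₁ : A →* ℂˣ) (h : 0 < c ψ₁) :
    ∃ φ, c φ < 0 ∧ ∀ x ∈ H, φ x = ψ₁ x := by
  classical
  have h1 : ∑ x : H, δ x * ((ψ₁ (x : A)⁻¹ : ℂˣ) : ℂ) = 0 :=
    Finset.sum_eq_zero fun x _ => by rw [hH x x.2, zero_mul]
  have h2 : ∑ x : H, δ x * ((ψ₁ (x : A)⁻¹ : ℂˣ) : ℂ) =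
      ∑ φ, (c φ : ℂ) * (if φ.comp H.subtype = ψ₁.comp H.subtype then (Fintype.card H : ℂ) else 0) := by
    have : ∀ x : H, δ x * ((ψ₁ (x : A)⁻¹ : ℂˣ) : ℂ)
        = ∑ φ, (c φ : ℂ) * ((((φ.comp H.subtype) x : ℂˣ) : ℂ) * (((ψ₁.comp H.subtype) x⁻¹ : ℂˣ) : ℂ)) := by
      intro x
      rw [hδ x, Finset.sum_mul]
      refine Finset.sum_congr rfl fun φ _ => ?_
      simp only [MonoidHom.comp_apply, Subgroup.coe_subtype, Subgroup.coe_inv]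
      ring
    rw [Finset.sum_congr rfl fun x _ => this x, Finset.sum_comm]
    refine Finset.sum_congr rfl fun φ _ => ?_
    rw [← Finset.mul_sum, sum_dual_orth]
  rw [h1] at h2
  have h3 : ∑ φ, c φ * (if φ.comp H.subtype = ψ₁.comp H.subtype then (Fintype.card H : ℤ) else 0) = 0 := by
    have := h2.symm
    exact_mod_cast this
  by_contra hcon
  push Not at hcon
  have hc : (0 : ℤ) < Fintype.card H := by exact_mod_cast Fintype.card_pos
  have h4 := (Finset.sum_eq_zero_iff_of_nonneg (fun φ _ => ?_)).1 h3 ψ₁ (Finset.mem_univ _)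
  · rw [if_pos rfl] at h4
    have := mul_pos h hc
    omega
  · split_ifs with hφ
    · refine mul_nonneg ?_ hc.le
      by_contra hneg
      obtain ⟨x, hx, hx'⟩ := hcon φ (by omega)
      exact hx' (DFunLike.congr_fun hφ ⟨x, hx⟩)
    · simp

theorem thmA_T {G : Type*} [Group G] [Fintype G] {V : Type*} [AddCommGroup V]
    [Module ℂ V] [FiniteDimensional ℂ V] (ρ : G →* (V →ₗ[ℂ] V)) (p : ℕ) (hp : p.Prime)
    (E n' : ℕ) (hn : Nat.card G = p ^ E * n') (hpn : ¬ p ∣ n') (s : ℕ) (hs : n' * p ∣ s)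
    (hχ : ∑ g, ‖LinearMap.trace ℂ V (ρ g)‖ ^ 2 = Fintype.card G)
    (h1 : LinearMap.trace ℂ V (ρ 1) ≠ 0)
    (T : Subgroup G) (hcomm : ∀ x y : T, x * y = y * x)
    (hb : ∀ z ∈ T, z ≠ 1 → z ^ p ^ E = 1 → ∀ x, x * z = z * x → x ∈ T)
    (hyp : ∀ x : T, x ^ p ^ E = 1 →
      LinearMap.trace ℂ V (ρ (x ^ (s + 1))) = LinearMap.trace ℂ V (ρ x)) (t : T) :
    LinearMap.trace ℂ V (ρ (t ^ (s + 1))) = LinearMap.trace ℂ V (ρ t) := by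
  classical
  have hcard0 : 0 < Nat.card G := Nat.card_pos
  let _ : CommGroup T := { (inferInstance : Group T) with mul_comm := hcomm }
  have : Fintype (T →* ℂˣ) := Fintype.ofFinite _
  set χ : G → ℂ := fun g => LinearMap.trace ℂ V (ρ g) with hχdef
  set r := s + 1 with hr
  have hsn : n' ∣ s := (Dvd.intro _ rfl).trans hs
  have hsp : p ∣ s := (Dvd.intro_left _ rfl).trans hs
  -- r coprime to |G|
  have hcop : r.Coprime (Nat.card G) := by
    rw [hn]
    refine Nat.Coprime.mul_right (Nat.Coprime.pow_right _ ?_) ?_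
    · obtain ⟨k, rfl⟩ := hsp
      rw [hr]
      simp
    · obtain ⟨k, rfl⟩ := hsn
      rw [hr]
      simp
  obtain ⟨k, hk1, hk⟩ := exists_inv_pow hcard0 hcop
  set r' := r ^ (k - 1) with hr'
  have hrr : r' * r ≡ 1 [MOD Nat.card G] := by
    rw [hr', ← pow_succ, Nat.sub_add_cancel hk1]; exact hk
  -- powers in the dual
  have hTG : Nat.card T ∣ Nat.card G := Subgroup.card_subgroup_dvd_card T
  have hXpow : ∀ ψ : T →* ℂˣ, ψ ^ Nat.card G = 1 := by
    intro ψ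
    ext x
    rw [MonoidHom.pow_apply, ← map_pow, pow_one_of_dvd hTG (pow_card_eq_one'), map_one,
      MonoidHom.one_apply]
  have hpm : ∀ (ψ : T →* ℂˣ) (a b : ℕ), (ψ ^ a) ^ b = ψ ^ (a * b) := by
    intro ψ a b
    ext x
    simp only [MonoidHom.pow_apply, pow_mul]
  have hp1 : ∀ ψ : T →* ℂˣ, ψ ^ 1 = ψ := by
    intro ψ
    ext x
    simp only [MonoidHom.pow_apply, pow_one]
  have hXmod : ∀ (ψ : T →* ℂˣ) {a b : ℕ}, a ≡ b [MOD Nat.card G] → ψ ^ a = ψ ^ b := by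
    intro ψ a b hab
    ext x
    have h0 := DFunLike.congr_fun (hXpow ψ) x
    simp only [MonoidHom.pow_apply, MonoidHom.one_apply] at h0 ⊢
    rw [pow_eq_of_modEq hab h0]
  have hXrr : ∀ ψ : T →* ℂˣ, (ψ ^ r') ^ r = ψ := by
    intro ψ
    rw [hpm, hXmod ψ hrr, hp1]
  have hXrr2 : ∀ ψ : T →* ℂˣ, (ψ ^ r) ^ r' = ψ := by
    intro ψ
    rw [hpm, mul_comm, ← hpm, hXrr]
  let e : (T →* ℂˣ) ≃ (T →* ℂˣ) := ⟨fun ψ => ψ ^ r', fun ψ => ψ ^ r, hXrr, hXrr2⟩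
  obtain ⟨m, hm⟩ := exists_mult (ρ.comp T.subtype)
  have hm' : ∀ a : T, χ a = ∑ ψ, (m ψ : ℂ) * ((ψ a : ℂˣ) : ℂ) := hm
  let c : (T →* ℂˣ) → ℤ := fun ψ => (m ψ : ℤ) - m (ψ ^ r')
  have hδ : ∀ a : T, χ a - χ ((a : G) ^ r) = ∑ ψ, (c ψ : ℂ) * ((ψ a : ℂˣ) : ℂ) := by
    intro a
    have h2 : χ ((a : G) ^ r) = ∑ ψ, (m (ψ ^ r') : ℂ) * ((ψ a : ℂˣ) : ℂ) := by
      have := hm' (a ^ r)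
      rw [Subgroup.coe_pow] at this
      rw [this]
      refine (Fintype.sum_equiv e _ _ fun ψ => ?_).symm
      simp only [e, Equiv.coe_fn_mk]
      rw [map_pow, ← MonoidHom.pow_apply, hXrr]
    rw [h2, hm' a, ← Finset.sum_sub_distrib]
    refine Finset.sum_congr rfl fun ψ _ => ?_
    simp only [c]
    push_cast
    ring
  have hcl : ∀ g h : G, χ (h * g * h⁻¹) = χ g := by
    intro g h
    simp only [hχdef]
    rw [map_mul, LinearMap.trace_mul_comm, ← map_mul]
    congr 2
    group
  -- p-part
  have hpart : ∀ g : G, (g ^ s) ^ p ^ E = 1 := by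
    intro g
    rw [← pow_mul]
    refine pow_one_of_dvd ?_ (pow_card_eq_one' (x := g))
    rw [hn, mul_comm]
    exact mul_dvd_mul_right hsn _
  let N := Subgroup.normalizer (T : Set G)
  -- Fourier inversion
  have hcF : ∀ ψ, (Fintype.card T : ℂ) * c ψ = ∑ a : T, (χ a - χ ((a : G) ^ r)) * ((ψ a⁻¹ : ℂˣ) : ℂ) := by
    intro ψ
    have : ∀ a : T, (χ a - χ ((a : G) ^ r)) * ((ψ a⁻¹ : ℂˣ) : ℂ)
        = ∑ φ, (c φ : ℂ) * (((φ a : ℂˣ) : ℂ) * ((ψ a⁻¹ : ℂˣ) : ℂ)) := by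
      intro a
      rw [hδ a, Finset.sum_mul]
      exact Finset.sum_congr rfl fun φ _ => by ring
    rw [Finset.sum_congr rfl fun a _ => this a, Finset.sum_comm, Finset.sum_eq_single ψ]
    · rw [← Finset.mul_sum, sum_dual_orth, if_pos rfl]; ring
    · intro φ _ hφ
      rw [← Finset.mul_sum, sum_dual_orth, if_neg hφ, mul_zero]
    · simp
  let _ := twistAction T
  have hsmul : ∀ (n : N) (ψ : T →* ℂˣ) (a : T), (n • ψ) a = ψ (conjT T n a) := fun _ _ _ => rfl
  have hinv : ∀ (n : N) ψ, c (n • ψ) = c ψ := by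
    intro n ψ
    have h3 : (Fintype.card T : ℂ) * c (n • ψ) = (Fintype.card T : ℂ) * c ψ := by
      rw [hcF, hcF]
      have hbij : Function.Bijective (conjT T n) := by
        rw [← Finite.injective_iff_bijective]
        intro x y hxy
        have := congrArg Subtype.val hxy
        rw [conjT_coe, conjT_coe] at this
        exact Subtype.ext (by simpa using this)
      refine Fintype.sum_bijective _ hbij _ _ fun a => ?_
      rw [hsmul, conjT_coe, map_inv (conjT T n)]
      congr 1
      have e1 := hcl a (n : G)⁻¹
      have e2 := hcl ((a : G) ^ r) (n : G)⁻¹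
      rw [inv_inv] at e1 e2
      rw [e1]
      have : ((n : G)⁻¹ * a * n) ^ r = (n : G)⁻¹ * (a : G) ^ r * n := by
        have := conj_pow (i := r) (a := (n : G)⁻¹) (b := (a : G))
        rwa [inv_inv] at this
      rw [this, e2]
    have h4 : (Fintype.card T : ℂ) ≠ 0 := Nat.cast_ne_zero.2 Fintype.card_ne_zero
    exact_mod_cast mul_left_cancel₀ h4 h3
  have hnontriv : ∀ ψ, c ψ ≠ 0 → ∃ x : T, x ^ p ^ E = 1 ∧ ψ x ≠ 1 := by
    intro ψ hψ
    by_contra hcon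
    push Not at hcon
    apply hψ
    have : ψ ^ r = ψ := by
      ext a
      rw [MonoidHom.pow_apply, hr, pow_succ, ← map_pow, hcon (a ^ s) (by
        apply Subtype.ext; simpa using hpart a), one_mul]
    have h5 : ψ ^ r' = ψ := by
      conv_lhs => rw [← this]
      exact hXrr2 ψ
    simp only [c, h5, sub_self]
  have hst : ∀ ψ, c ψ ≠ 0 → Nat.card (MulAction.stabilizer N ψ) ≤ Fintype.card T := by
    intro ψ hψ
    have key : ∀ n : MulAction.stabilizer N ψ, ((n : N) : G) ∈ T := by
      intro n
      refine twist_free T hcomm (p ^ E) hb n ψ (hnontriv ψ hψ) fun x _ => ?_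
      rw [← hsmul, MulAction.mem_stabilizer_iff.1 n.2]
    rw [← Nat.card_eq_fintype_card]
    refine Nat.card_le_card_of_injective (fun n => (⟨((n : N) : G), key n⟩ : T)) ?_
    intro x y hxy
    have h6 := congrArg (fun z : T => (z : G)) hxy
    exact Subtype.ext (Subtype.ext h6)
  have hsum0 : ∑ ψ, c ψ = 0 := by
    have := hδ 1
    simp only [Subgroup.coe_one, one_pow, sub_self, map_one, Units.val_one, mul_one] at this
    exact_mod_cast this.symm
  have hsq : (Fintype.card T : ℤ) * ∑ ψ, c ψ ^ 2 < 4 * Fintype.card N := by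
    have a1 := sum_delta_lt χ r hcop.symm hχ h1
    have a2 := sum_delta_T_le T N (fun g => ‖χ g - χ (g ^ r)‖ ^ 2) (fun g => by positivity)
      (fun g h => by
        rw [conj_pow, hcl, hcl]) (fun x hx hδx n hn => by
        have hxs : x ^ s ≠ 1 := by
          intro h
          apply hδx
          have h7 : x ^ (s + 1) = x := by rw [pow_succ, h, one_mul]
          simp only [hr, h7, sub_self, norm_zero]
          norm_num
        have hcommT : ∀ y, y ∈ T ↔ y * (x ^ s) = (x ^ s) * y := by
          intro y
          constructor
          · intro hy
            have := hcomm ⟨y, hy⟩ ⟨x ^ s, pow_mem hx s⟩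
            exact congrArg Subtype.val this
          · exact hb _ (pow_mem hx s) hxs (hpart x) y
        have hcommT' : ∀ y, y ∈ T ↔ y * (n⁻¹ * x * n) ^ s = (n⁻¹ * x * n) ^ s * y := by
          intro y
          constructor
          · intro hy
            have := hcomm ⟨y, hy⟩ ⟨_, pow_mem hn s⟩
            exact congrArg Subtype.val this
          · refine hb _ (pow_mem hn s) ?_ (hpart _) y
            intro h
            have e2 := conj_pow (i := s) (a := n⁻¹) (b := x)
            rw [inv_inv] at e2
            rw [e2] at h
            apply hxs
            have : x ^ s = n * (n⁻¹ * x ^ s * n) * n⁻¹ := by group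
            rw [this, h]; group
        rw [Subgroup.mem_normalizer_iff'']
        intro y
        change y ∈ T ↔ n⁻¹ * y * n ∈ T
        rw [hcommT, hcommT']
        have e2 := conj_pow (i := s) (a := n⁻¹) (b := x)
        rw [inv_inv] at e2
        rw [e2]
        constructor
        · intro h
          calc n⁻¹ * y * n * (n⁻¹ * x ^ s * n) = n⁻¹ * (y * x ^ s) * n := by group
            _ = _ := by rw [h]; group
        · intro h
          calc y * x ^ s = n * (n⁻¹ * y * n * (n⁻¹ * x ^ s * n)) * n⁻¹ := by group
            _ = _ := by rw [h]; group)
    rw [dual_parseval c (fun a : T => χ a - χ ((a : G) ^ r)) hδ] at a2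
    have hG0 : (0 : ℝ) < Fintype.card G := Nat.cast_pos.2 Fintype.card_pos
    have hN0 : (0 : ℝ) < Fintype.card N := Nat.cast_pos.2 Fintype.card_pos
    have a3 : (Fintype.card G : ℝ) * (Fintype.card T * ∑ ψ, (c ψ : ℝ) ^ 2) <
        Fintype.card G * (4 * Fintype.card N) := by
      refine a2.trans_lt ?_
      have := mul_lt_mul_of_pos_left a1 hN0
      linarith
    have a4 := lt_of_mul_lt_mul_left a3 hG0.le
    exact_mod_cast a4
  have huniq := orbit_unique (Fintype.card T) c hsum0 hsq hinv hst
  -- all c vanish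
  suffices hc0 : ∀ ψ, c ψ = 0 by
    have := hδ t
    simp only [hc0, Int.cast_zero, zero_mul, Finset.sum_const_zero] at this
    exact (sub_eq_zero.1 this).symm
  by_contra hne
  obtain ⟨ψ₁, hψ₁⟩ : ∃ ψ, 0 < c ψ := by
    by_contra hcon
    push Not at hcon
    apply hne
    intro ψ
    have := (Finset.sum_eq_zero_iff_of_nonpos (fun ψ _ => hcon ψ)).1 hsum0
    exact this ψ (Finset.mem_univ _)
  -- find ψ₂ = ψ₁ ^ R
  obtain ⟨j, hj⟩ : ∃ j, c (ψ₁ ^ (r' ^ j)) < 0 := by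
    by_contra hcon
    push Not at hcon
    have hk' : r' ^ k ≡ 1 [MOD Nat.card G] := by
      rw [hr', ← pow_mul, mul_comm, pow_mul]
      simpa using hk.pow (k - 1)
    have htel : ∑ i ∈ Finset.range k, c (ψ₁ ^ (r' ^ i)) = 0 := by
      have : ∀ i, c (ψ₁ ^ (r' ^ i)) = (m (ψ₁ ^ (r' ^ i)) : ℤ) - m (ψ₁ ^ (r' ^ (i + 1))) := by
        intro i
        simp only [c]
        rw [hpm, ← pow_succ]
      rw [Finset.sum_congr rfl fun i _ => this i,
        Finset.sum_range_sub' (fun i => (m (ψ₁ ^ (r' ^ i)) : ℤ)) k]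
      rw [hXmod ψ₁ hk']
      simp
    have := (Finset.sum_eq_zero_iff_of_nonneg (fun i _ => hcon i)).1 htel 0 (by simp; omega)
    simp only [pow_zero, hp1] at this
    omega
  set R := r' ^ j with hR
  obtain ⟨S, hS, hSd⟩ : ∃ S, R = S + 1 ∧ n' * p ∣ S := by
    rw [hR, hr', ← pow_mul]
    exact dvd_succ_pow_sub hs _
  -- restrict to p-elements
  obtain ⟨φ, hφ1, hφ2⟩ : ∃ φ, c φ < 0 ∧ ∀ x : T, x ^ p ^ E = 1 → φ x = ψ₁ x := by
    have hTq : ∀ x : T, x ∈ (powMonoidHom (p ^ E) : T →* T).ker ↔ x ^ p ^ E = 1 := fun x => by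
      simp [MonoidHom.mem_ker]
    obtain ⟨φ, h8, h9⟩ := exists_neg_restrict c _ hδ (powMonoidHom (p ^ E) : T →* T).ker
      (fun x hx => by rw [sub_eq_zero]; exact (hyp x ((hTq x).1 hx)).symm) ψ₁ hψ₁
    exact ⟨φ, h8, fun x hx => h9 x ((hTq x).2 hx)⟩
  obtain ⟨n, hn'⟩ := huniq _ _ hj hφ1
  have hrel : ∀ x : T, x ^ p ^ E = 1 → ψ₁ x = (ψ₁ (conjT T n x)) ^ R := by
    intro x hx
    rw [← hφ2 x hx, ← hn', hsmul, MonoidHom.pow_apply]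
  obtain ⟨l, ⟨x₀, hx₀, hx₀'⟩, hl2⟩ : ∃ l, (∃ x : T, x ^ p ^ E = 1 ∧ (ψ₁ ^ p ^ l) x ≠ 1) ∧
      ∀ x : T, x ^ p ^ E = 1 → (ψ₁ ^ p ^ (l + 1)) x = 1 := by
    have hex : ∃ l, ∀ x : T, x ^ p ^ E = 1 → (ψ₁ ^ p ^ l) x = 1 :=
      ⟨E, fun x hx => by rw [MonoidHom.pow_apply, ← map_pow, hx, map_one]⟩
    have hpos : Nat.find hex ≠ 0 := by
      intro h0
      have h10 := Nat.find_spec hex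
      rw [h0] at h10
      obtain ⟨x, hx, hx'⟩ := hnontriv ψ₁ hψ₁.ne'
      exact hx' (by simpa using h10 x hx)
    obtain ⟨l, hl⟩ := Nat.exists_eq_succ_of_ne_zero hpos
    refine ⟨l, ?_, ?_⟩
    · have h11 := Nat.find_min hex (m := l) (by omega)
      push Not at h11
      exact h11
    · have h12 := Nat.find_spec hex
      rw [hl] at h12
      exact h12
  have hnT : (n : G) ∈ T := by
    refine twist_free T hcomm (p ^ E) hb n (ψ₁ ^ p ^ l) ⟨x₀, hx₀, hx₀'⟩ fun x hx => ?_
    have hcx : (conjT T n x) ^ p ^ E = 1 := by rw [← map_pow, hx, map_one]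
    obtain ⟨v, hv⟩ : p ∣ S := (Dvd.intro_left _ rfl).trans hSd
    have := hl2 _ hcx
    simp only [MonoidHom.pow_apply] at this ⊢
    rw [hrel x hx, hS, hv, pow_succ (ψ₁ (conjT T n x)) (p * v), mul_pow, ← pow_mul,
      show p * v * p ^ l = p ^ (l + 1) * v by ring, pow_mul _ (p ^ (l + 1)), this, one_pow, one_mul]
  have hRψ : ψ₁ ^ R = ψ₁ := by
    have hS1 : ∀ x : T, x ^ p ^ E = 1 → ψ₁ x ^ S = 1 := by
      intro x hx
      have h13 := hrel x hx
      have h14 : conjT T n x = x := by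
        apply Subtype.ext
        rw [conjT_coe]
        have h15 := congrArg (fun z : T => (z : G)) (hcomm ⟨n, hnT⟩ x)
        simp only [Subgroup.coe_mul] at h15
        rw [mul_assoc, ← h15]
        group
      rw [h14, hS, pow_succ] at h13
      exact (mul_eq_right.1 h13.symm)
    have hcop2 : (p ^ E).Coprime n' := Nat.Coprime.pow_left _ ((Nat.Prime.coprime_iff_not_dvd hp).2 hpn)
    obtain ⟨d, hd1, hd2⟩ := Nat.chineseRemainder hcop2 1 0
    have hdn : n' ∣ d := (Nat.modEq_zero_iff_dvd).1 hd2
    have hSn : n' ∣ S := (Dvd.intro _ rfl).trans hSd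
    ext a
    rw [MonoidHom.pow_apply, hS, pow_succ]
    have h16 : (a : T) ^ Nat.card G = 1 := pow_one_of_dvd hTG pow_card_eq_one'
    have h17 := hS1 (a ^ d) (by
      rw [← pow_mul]
      refine pow_one_of_dvd ?_ h16
      rw [hn, mul_comm]
      exact mul_dvd_mul_right hdn _)
    rw [← map_pow, ← pow_mul] at h17
    have h18 : a ^ (d * S) = a ^ S := by
      refine pow_eq_of_modEq ?_ h16
      obtain ⟨v, hv⟩ := hSn
      rw [hn, hv, show d * (n' * v) = d * v * n' by ring, show n' * v = 1 * v * n' by ring]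
      exact Nat.ModEq.mul_right' _ (hd1.mul_right v)
    rw [h18, map_pow] at h17
    rw [h17, one_mul]
  rw [hRψ] at hj
  omega

end ThmC

section ThmD
open Module

theorem thmA {G : Type*} [Group G] [Fintype G] {V : Type*} [AddCommGroup V]
    [Module ℂ V] [FiniteDimensional ℂ V] (ρ : G →* (V →ₗ[ℂ] V)) (p : ℕ) (hp : p.Prime)
    (E n' : ℕ) (hn : Nat.card G = p ^ E * n') (hpn : ¬ p ∣ n') (s : ℕ) (hs : n' * p ∣ s)
    (hχ : ∑ g, ‖LinearMap.trace ℂ V (ρ g)‖ ^ 2 = Fintype.card G)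
    (h1 : LinearMap.trace ℂ V (ρ 1) ≠ 0)
    (hcent : ∀ z : G, z ≠ 1 → z ^ p ^ E = 1 → ∀ x y, x * z = z * x → y * z = z * y → x * y = y * x)
    (hyp : ∀ x : G, x ^ p ^ E = 1 →
      LinearMap.trace ℂ V (ρ (x ^ (s + 1))) = LinearMap.trace ℂ V (ρ x)) (g : G) :
    LinearMap.trace ℂ V (ρ (g ^ (s + 1))) = LinearMap.trace ℂ V (ρ g) := by
  classical
  by_cases hg : g ^ s = 1
  · rw [pow_succ, hg, one_mul]
  have hsn : n' ∣ s := (Dvd.intro _ rfl).trans hs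
  have hpart : ∀ g : G, (g ^ s) ^ p ^ E = 1 := by
    intro g
    rw [← pow_mul]
    refine pow_one_of_dvd ?_ (pow_card_eq_one' (x := g))
    rw [hn, mul_comm]
    exact mul_dvd_mul_right hsn _
  have : Fact p.Prime := ⟨hp⟩
  -- Sylow subgroup containing g^s
  have hpg : IsPGroup p (Subgroup.zpowers (g ^ s)) := by
    rintro ⟨y, hy⟩
    obtain ⟨k, rfl⟩ := hy
    refine ⟨E, Subtype.ext ?_⟩
    simp only [Subgroup.coe_pow, Subgroup.coe_one]
    rw [← zpow_natCast, zpow_comm, zpow_natCast, hpart, one_zpow]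
  obtain ⟨P, hP⟩ := hpg.exists_le_sylow
  have hgP : g ^ s ∈ P := hP (Subgroup.mem_zpowers _)
  have hPE : ∀ x ∈ P, x ^ p ^ E = 1 := by
    intro x hx
    obtain ⟨k, hk⟩ := P.2 ⟨x, hx⟩
    have hk' : x ^ p ^ k = 1 := congrArg Subtype.val hk
    obtain ⟨j, hj, hj'⟩ := (Nat.dvd_prime_pow hp).1 (orderOf_dvd_of_pow_eq_one hk')
    have h2 : p ^ j ∣ p ^ E * n' := by
      rw [← hj', ← hn]; exact orderOf_dvd_natCard x
    have h3 : p ^ j ∣ p ^ E := Nat.Coprime.dvd_of_dvd_mul_right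
      (Nat.Coprime.pow_left _ ((Nat.Prime.coprime_iff_not_dvd hp).2 hpn)) h2
    rw [← hj'] at h3
    exact orderOf_dvd_iff_pow_eq_one.1 h3
  have hnt : Nontrivial P := ⟨⟨⟨g ^ s, hgP⟩, 1, fun h => hg (congrArg Subtype.val h)⟩⟩
  have hct := IsPGroup.center_nontrivial P.2
  obtain ⟨⟨⟨z0, hz0P⟩, hz0c⟩, hz0⟩ := exists_ne (1 : Subgroup.center P)
  have hz01 : z0 ≠ 1 := by
    rintro rfl
    exact hz0 rfl
  have hcz : ∀ y ∈ P, y * z0 = z0 * y := by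
    intro y hy
    have := Subgroup.mem_center_iff.1 hz0c ⟨y, hy⟩
    exact congrArg Subtype.val this
  let T : Subgroup G := Subgroup.centralizer {z0}
  have hT : ∀ x, x ∈ T ↔ x * z0 = z0 * x := by
    intro x
    simp only [T, Subgroup.mem_centralizer_iff, Set.mem_singleton_iff, forall_eq]
    exact eq_comm
  have hz0E := hPE z0 hz0P
  have hcomm : ∀ x y : T, x * y = y * x := by
    intro x y
    exact Subtype.ext (hcent z0 hz01 hz0E x y ((hT _).1 x.2) ((hT _).1 y.2))
  have hb : ∀ z ∈ T, z ≠ 1 → z ^ p ^ E = 1 → ∀ x, x * z = z * x → x ∈ T := by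
    intro z hz hz1 hzE x hx
    rw [hT]
    exact hcent z hz1 hzE x z0 hx ((hT z).1 hz).symm
  have key := thmA_T ρ p hp E n' hn hpn s hs hχ h1 T hcomm hb
    (fun x hx => hyp x (by simpa using congrArg Subtype.val hx))
  have hgsT : g ^ s ∈ T := (hT _).2 (hcz _ hgP)
  have hgT : g ∈ T := hb _ hgsT hg (hpart g) g ((Commute.refl g).pow_right s)
  exact key ⟨g, hgT⟩

end ThmD

section P4sec
open Polynomial Matrix

lemma comm_of_distinct_eigen {K : Type*} [Field K] (M A B : Matrix (Fin 3) (Fin 3) K)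
    (μ : Fin 3 → K) (hμ : Function.Injective μ) (hr : ∀ i, M.charpoly.eval (μ i) = 0)
    (hA : A * M = M * A) (hB : B * M = M * B) : A * B = B * A := by
  have h1 : ∀ i, ∃ v : Fin 3 → K, v ≠ 0 ∧ M *ᵥ v = μ i • v := by
    intro i
    have := hr i
    rw [Matrix.eval_charpoly, ← Matrix.exists_mulVec_eq_zero_iff] at this
    obtain ⟨v, hv, hv2⟩ := this
    refine ⟨v, hv, ?_⟩
    rw [Matrix.sub_mulVec, sub_eq_zero] at hv2
    rw [← hv2]
    ext j
    simp [Matrix.scalar_apply, Matrix.mulVec_diagonal]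
  choose v hv hv2 using h1
  have hli : LinearIndependent K v := by
    refine Module.End.eigenvectors_linearIndependent' (Matrix.toLin' M) μ hμ v fun i => ?_
    rw [Module.End.hasEigenvector_iff, Module.End.mem_eigenspace_iff]
    exact ⟨by simpa using hv2 i, hv i⟩
  let P : Matrix (Fin 3) (Fin 3) K := Matrix.of fun i j => v j i
  have hP : IsUnit P := Matrix.linearIndependent_cols_iff_isUnit.1 hli
  have hPd : IsUnit P.det := (Matrix.isUnit_iff_isUnit_det P).1 hP
  have hMP : M * P = P * diagonal μ := by
    ext i j
    rw [Matrix.mul_diagonal]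
    have := congrFun (hv2 j) i
    simp only [Pi.smul_apply, smul_eq_mul] at this
    rw [mul_comm] at this
    exact this
  have e1 : P * P⁻¹ = 1 := Matrix.mul_nonsing_inv P hPd
  have e2 : P⁻¹ * P = 1 := Matrix.nonsing_inv_mul P hPd
  have hdiag : ∀ C : Matrix (Fin 3) (Fin 3) K, C * M = M * C →
      ∃ d, C = P * diagonal d * P⁻¹ := by
    intro C hC
    have hM' : M = P * diagonal μ * P⁻¹ := by rw [← hMP, mul_assoc, e1, mul_one]
    have h3 : (P⁻¹ * C * P) * diagonal μ = diagonal μ * (P⁻¹ * C * P) := by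
      have h4 : diagonal μ = P⁻¹ * M * P := by rw [mul_assoc, hMP, ← mul_assoc, e2, one_mul]
      rw [h4]
      calc P⁻¹ * C * P * (P⁻¹ * M * P) = P⁻¹ * C * (P * P⁻¹) * M * P := by simp only [mul_assoc]
        _ = P⁻¹ * (C * M) * P := by rw [e1, mul_one]; simp only [mul_assoc]
        _ = P⁻¹ * M * (P * P⁻¹) * C * P := by rw [e1, mul_one, hC]; simp only [mul_assoc]
        _ = _ := by simp only [mul_assoc]
    refine ⟨fun i => (P⁻¹ * C * P) i i, ?_⟩
    have h5 : diagonal (fun i => (P⁻¹ * C * P) i i) = P⁻¹ * C * P := by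
      ext i j
      by_cases hij : i = j
      · subst hij; simp
      · rw [Matrix.diagonal_apply_ne _ hij]
        have := congrFun (congrFun h3 i) j
        rw [Matrix.mul_diagonal, Matrix.diagonal_mul] at this
        have h6 : (μ j - μ i) * (P⁻¹ * C * P) i j = 0 := by linear_combination this
        rcases mul_eq_zero.1 h6 with h | h
        · exact absurd (hμ (sub_eq_zero.1 h)) (Ne.symm hij)
        · exact h.symm
    rw [h5]
    calc C = (P * P⁻¹) * C * (P * P⁻¹) := by rw [e1]; simp
      _ = _ := by simp only [mul_assoc]
  obtain ⟨a, rfl⟩ := hdiag A hA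
  obtain ⟨b, rfl⟩ := hdiag B hB
  calc P * diagonal a * P⁻¹ * (P * diagonal b * P⁻¹) = P * diagonal a * (P⁻¹ * P) * diagonal b * P⁻¹ := by
        simp only [mul_assoc]
    _ = P * (diagonal a * diagonal b) * P⁻¹ := by rw [e2, mul_one]; simp only [mul_assoc]
    _ = P * (diagonal b * diagonal a) * P⁻¹ := by
        rw [Matrix.diagonal_mul_diagonal, Matrix.diagonal_mul_diagonal]
        simp only [mul_comm]
    _ = P * diagonal b * (P⁻¹ * P) * diagonal a * P⁻¹ := by rw [e2, mul_one]; simp only [mul_assoc]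
    _ = _ := by simp only [mul_assoc]

lemma comm_of_separable {F : Type*} [Field F] (M A B : Matrix (Fin 3) (Fin 3) F)
    (hs : M.charpoly.Separable) (hA : A * M = M * A) (hB : B * M = M * B) : A * B = B * A := by
  let K := AlgebraicClosure F
  let f := algebraMap F K
  have hsep : (M.map f).charpoly.Separable := by
    rw [Matrix.charpoly_map]; exact hs.map
  have hnd := nodup_roots hsep
  have hcard : Multiset.card (M.map f).charpoly.roots = 3 := by
    rw [← (IsAlgClosed.splits (M.map f).charpoly).natDegree_eq_card_roots,
      Matrix.charpoly_natDegree_eq_dim]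
    simp
  classical
  have hc : Fintype.card (M.map f).charpoly.roots.toFinset = 3 := by
    rw [Fintype.card_coe, Multiset.toFinset_card_of_nodup hnd, hcard]
  let e := (Fintype.equivFinOfCardEq hc).symm
  have hmap : ∀ C D : Matrix (Fin 3) (Fin 3) F, C * D = D * C → C.map f * D.map f = D.map f * C.map f := by
    intro C D h
    rw [← Matrix.map_mul, h, Matrix.map_mul]
  have := comm_of_distinct_eigen (M.map f) (A.map f) (B.map f) (fun i => (e i : K))
    (fun i j h => e.injective (Subtype.ext h))
    (fun i => by
      have := (e i).2
      rw [Multiset.mem_toFinset] at this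
      exact (mem_roots'.1 this).2) (hmap _ _ hA) (hmap _ _ hB)
  rw [← Matrix.map_mul, ← Matrix.map_mul] at this
  exact Matrix.map_injective f.injective this

lemma charpoly_separable {F : Type*} [Field F] [Fintype F] (M : Matrix (Fin 3) (Fin 3) F) (N : ℕ)
    (hN : (N : F) ≠ 0) (hN1 : N.Coprime (Fintype.card F - 1)) (hM : M ^ N = 1) (hM1 : M ≠ 1) :
    M.charpoly.Separable := by
  have hdeg : M.charpoly.natDegree = 3 := by rw [Matrix.charpoly_natDegree_eq_dim]; simp
  have hroot : ∀ a, M.charpoly.eval a = 0 → a = 1 := by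
    intro a ha
    rw [Matrix.eval_charpoly, ← Matrix.exists_mulVec_eq_zero_iff] at ha
    obtain ⟨v, hv, hv2⟩ := ha
    have hv3 : M *ᵥ v = a • v := by
      rw [Matrix.sub_mulVec, sub_eq_zero] at hv2
      rw [← hv2]
      ext j
      simp [Matrix.scalar_apply, Matrix.mulVec_diagonal]
    have hpow : ∀ k : ℕ, (M ^ k) *ᵥ v = a ^ k • v := by
      intro k
      induction k with
      | zero => simp
      | succ k ih => rw [pow_succ, ← Matrix.mulVec_mulVec, hv3, Matrix.mulVec_smul, ih, smul_smul, pow_succ, mul_comm]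
    have h1 := hpow N
    rw [hM, Matrix.one_mulVec] at h1
    have haN : a ^ N = 1 := by
      obtain ⟨i, hi⟩ := Function.ne_iff.1 hv
      have := congrFun h1 i
      simp only [Pi.smul_apply, smul_eq_mul] at this
      exact (mul_eq_right₀ hi).1 this.symm
    have ha0 : a ≠ 0 := by
      rintro rfl
      have hN0 : N ≠ 0 := by rintro rfl; simp at hN
      rw [zero_pow hN0] at haN
      exact zero_ne_one haN
    have ha1 := FiniteField.pow_card_sub_one_eq_one a ha0
    have h2 := orderOf_dvd_of_pow_eq_one haN
    have h3 := orderOf_dvd_of_pow_eq_one ha1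
    have h4 := Nat.dvd_gcd h2 h3
    rw [hN1.gcd_eq_one, Nat.dvd_one] at h4
    exact orderOf_eq_one_iff.1 h4
  have hmon := M.charpoly_monic
  by_cases hirr : Irreducible M.charpoly
  · exact PerfectField.separable_of_irreducible hirr
  rw [irreducible_iff_roots_eq_zero_of_degree_le_three (by omega) (by omega)] at hirr
  have hroot1 : ∀ a ∈ M.charpoly.roots, a = 1 := fun a ha => hroot a (mem_roots'.1 ha).2
  obtain ⟨a, ha⟩ := Multiset.exists_mem_of_ne_zero hirr
  obtain rfl := hroot1 a ha
  obtain ⟨Q, hQ⟩ := dvd_iff_isRoot.2 (mem_roots'.1 ha).2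
  have hXm : (X - C (1 : F)).Monic := monic_X_sub_C 1
  have hQm : Q.Monic := hXm.of_mul_monic_left (hQ ▸ hmon)
  have hQd : Q.natDegree = 2 := by
    have := hXm.natDegree_mul hQm
    rw [← hQ, hdeg, natDegree_X_sub_C] at this
    omega
  by_cases hQi : Irreducible Q
  · rw [hQ]
    refine (separable_X_sub_C).mul (PerfectField.separable_of_irreducible hQi) ?_
    refine (irreducible_X_sub_C 1).coprime_iff_not_dvd.2 fun hd => ?_
    have hz := (irreducible_iff_roots_eq_zero_of_degree_le_three (p := Q) (by omega) (by omega)).1 hQi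
    have : (1 : F) ∈ Q.roots := mem_roots'.2 ⟨hQm.ne_zero, dvd_iff_isRoot.1 hd⟩
    rw [hz] at this
    simp at this
  exfalso
  rw [irreducible_iff_roots_eq_zero_of_degree_le_three (by omega) (by omega)] at hQi
  have hQr : ∀ a, Q.eval a = 0 → a = 1 := fun a ha => hroot a (by rw [hQ, eval_mul, ha, mul_zero])
  obtain ⟨b, hb⟩ := Multiset.exists_mem_of_ne_zero hQi
  obtain rfl := hQr b (mem_roots'.1 hb).2
  obtain ⟨R, hR⟩ := dvd_iff_isRoot.2 (mem_roots'.1 hb).2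
  have hRm : R.Monic := hXm.of_mul_monic_left (hR ▸ hQm)
  have hRd : R.natDegree = 1 := by
    have := hXm.natDegree_mul hRm
    rw [← hR, hQd, natDegree_X_sub_C] at this
    omega
  have hR1 : R = X - C 1 := by
    have h1 := hRm.eq_X_add_C hRd
    have h2 : R.eval (-(R.coeff 0)) = 0 := by
      rw [h1]; simp
    have h3 := hQr _ (by rw [hR, eval_mul, h2, mul_zero])
    rw [h1, ← h3]
    simp
  rw [hR, hR1] at hQ
  have hnil : (M - 1) ^ 3 = 0 := by
    have := Matrix.aeval_self_charpoly M
    rw [hQ] at this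
    simp only [map_mul, map_sub, aeval_X, map_one] at this
    rw [← this]; simp [pow_succ, mul_assoc]
  have hmd1 : minpoly F M ∣ X ^ N - C 1 := minpoly.dvd _ _ (by simp [hM])
  have hmd2 : minpoly F M ∣ (X - C 1) ^ 3 := minpoly.dvd _ _ (by simp [hnil])
  have hsq : Squarefree (minpoly F M) :=
    (separable_X_pow_sub_C (1 : F) hN one_ne_zero).squarefree.squarefree_of_dvd hmd1
  have hmd3 : minpoly F M ∣ X - C 1 := (hsq.dvd_pow_iff_dvd (by norm_num)).1 hmd2
  obtain ⟨W, hW⟩ := hmd3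
  have : aeval M (X - C (1 : F)) = 0 := by rw [hW, map_mul, minpoly.aeval, zero_mul]
  apply hM1
  simpa [sub_eq_zero] using this

end P4sec

section P5
set_option linter.all false
open Matrix Polynomial

lemma case_char {F : Type*} [Field F] [Fintype F] (p E n' : ℕ) (hp : p.Prime) (hodd : Odd p)
    (hpq : p ∣ Fintype.card F)
    (hn : Nat.card (SpecialLinearGroup (Fin 3) F) = p ^ E * n') (s : ℕ) (hs : n' * p ∣ s)
    (g : SpecialLinearGroup (Fin 3) F) : g ^ (s + 1) = g := by
  have hch : CharP F p := by
    obtain ⟨r, hr⟩ := CharP.exists F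
    have := CharP.char_is_prime F r
    obtain ⟨n, hn1, hn2⟩ := FiniteField.card F r
    rw [hn2] at hpq
    have h1 := (Nat.prime_dvd_prime_iff_eq hp hn1).1 (hp.dvd_of_dvd_pow hpq)
    rw [h1]; infer_instance
  have hfact : Fact p.Prime := ⟨hp⟩
  have hx : (g ^ n') ^ p ^ E = 1 := by
    rw [← pow_mul, mul_comm, ← hn]; exact pow_card_eq_one'
  have hy : (g ^ n') ^ p = 1 := by
    apply Subtype.ext
    rw [Matrix.SpecialLinearGroup.coe_pow, Matrix.SpecialLinearGroup.coe_one]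
    have hx' : ((g ^ n' : SpecialLinearGroup (Fin 3) F) : Matrix (Fin 3) (Fin 3) F) ^ p ^ E = 1 := by
      rw [← Matrix.SpecialLinearGroup.coe_pow, hx, Matrix.SpecialLinearGroup.coe_one]
    generalize ((g ^ n' : SpecialLinearGroup (Fin 3) F) : Matrix (Fin 3) (Fin 3) F) = M at hx'
    have hnil : IsNilpotent (M - 1) := by
      refine ⟨p ^ E, ?_⟩
      rw [sub_pow_char_pow_of_commute _ _ (Commute.one_right M), hx', one_pow, sub_self]
    have h3 := (isNilpotent_charpoly_sub_pow_of_isNilpotent hnil).eq_zero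
    have h4 := Matrix.aeval_self_charpoly (M - 1)
    rw [sub_eq_zero.1 h3] at h4
    simp only [map_pow, aeval_X, Fintype.card_fin] at h4
    have hp3 : 3 ≤ p := by
      rcases hp.eq_two_or_odd' with h | h
      · subst h; exact absurd hodd (by decide)
      · have := hp.two_le
        rcases Nat.lt_or_ge p 3 with h2 | h2
        · interval_cases p
          exact absurd hodd (by decide)
        · exact h2
    have h5 : (M - 1) ^ p = 0 := by
      rw [← Nat.sub_add_cancel hp3, pow_add, h4, mul_zero]
    have h6 := sub_pow_char_of_commute p (Commute.one_right M)
    rw [h5, one_pow] at h6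
    exact (sub_eq_zero.1 h6.symm)
  obtain ⟨k, rfl⟩ := hs
  rw [pow_succ, pow_mul, pow_mul, hy, one_pow, one_mul]

end P5

section P6a
open Module

variable {G : Type*} [Group G] [Fintype G] {V : Type*} [AddCommGroup V] [Module ℂ V]

open Classical in
/-- averaging operator over a subgroup -/
noncomputable def avg (ρ : G →* (V →ₗ[ℂ] V)) (H : Subgroup G) : V →ₗ[ℂ] V :=
  (Fintype.card H : ℂ)⁻¹ • ∑ h : H, ρ h

lemma rho_mul_avg (ρ : G →* (V →ₗ[ℂ] V)) (H : Subgroup G) (h : G) (hh : h ∈ H) :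
    ρ h * avg ρ H = avg ρ H := by
  classical
  unfold avg
  rw [mul_smul_comm, Finset.mul_sum]
  congr 1
  refine Fintype.sum_equiv (Equiv.mulLeft (⟨h, hh⟩ : H)) _ _ fun x => ?_
  simp

lemma avg_mul_rho (ρ : G →* (V →ₗ[ℂ] V)) (H : Subgroup G) (h : G) (hh : h ∈ H) :
    avg ρ H * ρ h = avg ρ H := by
  classical
  unfold avg
  rw [smul_mul_assoc, Finset.sum_mul]
  congr 1
  refine Fintype.sum_equiv (Equiv.mulRight (⟨h, hh⟩ : H)) _ _ fun x => ?_
  simp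

lemma avg_apply_fixed (ρ : G →* (V →ₗ[ℂ] V)) (H : Subgroup G) (v : V)
    (hv : ∀ h ∈ H, ρ h v = v) : avg ρ H v = v := by
  classical
  unfold avg
  simp only [LinearMap.smul_apply, LinearMap.sum_apply]
  rw [Finset.sum_congr rfl fun (h : H) _ => hv h h.2]
  simp only [Finset.sum_const, Finset.card_univ, ← Nat.cast_smul_eq_nsmul ℂ, smul_smul]
  rw [inv_mul_cancel₀ (Nat.cast_ne_zero.2 Fintype.card_ne_zero), one_smul]

lemma rho_avg_apply (ρ : G →* (V →ₗ[ℂ] V)) (H : Subgroup G) (h : G) (hh : h ∈ H) (v : V) :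
    ρ h (avg ρ H v) = avg ρ H v := DFunLike.congr_fun (rho_mul_avg ρ H h hh) v

lemma avg_rho_apply (ρ : G →* (V →ₗ[ℂ] V)) (H : Subgroup G) (h : G) (hh : h ∈ H) (v : V) :
    avg ρ H (ρ h v) = avg ρ H v := DFunLike.congr_fun (avg_mul_rho ρ H h hh) v

lemma avg_avg_apply (ρ : G →* (V →ₗ[ℂ] V)) (H : Subgroup G) (v : V) :
    avg ρ H (avg ρ H v) = avg ρ H v :=
  avg_apply_fixed ρ H _ fun h hh => rho_avg_apply ρ H h hh v

lemma avg_comm (ρ : G →* (V →ₗ[ℂ] V)) (H : Subgroup G) (g : G)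
    (hg : ∀ h ∈ H, g * h * g⁻¹ ∈ H) (v : V) : ρ g (avg ρ H v) = avg ρ H (ρ g v) := by
  classical
  have : ρ g * avg ρ H = avg ρ H * ρ g := by
    unfold avg
    rw [mul_smul_comm, smul_mul_assoc, Finset.mul_sum, Finset.sum_mul]
    congr 1
    have hbij : Function.Bijective (fun h : H => (⟨g * h * g⁻¹, hg h h.2⟩ : H)) := by
      rw [← Finite.injective_iff_bijective]
      intro a b hab
      have := congrArg (fun z : H => (z : G)) hab
      simp only [mul_left_inj, mul_right_inj] at this
      exact Subtype.ext this
    refine Fintype.sum_bijective _ hbij _ _ fun x => ?_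
    rw [← map_mul, ← map_mul]
    congr 1
    group
  exact DFunLike.congr_fun this v

lemma trace_avg [FiniteDimensional ℂ V] (ρ : G →* (V →ₗ[ℂ] V)) (H : Subgroup G) (g : G)
    (hg : ∀ h ∈ H, g * h * g⁻¹ ∈ H) (hc : ∀ h ∈ H, h * g = g * h → h = 1) :
    LinearMap.trace ℂ V (ρ g * avg ρ H) = LinearMap.trace ℂ V (ρ g) := by
  classical
  have hginv : ∀ h ∈ H, g⁻¹ * h * g ∈ H := by
    have hbij : Function.Bijective (fun h : H => (⟨g * h * g⁻¹, hg h h.2⟩ : H)) := by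
      rw [← Finite.injective_iff_bijective]
      intro a b hab
      have := congrArg (fun z : H => (z : G)) hab
      simp only [mul_left_inj, mul_right_inj] at this
      exact Subtype.ext this
    intro h hh
    obtain ⟨k, hk⟩ := hbij.2 ⟨h, hh⟩
    have := congrArg (fun z : H => (z : G)) hk
    simp only at this
    rw [← this]
    have e : g⁻¹ * (g * k * g⁻¹) * g = k := by group
    rw [e]; exact k.2
  have hinj : Function.Bijective (fun u : H => (⟨g⁻¹ * u * g * (u : G)⁻¹,
      mul_mem (hginv u u.2) (inv_mem u.2)⟩ : H)) := by
    rw [← Finite.injective_iff_bijective]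
    intro a b hab
    have h1 := congrArg (fun z : H => (z : G)) hab
    simp only at h1
    have h2 : (b : G)⁻¹ * a * g = g * ((b : G)⁻¹ * a) := by
      have h3 : (a : G) * g * (a : G)⁻¹ = b * g * (b : G)⁻¹ := by
        have := congrArg (fun z => g * z) h1
        simpa [mul_assoc] using this
      calc (b : G)⁻¹ * a * g = (b : G)⁻¹ * (a * g * (a : G)⁻¹) * a := by group
        _ = _ := by rw [h3]; group
    have h4 := hc _ (mul_mem (inv_mem b.2) a.2) h2
    apply Subtype.ext
    exact (inv_mul_eq_one.1 h4).symm
  have hall : ∀ h : H, LinearMap.trace ℂ V (ρ (g * h)) = LinearMap.trace ℂ V (ρ g) := by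
    intro h
    obtain ⟨u, hu⟩ := hinj.2 h
    have h1 := congrArg (fun z : H => (z : G)) hu
    simp only at h1
    rw [← h1, show g * (g⁻¹ * u * g * (u : G)⁻¹) = u * (g * (u : G)⁻¹) by group, map_mul,
      LinearMap.trace_mul_comm, ← map_mul]
    congr 2
    group
  unfold avg
  rw [mul_smul_comm, Finset.mul_sum, map_smul, map_sum]
  simp only [← map_mul, hall]
  simp only [Finset.sum_const, Finset.card_univ, nsmul_eq_mul, smul_eq_mul]
  rw [← mul_assoc, inv_mul_cancel₀ (Nat.cast_ne_zero.2 Fintype.card_ne_zero), one_mul]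

lemma dim_cong [FiniteDimensional ℂ V] (ρ : G →* (V →ₗ[ℂ] V)) (p : ℕ) (hp : p.Prime) (k : ℕ) (g : G)
    (hg : g ^ p ^ k = 1) {ι : Type*} (I : Finset ι) (z : ι → ℂ) (hz : ∀ i ∈ I, z i ^ p ^ k = 1)
    (h : LinearMap.trace ℂ V (ρ g) = ∑ i ∈ I, z i) :
    (p : ℤ) ∣ (finrank ℂ V : ℤ) - I.card := by
  classical
  obtain ⟨κ, _, m, y, hy, htr⟩ := exists_roots ρ g (p ^ k) (pow_pos hp.pos _) hg
  have h0 := htr 0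
  have h1 := htr 1
  simp only [pow_zero, map_one, mul_one, pow_one] at h0 h1
  rw [LinearMap.trace_one] at h0
  have h0' : finrank ℂ V = ∑ i, m i := by exact_mod_cast h0
  let c : κ ⊕ ι → ℤ := Sum.elim (fun i => (m i : ℤ)) (fun _ => -1)
  let w : κ ⊕ ι → ℂ := Sum.elim y z
  have := dvd_of_sum_roots_eq_zero (Finset.univ.disjSum I) p hp k c w (by
    intro i hi
    rcases i with i | i
    · exact hy i
    · rw [Finset.inr_mem_disjSum] at hi
      exact hz i hi) (by
    rw [Finset.sum_disjSum]
    simp only [c, w, Sum.elim_inl, Sum.elim_inr]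
    push_cast
    rw [← h1, h]
    simp)
  rw [Finset.sum_disjSum] at this
  simp only [c, Sum.elim_inl, Sum.elim_inr] at this
  rw [h0']
  push_cast
  simpa [sub_eq_add_neg] using this

end P6a

section P6b
set_option linter.all false
open Matrix

variable {F : Type*} [Field F]

lemma sl_mul_apply (g h : SpecialLinearGroup (Fin 3) F) (i j : Fin 3) :
    (g * h) i j = g i 0 * h 0 j + g i 1 * h 1 j + g i 2 * h 2 j := by
  rw [Matrix.SpecialLinearGroup.coe_mul, Matrix.mul_apply, Fin.sum_univ_three]

lemma sl_mul_inv (g : SpecialLinearGroup (Fin 3) F) (i j : Fin 3) :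
    g i 0 * g⁻¹ 0 j + g i 1 * g⁻¹ 1 j + g i 2 * g⁻¹ 2 j = if i = j then 1 else 0 := by
  rw [← sl_mul_apply, mul_inv_cancel]
  simp [Matrix.one_apply]

lemma sl_inv_mul (g : SpecialLinearGroup (Fin 3) F) (i j : Fin 3) :
    g⁻¹ i 0 * g 0 j + g⁻¹ i 1 * g 1 j + g⁻¹ i 2 * g 2 j = if i = j then 1 else 0 := by
  rw [← sl_mul_apply, inv_mul_cancel]
  simp [Matrix.one_apply]

/-- upper unitriangular group -/
def UU (F : Type*) [Field F] : Subgroup (SpecialLinearGroup (Fin 3) F) where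
  carrier := {g | g 0 0 = 1 ∧ g 1 1 = 1 ∧ g 2 2 = 1 ∧ g 1 0 = 0 ∧ g 2 0 = 0 ∧ g 2 1 = 0}
  mul_mem' := by
    rintro a b ⟨h1, h2, h3, h4, h5, h6⟩ ⟨k1, k2, k3, k4, k5, k6⟩
    simp only [Set.mem_ofPred_eq, sl_mul_apply, h1, h2, h3, h4, h5, h6, k1, k2, k3, k4, k5, k6]
    simp
  one_mem' := by simp
  inv_mem' := by
    rintro a ⟨h1, h2, h3, h4, h5, h6⟩
    simp only [Set.mem_ofPred_eq, Matrix.SpecialLinearGroup.coe_inv, Matrix.adjugate_fin_three]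
    simp [h1, h2, h3, h4, h5, h6]

/-- radical of a maximal parabolic -/
def UQ (F : Type*) [Field F] : Subgroup (SpecialLinearGroup (Fin 3) F) where
  carrier := {g | g 0 0 = 1 ∧ g 1 1 = 1 ∧ g 2 2 = 1 ∧ g 1 0 = 0 ∧ g 2 0 = 0 ∧ g 2 1 = 0 ∧ g 0 1 = 0}
  mul_mem' := by
    rintro a b ⟨h1, h2, h3, h4, h5, h6, h7⟩ ⟨k1, k2, k3, k4, k5, k6, k7⟩
    simp only [Set.mem_ofPred_eq, sl_mul_apply, h1, h2, h3, h4, h5, h6, k1, k2, k3, k4, k5, k6, h7, k7]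
    simp
  one_mem' := by simp
  inv_mem' := by
    rintro a ⟨h1, h2, h3, h4, h5, h6, h7⟩
    simp only [Set.mem_ofPred_eq, Matrix.SpecialLinearGroup.coe_inv, Matrix.adjugate_fin_three]
    simp [h1, h2, h3, h4, h5, h6, h7]

lemma mem_UU (g : SpecialLinearGroup (Fin 3) F) : g ∈ UU F ↔
    g 0 0 = 1 ∧ g 1 1 = 1 ∧ g 2 2 = 1 ∧ g 1 0 = 0 ∧ g 2 0 = 0 ∧ g 2 1 = 0 := Iff.rfl

lemma mem_UQ (g : SpecialLinearGroup (Fin 3) F) : g ∈ UQ F ↔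
    g 0 0 = 1 ∧ g 1 1 = 1 ∧ g 2 2 = 1 ∧ g 1 0 = 0 ∧ g 2 0 = 0 ∧ g 2 1 = 0 ∧ g 0 1 = 0 := Iff.rfl

lemma UQ_le : UQ F ≤ UU F := fun _ h => ⟨h.1, h.2.1, h.2.2.1, h.2.2.2.1, h.2.2.2.2.1, h.2.2.2.2.2.1⟩

/-- unitriangular element -/
def uu (a b c : F) : SpecialLinearGroup (Fin 3) F :=
  ⟨!![1, a, b; 0, 1, c; 0, 0, 1], by simp [Matrix.det_fin_three]⟩

lemma uu_coe (a b c : F) : ((uu a b c : SpecialLinearGroup (Fin 3) F) : Matrix (Fin 3) (Fin 3) F)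
    = !![1, a, b; 0, 1, c; 0, 0, 1] := rfl

lemma uu_mem (a b c : F) : uu a b c ∈ UU F := by
  rw [mem_UU]
  simp [uu_coe]

/-- the torus -/
def Tor (F : Type*) [Field F] : Subgroup (Fin 3 → Fˣ) where
  carrier := {t | ∏ i, t i = 1}
  mul_mem' := by
    intro a b ha hb
    simp only [Set.mem_ofPred_eq, Pi.mul_apply, Finset.prod_mul_distrib] at *
    rw [ha, hb, one_mul]
  one_mem' := by simp
  inv_mem' := by
    intro a ha
    simp only [Set.mem_ofPred_eq, Pi.inv_apply, Finset.prod_inv_distrib] at *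
    rw [ha, inv_one]

lemma mem_Tor (t : Fin 3 → Fˣ) : t ∈ Tor F ↔ ∏ i, t i = 1 := Iff.rfl

/-- diagonal embedding -/
def DD : Tor F →* SpecialLinearGroup (Fin 3) F where
  toFun t := ⟨Matrix.diagonal fun i => ((t : Fin 3 → Fˣ) i : F), by
    rw [Matrix.det_diagonal]
    have := (mem_Tor _).1 t.2
    rw [← Units.coe_prod, this, Units.val_one]⟩
  map_one' := by
    ext i j
    simp [Matrix.one_apply, Matrix.diagonal_apply]
  map_mul' a b := by
    apply Subtype.ext
    refine Eq.trans ?_ (Matrix.diagonal_mul_diagonal _ _).symm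
    simp

lemma DD_apply (t : Tor F) (i j : Fin 3) :
    (DD t) i j = if i = j then ((t : Fin 3 → Fˣ) i : F) else 0 := by
  change Matrix.diagonal _ i j = _
  rw [Matrix.diagonal_apply]

/-- permutation of coordinates -/
def permT (σ : Equiv.Perm (Fin 3)) : Tor F →* Tor F where
  toFun t := ⟨fun i => (t : Fin 3 → Fˣ) (σ i), by
    rw [mem_Tor, Equiv.prod_comp σ]; exact t.2⟩
  map_one' := rfl
  map_mul' _ _ := rfl

lemma permT_apply (σ : Equiv.Perm (Fin 3)) (t : Tor F) (i : Fin 3) :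
    (permT σ t : Fin 3 → Fˣ) i = (t : Fin 3 → Fˣ) (σ i) := rfl

/-- the Weyl representatives -/
def ww (σ : Equiv.Perm (Fin 3)) : SpecialLinearGroup (Fin 3) F :=
  ⟨Matrix.diagonal (fun i => if i = 0 then ((Equiv.Perm.sign σ : ℤ) : F) else 1) * (σ⁻¹).permMatrix F, by
    rw [Matrix.det_mul, Matrix.det_diagonal, Matrix.det_permutation, Fin.prod_univ_three]
    simp only [if_true, Equiv.Perm.sign_inv]
    simp
    have := Int.units_mul_self (Equiv.Perm.sign σ)
    have h2 := congrArg (fun z : ℤˣ => ((z : ℤ) : F)) this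
    simp only [Units.val_mul, Int.cast_mul, Units.val_one, Int.cast_one] at h2
    exact h2⟩

lemma ww_apply (σ : Equiv.Perm (Fin 3)) (i j : Fin 3) :
    (ww σ : SpecialLinearGroup (Fin 3) F) i j = if i = σ j then
      (if i = 0 then ((Equiv.Perm.sign σ : ℤ) : F) else 1) else 0 := by
  change (Matrix.diagonal (fun i => if i = 0 then ((Equiv.Perm.sign σ : ℤ) : F) else 1) *
    (σ⁻¹).permMatrix F : Matrix (Fin 3) (Fin 3) F) i j = _
  rw [Matrix.diagonal_mul]
  simp only [Equiv.Perm.permMatrix, PEquiv.toMatrix_apply, Equiv.toPEquiv_apply]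
  simp only [Option.mem_def, Option.some.injEq, Equiv.Perm.inv_eq_iff_eq]
  split_ifs <;> simp

lemma DD_ww (σ : Equiv.Perm (Fin 3)) (t : Tor F) : DD t * ww σ = ww σ * DD (permT σ t) := by
  ext i j
  simp only [sl_mul_apply, DD_apply, ww_apply, permT_apply]
  fin_cases i <;> fin_cases j <;> simp <;> grind

end P6b

section P6c
set_option linter.all false
open Matrix

variable {F : Type*} [Field F]

lemma upper_decomp (b : SpecialLinearGroup (Fin 3) F) (h10 : b 1 0 = 0) (h20 : b 2 0 = 0)
    (h21 : b 2 1 = 0) : ∃ t : Tor F, ∃ u ∈ UU F, b = DD t * u := by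
  have hdet := b.det_coe
  rw [Matrix.det_fin_three, h10, h20, h21] at hdet
  have hd : b 0 0 * b 1 1 * b 2 2 = 1 := by linear_combination hdet
  have h0 : b 0 0 ≠ 0 := by intro h; rw [h] at hd; simp at hd
  have h1 : b 1 1 ≠ 0 := by intro h; rw [h] at hd; simp at hd
  have h2 : b 2 2 ≠ 0 := by intro h; rw [h] at hd; simp at hd
  refine ⟨⟨![Units.mk0 _ h0, Units.mk0 _ h1, Units.mk0 _ h2], ?_⟩,
    uu (b 0 1 / b 0 0) (b 0 2 / b 0 0) (b 1 2 / b 1 1), uu_mem _ _ _, ?_⟩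
  · rw [mem_Tor, Fin.prod_univ_three]
    ext
    simpa using hd
  · ext i j
    rw [sl_mul_apply]
    simp only [DD_apply, uu_coe]
    fin_cases i <;> fin_cases j <;> simp [h10, h20, h21] <;> field_simp

lemma ww_decomp (h : SpecialLinearGroup (Fin 3) F) (σ : Equiv.Perm (Fin 3))
    (h10 : h (σ 1) 0 = 0) (h20 : h (σ 2) 0 = 0) (h21 : h (σ 2) 1 = 0) :
    ∃ t : Tor F, ∃ u ∈ UU F, h = ww σ * (DD t * u) := by
  have key : ∀ k j, h (σ k) j = (if σ k = 0 then ((Equiv.Perm.sign σ : ℤ) : F) else 1) *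
      ((ww σ)⁻¹ * h : SpecialLinearGroup (Fin 3) F) k j := by
    intro k j
    have e : h = ww σ * ((ww σ)⁻¹ * h) := by group
    conv_lhs => rw [e]
    rw [Matrix.SpecialLinearGroup.coe_mul, Matrix.mul_apply, Finset.sum_eq_single k]
    · rw [ww_apply, if_pos rfl]
    · intro l _ hl
      rw [ww_apply, if_neg (fun h => hl (σ.injective h).symm), zero_mul]
    · simp
  have hne : ∀ k, (if σ k = 0 then ((Equiv.Perm.sign σ : ℤ) : F) else 1) ≠ 0 := by
    intro k
    split_ifs
    · rcases Int.units_eq_one_or (Equiv.Perm.sign σ) with h | h <;> rw [h] <;> simp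
    · exact one_ne_zero
  have hz : ∀ k j, h (σ k) j = 0 → ((ww σ)⁻¹ * h : SpecialLinearGroup (Fin 3) F) k j = 0 := by
    intro k j h0
    rw [key] at h0
    exact (mul_eq_zero.1 h0).resolve_left (hne k)
  obtain ⟨t, u, hu, e⟩ := upper_decomp _ (hz _ _ h10) (hz _ _ h20) (hz _ _ h21)
  refine ⟨t, u, hu, ?_⟩
  rw [← e]; group

lemma bruhat_aux (g : SpecialLinearGroup (Fin 3) F) :
    ∃ u ∈ UU F, ∃ σ : Equiv.Perm (Fin 3),
      (u * g) (σ 1) 0 = 0 ∧ (u * g) (σ 2) 0 = 0 ∧ (u * g) (σ 2) 1 = 0 := by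
  have step : ∀ (g : SpecialLinearGroup (Fin 3) F) (u : SpecialLinearGroup (Fin 3) F), u ∈ UU F →
      (∃ u' ∈ UU F, ∃ σ : Equiv.Perm (Fin 3),
      (u' * (u * g)) (σ 1) 0 = 0 ∧ (u' * (u * g)) (σ 2) 0 = 0 ∧ (u' * (u * g)) (σ 2) 1 = 0) →
      ∃ u ∈ UU F, ∃ σ : Equiv.Perm (Fin 3),
      (u * g) (σ 1) 0 = 0 ∧ (u * g) (σ 2) 0 = 0 ∧ (u * g) (σ 2) 1 = 0 := by
    rintro g u hu ⟨u', hu', σ, h⟩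
    exact ⟨u' * u, mul_mem hu' hu, σ, by rw [mul_assoc]; exact h⟩
  have r0 : ∀ (a b c : F) (g : SpecialLinearGroup (Fin 3) F) j, (uu a b c * g) 0 j = g 0 j + a * g 1 j + b * g 2 j := by
    intro a b c g j
    rw [sl_mul_apply]; simp [uu_coe]
  have r1 : ∀ (a b c : F) (g : SpecialLinearGroup (Fin 3) F) j, (uu a b c * g) 1 j = g 1 j + c * g 2 j := by
    intro a b c g j
    rw [sl_mul_apply]; simp [uu_coe]
  have r2 : ∀ (a b c : F) (g : SpecialLinearGroup (Fin 3) F) j, (uu a b c * g) 2 j = g 2 j := by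
    intro a b c g j
    rw [sl_mul_apply]; simp [uu_coe]
  have c1 : (Equiv.swap (0 : Fin 3) 2) 1 = 1 := by decide
  have c2 : (Equiv.swap (0 : Fin 3) 2) 2 = 0 := by decide
  have c3 : (finRotate 3)⁻¹ 1 = 0 := by decide
  have c4 : (finRotate 3)⁻¹ 2 = 1 := by decide
  have c5 : (finRotate 3) 1 = 2 := by decide
  have c6 : (finRotate 3) 2 = 0 := by decide
  have c7 : (Equiv.swap (0 : Fin 3) 1) 1 = 0 := by decide
  have c8 : (Equiv.swap (0 : Fin 3) 1) 2 = 2 := by decide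
  have c9 : (Equiv.swap (1 : Fin 3) 2) 1 = 2 := by decide
  have c10 : (Equiv.swap (1 : Fin 3) 2) 2 = 1 := by decide
  by_cases h20 : g 2 0 = 0
  · by_cases h10 : g 1 0 = 0
    · by_cases h21 : g 2 1 = 0
      · exact ⟨1, one_mem _, 1, by simpa using ⟨h10, h20, h21⟩⟩
      · refine ⟨uu 0 0 (-(g 1 1 / g 2 1)), uu_mem _ _ _, Equiv.swap 1 2, ?_⟩
        rw [c9, c10]
        simp only [r0, r1, r2, h20, h10]
        refine ⟨by simp, by simp, by field_simp; simp⟩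
    · refine step g (uu (-(g 0 0 / g 1 0)) 0 0) (uu_mem _ _ _) ?_
      set h := uu (-(g 0 0 / g 1 0)) 0 0 * g with hh
      have k20 : h 2 0 = 0 := by rw [hh, r2, h20]
      have k00 : h 0 0 = 0 := by rw [hh, r0]; field_simp; simp
      by_cases h21 : h 2 1 = 0
      · refine ⟨1, one_mem _, Equiv.swap 0 1, ?_⟩
        rw [c7, c8, one_mul]
        exact ⟨k00, k20, h21⟩
      · refine ⟨uu 0 (-(h 0 1 / h 2 1)) 0, uu_mem _ _ _, finRotate 3, ?_⟩
        rw [c5, c6]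
        simp only [r0, r1, r2, k20, k00]
        refine ⟨by simp, by simp, by field_simp; simp⟩
  · refine step g (uu 0 (-(g 0 0 / g 2 0)) (-(g 1 0 / g 2 0))) (uu_mem _ _ _) ?_
    set h := uu 0 (-(g 0 0 / g 2 0)) (-(g 1 0 / g 2 0)) * g with hh
    have k10 : h 1 0 = 0 := by rw [hh, r1]; field_simp; simp
    have k00 : h 0 0 = 0 := by rw [hh, r0]; field_simp; simp
    by_cases h11 : h 1 1 = 0
    · refine ⟨1, one_mem _, (finRotate 3)⁻¹, ?_⟩
      rw [c3, c4, one_mul]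
      exact ⟨k00, k10, h11⟩
    · refine ⟨uu (-(h 0 1 / h 1 1)) 0 0, uu_mem _ _ _, Equiv.swap 0 2, ?_⟩
      rw [c1, c2]
      simp only [r0, r1, r2, k10, k00]
      refine ⟨by simp, by simp, by field_simp; simp⟩

lemma bruhat (g : SpecialLinearGroup (Fin 3) F) :
    ∃ u ∈ UU F, ∃ σ : Equiv.Perm (Fin 3), ∃ t : Tor F, ∃ u' ∈ UU F, g = u * (ww σ * (DD t * u')) := by
  obtain ⟨u, hu, σ, h1, h2, h3⟩ := bruhat_aux g
  obtain ⟨t, u', hu', e⟩ := ww_decomp _ σ h1 h2 h3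
  refine ⟨u⁻¹, inv_mem hu, σ, t, u', hu', ?_⟩
  rw [← e]; group

lemma comm_DD (g : SpecialLinearGroup (Fin 3) F) (t : Tor F) (h : g * DD t = DD t * g) (i j : Fin 3)
    (hij : (t : Fin 3 → Fˣ) i ≠ (t : Fin 3 → Fˣ) j) : g i j = 0 := by
  have h1 : (g * DD t) i j = (DD t * g) i j := by rw [h]
  have e1 : (g * DD t) i j = g i j * ((t : Fin 3 → Fˣ) j : F) := by
    rw [Matrix.SpecialLinearGroup.coe_mul]
    exact Matrix.mul_diagonal _ _ _ _
  have e2 : (DD t * g) i j = ((t : Fin 3 → Fˣ) i : F) * g i j := by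
    rw [Matrix.SpecialLinearGroup.coe_mul]
    exact Matrix.diagonal_mul _ _ _ _
  rw [e1, e2] at h1
  have h2 : (((t : Fin 3 → Fˣ) j : F) - ((t : Fin 3 → Fˣ) i : F)) * g i j = 0 := by
    linear_combination h1
  rcases mul_eq_zero.1 h2 with h | h
  · exact absurd (Units.ext (sub_eq_zero.1 h)).symm hij
  · exact h

lemma cent_UU (t : Tor F) (ht : Function.Injective (t : Fin 3 → Fˣ)) (u) (hu : u ∈ UU F)
    (h : u * DD t = DD t * u) : u = 1 := by
  obtain ⟨h1, h2, h3, h4, h5, h6⟩ := hu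
  have k : ∀ i j, i ≠ j → u i j = 0 := fun i j hij => comm_DD u t h i j fun e => hij (ht e)
  ext i j
  fin_cases i <;> fin_cases j <;> simp [h1, h2, h3, k]

lemma cent_UQ (t : Tor F) (h02 : (t : Fin 3 → Fˣ) 0 ≠ (t : Fin 3 → Fˣ) 2)
    (h12 : (t : Fin 3 → Fˣ) 1 ≠ (t : Fin 3 → Fˣ) 2) (u) (hu : u ∈ UQ F)
    (h : u * DD t = DD t * u) : u = 1 := by
  obtain ⟨h1, h2, h3, h4, h5, h6, h7⟩ := hu
  have k1 := comm_DD u t h 0 2 h02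
  have k2 := comm_DD u t h 1 2 h12
  ext i j
  fin_cases i <;> fin_cases j <;> simp [h1, h2, h3, h4, h5, h6, h7, k1, k2]

lemma comm_inv_of {G : Type*} [Group G] {g x : G} (h : g * x = x * g) : g⁻¹ * x = x * g⁻¹ := by
  have h' : Commute g x := h
  exact h'.inv_left

lemma norm_UU (t : Tor F) (ht : Function.Injective (t : Fin 3 → Fˣ)) (g)
    (hg : g * DD t = DD t * g) (u) (hu : u ∈ UU F) : g * u * g⁻¹ ∈ UU F := by
  obtain ⟨h1, h2, h3, h4, h5, h6⟩ := hu
  have k : ∀ i j, i ≠ j → g i j = 0 := fun i j hij => comm_DD g t hg i j fun e => hij (ht e)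
  have k' : ∀ i j, i ≠ j → g⁻¹ i j = 0 := fun i j hij =>
    comm_DD _ t (comm_inv_of hg) i j fun e => hij (ht e)
  have a0 := sl_mul_inv g 0 0
  have a1 := sl_mul_inv g 1 1
  have a2 := sl_mul_inv g 2 2
  rw [k 0 1 (by decide), k 0 2 (by decide), if_pos rfl] at a0
  rw [k 1 0 (by decide), k 1 2 (by decide), if_pos rfl] at a1
  rw [k 2 0 (by decide), k 2 1 (by decide), if_pos rfl] at a2
  rw [mem_UU]
  simp only [sl_mul_apply, h1, h2, h3, h4, h5, h6, k 0 1 (by decide), k 0 2 (by decide),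
    k 1 0 (by decide), k 1 2 (by decide), k 2 0 (by decide), k 2 1 (by decide),
    k' 0 1 (by decide), k' 0 2 (by decide),
    k' 1 0 (by decide), k' 1 2 (by decide), k' 2 0 (by decide), k' 2 1 (by decide)]
  refine ⟨?_, ?_, ?_, ?_, ?_, ?_⟩
  · linear_combination a0
  · linear_combination a1
  · linear_combination a2
  all_goals ring

lemma norm_UQ (t : Tor F) (h02 : (t : Fin 3 → Fˣ) 0 ≠ (t : Fin 3 → Fˣ) 2)
    (h12 : (t : Fin 3 → Fˣ) 1 ≠ (t : Fin 3 → Fˣ) 2) (g)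
    (hg : g * DD t = DD t * g) (u) (hu : u ∈ UQ F) : g * u * g⁻¹ ∈ UQ F := by
  obtain ⟨h1, h2, h3, h4, h5, h6, h7⟩ := hu
  have b1 := comm_DD g t hg 0 2 h02
  have b2 := comm_DD g t hg 1 2 h12
  have b3 := comm_DD g t hg 2 0 h02.symm
  have b4 := comm_DD g t hg 2 1 h12.symm
  have c1 := comm_DD _ t (comm_inv_of hg) 0 2 h02
  have c2 := comm_DD _ t (comm_inv_of hg) 1 2 h12
  have c3 := comm_DD _ t (comm_inv_of hg) 2 0 h02.symm
  have c4 := comm_DD _ t (comm_inv_of hg) 2 1 h12.symm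
  have a00 := sl_mul_inv g 0 0
  have a01 := sl_mul_inv g 0 1
  have a10 := sl_mul_inv g 1 0
  have a11 := sl_mul_inv g 1 1
  have a22 := sl_mul_inv g 2 2
  rw [if_pos rfl] at a00 a11 a22
  rw [if_neg (by decide)] at a01 a10
  rw [b1, c3] at a00
  rw [b1, c4] at a01
  rw [b2, c3] at a10
  rw [b2, c4] at a11
  rw [b3, b4] at a22
  rw [mem_UQ]
  simp only [sl_mul_apply, h1, h2, h3, h4, h5, h6, h7, b1, b2, b3, b4, c1, c2, c3, c4]
  refine ⟨?_, ?_, ?_, ?_, ?_, ?_, ?_⟩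
  · linear_combination a00
  · linear_combination a11
  · linear_combination a22
  · linear_combination a10
  · ring
  · ring
  · linear_combination a01

lemma UU_decomp (u) (hu : u ∈ UU F) : ∃ a : F, ∃ u' ∈ UQ F, u = uu a 0 0 * u' := by
  obtain ⟨h1, h2, h3, h4, h5, h6⟩ := hu
  refine ⟨u 0 1, uu 0 (u 0 2 - u 0 1 * u 1 2) (u 1 2), ?_, ?_⟩
  · rw [mem_UQ]; simp [uu_coe]
  · ext i j
    rw [sl_mul_apply]
    simp only [uu_coe]
    fin_cases i <;> fin_cases j <;> simp [h1, h2, h3, h4, h5, h6]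

lemma uu_comm_DD (t : Tor F) (h01 : (t : Fin 3 → Fˣ) 0 = (t : Fin 3 → Fˣ) 1) (a : F) :
    uu a 0 0 * DD t = DD t * uu a 0 0 := by
  ext i j
  simp only [sl_mul_apply, DD_apply, uu_coe]
  fin_cases i <;> fin_cases j <;> simp [h01, mul_comm]

lemma DD_of_comm (t : Tor F) (ht : Function.Injective (t : Fin 3 → Fˣ)) (g)
    (hg : g * DD t = DD t * g) : ∃ t', g = DD t' := by
  have k : ∀ i j, i ≠ j → g i j = 0 := fun i j hij => comm_DD g t hg i j fun e => hij (ht e)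
  obtain ⟨t', u, hu, e⟩ := upper_decomp g (k _ _ (by decide)) (k _ _ (by decide)) (k _ _ (by decide))
  refine ⟨t', ?_⟩
  have : u = 1 := by
    refine cent_UU t ht u hu ?_
    have : u = (DD t')⁻¹ * g := by rw [e]; group
    rw [this]
    have e2 : (DD t')⁻¹ * DD t = DD t * (DD t')⁻¹ := by
      rw [← map_inv, ← map_mul, ← map_mul, mul_comm]
    rw [mul_assoc, hg, ← mul_assoc, e2, mul_assoc]
  rw [e, this, mul_one]

end P6c

section P6d
set_option linter.all false
open Matrix Polynomial

lemma num_lem1 (p q k : ℕ) (hp : p.Prime) (hodd : Odd p) (hq : 2 ≤ q) (hpq : p ∣ q - 1)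
    (h : p ^ k ∣ q ^ 2 - 1) : p ^ k ∣ q - 1 := by
  have e : q ^ 2 - 1 = (q + 1) * (q - 1) := by
    have := Nat.sq_sub_sq q 1
    simpa using this
  rw [e] at h
  refine Nat.Coprime.dvd_of_dvd_mul_left ?_ h
  refine Nat.Coprime.pow_left _ ((Nat.Prime.coprime_iff_not_dvd hp).2 fun h2 => ?_)
  have h3 := Nat.dvd_sub h2 hpq
  have h4 : q + 1 - (q - 1) = 2 := by omega
  rw [h4] at h3
  have h5 := (Nat.prime_dvd_prime_iff_eq hp Nat.prime_two).1 h3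
  subst h5
  exact absurd hodd (by decide)

lemma num_lem2 (p q k : ℕ) (hp : p.Prime) (hodd : Odd p) (hq : 2 ≤ q) (hpq : p ∣ q - 1)
    (h : p ^ k ∣ 1 + q + q ^ 2) : p ^ k ∣ q - 1 := by
  rcases Nat.lt_or_ge k 2 with hk | hk
  · interval_cases k
    · simp
    · simpa using hpq
  · exfalso
    have h2 := (pow_dvd_pow p hk).trans h
    obtain ⟨m, hm⟩ := hpq
    have hq' : q = 1 + p * m := by omega
    have e : 1 + q + q ^ 2 = p ^ 2 * m ^ 2 + 3 * (1 + p * m) := by rw [hq']; ring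
    rw [e] at h2
    have h3 := (Nat.dvd_add_right (Dvd.intro _ rfl)).1 h2
    have h4 : Nat.Coprime (p ^ 2) (1 + p * m) := by
      refine Nat.Coprime.pow_left _ ?_
      simp
    have h5 := h4.dvd_of_dvd_mul_right h3
    have h6 := Nat.le_of_dvd (by norm_num) h5
    have := hp.two_le
    nlinarith

lemma diag_pow {F : Type*} [Field F] [Fintype F] (p E : ℕ) (hp : p.Prime) (hodd : Odd p)
    (hpq : p ∣ Fintype.card F - 1) (M : SpecialLinearGroup (Fin 3) F) (hM : M ^ p ^ E = 1) :
    (M : Matrix (Fin 3) (Fin 3) F) ^ (Fintype.card F - 1) = 1 := by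
  set q := Fintype.card F with hq
  have hq2 : 2 ≤ q := Fintype.one_lt_card
  let K := AlgebraicClosure F
  let f := algebraMap F K
  have hMm : (M : Matrix (Fin 3) (Fin 3) F) ^ p ^ E = 1 := by
    rw [← Matrix.SpecialLinearGroup.coe_pow, hM]; simp
  have hmd1 : minpoly F (M : Matrix (Fin 3) (Fin 3) F) ∣ X ^ (p ^ E) - C 1 :=
    minpoly.dvd _ _ (by simp [hMm])
  have hpF : ((p ^ E : ℕ) : F) ≠ 0 := by
    intro h
    rw [Nat.cast_pow] at h
    have h2 : (p : F) = 0 := eq_zero_of_pow_eq_zero h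
    have h3 : ((q - 1 : ℕ) : F) = 0 := by
      obtain ⟨m, hm⟩ := hpq
      rw [hm]; push_cast; rw [h2, zero_mul]
    rw [Nat.cast_sub (by omega), hq, FiniteField.cast_card_eq_zero] at h3
    simp at h3
  have hsep : (minpoly F (M : Matrix (Fin 3) (Fin 3) F)).Separable :=
    (separable_X_pow_sub_C (1 : F) hpF one_ne_zero).of_dvd hmd1
  have hm0 : minpoly F (M : Matrix (Fin 3) (Fin 3) F) ≠ 0 := minpoly.ne_zero (Matrix.isIntegral _)
  have hroot : ∀ μ : K, aeval μ (M : Matrix (Fin 3) (Fin 3) F).charpoly = 0 →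
      μ ^ p ^ E = 1 → μ ^ (q - 1) = 1 := by
    intro μ hμ hμp
    have hμ0 : μ ≠ 0 := by
      rintro rfl
      rw [zero_pow (pow_pos hp.pos _).ne'] at hμp
      exact zero_ne_one hμp
    obtain ⟨k, hk, hk2⟩ := (Nat.dvd_prime_pow hp).1 (orderOf_dvd_of_pow_eq_one hμp)
    have hfr : ∀ x : K, aeval x (M : Matrix (Fin 3) (Fin 3) F).charpoly = 0 →
        aeval (x ^ q) (M : Matrix (Fin 3) (Fin 3) F).charpoly = 0 := by
      intro x hx
      rw [← Polynomial.expand_aeval, FiniteField.expand_card, map_pow, hx, zero_pow (by omega)]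
    have hcan : ∀ n : ℕ, 1 ≤ n → μ ^ n = μ → μ ^ (n - 1) = 1 := by
      intro n hn h
      have : μ ^ (n - 1) * μ = 1 * μ := by
        rw [← pow_succ, Nat.sub_add_cancel hn, one_mul, h]
      exact mul_right_cancel₀ hμ0 this
    have hfin : ∀ n : ℕ, (p ^ k ∣ n → p ^ k ∣ q - 1) → μ ^ n = 1 → μ ^ (q - 1) = 1 := by
      intro n h1 h2
      apply orderOf_dvd_iff_pow_eq_one.1
      rw [hk2]
      apply h1
      rw [← hk2]
      exact orderOf_dvd_of_pow_eq_one h2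
    by_cases h01 : μ ^ q = μ
    · exact hcan q (by omega) h01
    by_cases h02 : (μ ^ q) ^ q = μ
    · rw [← pow_mul, ← sq] at h02
      exact hfin _ (num_lem1 p q k hp hodd hq2 hpq) (hcan _ (Nat.one_le_pow _ _ (by omega)) h02)
    have h12 : (μ ^ q) ^ q ≠ μ ^ q := by
      intro h
      apply h01
      have h1 : (μ ^ q) ^ (q - 1) = 1 := by
        have : (μ ^ q) ^ (q - 1) * μ ^ q = 1 * μ ^ q := by
          rw [← pow_succ, Nat.sub_add_cancel (by omega), one_mul, h]
        exact mul_right_cancel₀ (pow_ne_zero _ hμ0) this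
      have h2 : μ ^ (q - 1) = 1 := by
        apply orderOf_dvd_iff_pow_eq_one.1
        rw [← pow_mul] at h1
        have h3 := orderOf_dvd_of_pow_eq_one h1
        refine Nat.Coprime.dvd_of_dvd_mul_left ?_ h3
        rw [hk2]
        refine Nat.Coprime.pow_left _ ((Nat.Prime.coprime_iff_not_dvd hp).2 fun h2 => ?_)
        have h3 := Nat.dvd_sub h2 hpq
        have h4 : q - (q - 1) = 1 := by omega
        rw [h4, Nat.dvd_one] at h3
        exact hp.one_lt.ne' h3
      calc μ ^ q = μ ^ (q - 1) * μ := by rw [← pow_succ, Nat.sub_add_cancel (by omega)]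
        _ = μ := by rw [h2, one_mul]
    refine hfin _ (num_lem2 p q k hp hodd hq2 hpq) ?_
    have hch : ((M : Matrix (Fin 3) (Fin 3) F).map f).charpoly =
      (M : Matrix (Fin 3) (Fin 3) F).charpoly.map f := Matrix.charpoly_map _ _
    have hcard : Multiset.card ((M : Matrix (Fin 3) (Fin 3) F).map f).charpoly.roots = 3 := by
      rw [← (IsAlgClosed.splits _).natDegree_eq_card_roots, Matrix.charpoly_natDegree_eq_dim]
      simp
    have hmem : ∀ x : K, aeval x (M : Matrix (Fin 3) (Fin 3) F).charpoly = 0 →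
        x ∈ ((M : Matrix (Fin 3) (Fin 3) F).map f).charpoly.roots := by
      intro x hx
      rw [mem_roots (Matrix.charpoly_monic _).ne_zero, IsRoot, hch, eval_map_algebraMap]
      exact hx
    have hle : ({μ, μ ^ q, (μ ^ q) ^ q} : Multiset K) ≤
        ((M : Matrix (Fin 3) (Fin 3) F).map f).charpoly.roots := by
      rw [Multiset.le_iff_subset]
      · intro x hx
        simp only [Multiset.insert_eq_cons, Multiset.mem_cons, Multiset.mem_singleton] at hx
        rcases hx with rfl | rfl | rfl
        · exact hmem _ hμ
        · exact hmem _ (hfr _ hμ)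
        · exact hmem _ (hfr _ (hfr _ hμ))
      · simp only [Multiset.insert_eq_cons, Multiset.nodup_cons, Multiset.mem_cons,
          Multiset.mem_singleton, Multiset.nodup_singleton, not_or]
        exact ⟨⟨fun h => h01 h.symm, fun h => h02 h.symm⟩, fun h => h12 h.symm, trivial⟩
    have heq := Multiset.eq_of_le_of_card_le hle (by rw [hcard]; simp)
    have hdet := Matrix.det_eq_prod_roots_charpoly ((M : Matrix (Fin 3) (Fin 3) F).map f)
    rw [← heq] at hdet
    have hd1 : ((M : Matrix (Fin 3) (Fin 3) F).map f).det = 1 := by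
      have := RingHom.map_det f (M : Matrix (Fin 3) (Fin 3) F)
      rw [M.det_coe, map_one] at this
      exact this.symm
    rw [hd1] at hdet
    simp only [Multiset.insert_eq_cons, Multiset.prod_cons, Multiset.prod_singleton] at hdet
    rw [hdet]; ring
  have hdvd : minpoly F (M : Matrix (Fin 3) (Fin 3) F) ∣ X ^ (q - 1) - 1 := by
    rw [← Polynomial.map_dvd_map' f]
    have hX0 : (Polynomial.map f (X ^ (q - 1) - 1 : F[X])) ≠ 0 := by
      rw [Polynomial.map_ne_zero_iff f.injective]
      exact X_pow_sub_C_ne_zero (by omega) (1 : F)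
    refine Polynomial.Splits.dvd_of_roots_le_roots (IsAlgClosed.splits _)
      ((Polynomial.map_ne_zero_iff f.injective).2 hm0) ?_
    rw [Multiset.le_iff_subset (nodup_roots hsep.map)]
    intro μ hμ
    have h1 := (mem_roots'.1 hμ).2
    rw [IsRoot, eval_map_algebraMap] at h1
    have h2 : ∀ P, minpoly F (M : Matrix (Fin 3) (Fin 3) F) ∣ P → aeval μ P = 0 := by
      rintro P ⟨R, rfl⟩
      rw [map_mul, h1, zero_mul]
    have h3 := h2 _ hmd1
    have h4 := hroot μ (h2 _ (Matrix.minpoly_dvd_charpoly _)) (by simpa [sub_eq_zero] using h3)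
    rw [mem_roots hX0, IsRoot, eval_map_algebraMap]
    simp [h4]
  obtain ⟨R, hR⟩ := hdvd
  have : aeval (M : Matrix (Fin 3) (Fin 3) F) (X ^ (q - 1) - 1 : F[X]) = 0 := by
    rw [hR, map_mul, minpoly.aeval, zero_mul]
  simpa [sub_eq_zero] using this


lemma diag_exists {F : Type*} [Field F] [Fintype F] (M : SpecialLinearGroup (Fin 3) F)
    (hM : (M : Matrix (Fin 3) (Fin 3) F) ^ (Fintype.card F - 1) = 1) :
    ∃ P : SpecialLinearGroup (Fin 3) F, ∃ t : Tor F, M * P = P * DD t := by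
  classical
  set q := Fintype.card F with hq
  have hq2 : 2 ≤ q := Fintype.one_lt_card
  let A : Matrix (Fin 3) (Fin 3) F := M
  have hA : A ^ (q - 1) = 1 := hM
  let PP : Fˣ → Matrix (Fin 3) (Fin 3) F := fun a => ∑ i ∈ Finset.range (q - 1), ((a⁻¹ : Fˣ) : F) ^ i • A ^ i
  have h1 : ∀ a, A * PP a = (a : F) • PP a := by
    intro a
    have e1 : ∑ i ∈ Finset.range (q - 1), ((a⁻¹ : Fˣ) : F) ^ (i + 1) • A ^ (i + 1) = PP a := by
      have h2 := Finset.sum_range_succ (fun i => ((a⁻¹ : Fˣ) : F) ^ i • A ^ i) (q - 1)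
      have h3 := Finset.sum_range_succ' (fun i => ((a⁻¹ : Fˣ) : F) ^ i • A ^ i) (q - 1)
      rw [h2] at h3
      have h4 : ((a⁻¹ : Fˣ) : F) ^ (q - 1) = 1 := by
        rw [hq]; exact FiniteField.pow_card_sub_one_eq_one _ (Units.ne_zero _)
      rw [hA, h4, pow_zero, pow_zero] at h3
      exact (add_right_cancel h3).symm
    conv_rhs => rw [← e1]
    simp only [PP]
    rw [Finset.smul_sum, Finset.mul_sum]
    refine Finset.sum_congr rfl fun i _ => ?_
    rw [Matrix.mul_smul, ← pow_succ', smul_smul]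
    congr 1
    rw [pow_succ']
    simp
  have h2 : ∑ a : Fˣ, PP a = -1 := by
    simp only [PP]
    rw [Finset.sum_comm]
    simp_rw [← Finset.sum_smul]
    have e : ∀ i, ∑ a : Fˣ, ((a⁻¹ : Fˣ) : F) ^ i = if q - 1 ∣ i then -1 else 0 := by
      intro i
      rw [← FiniteField.sum_pow_units F i]
      exact Equiv.sum_comp (Equiv.inv Fˣ) (fun a : Fˣ => (a : F) ^ i)
    simp_rw [e]
    rw [Finset.sum_eq_single 0]
    · simp
    · intro i hi hi0
      rw [if_neg, zero_smul]
      intro hd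
      have := Nat.le_of_dvd (by omega) hd
      rw [Finset.mem_range] at hi
      omega
    · intro h
      exact absurd (Finset.mem_range.2 (by omega)) h
  let S : Set (Fin 3 → F) := {v | ∃ a : Fˣ, A *ᵥ v = (a : F) • v}
  have hS : ⊤ ≤ Submodule.span F S := by
    intro v _
    have h3 : v = - ∑ a : Fˣ, PP a *ᵥ v := by
      rw [← Matrix.sum_mulVec, h2, Matrix.neg_mulVec, Matrix.one_mulVec, neg_neg]
    rw [h3]
    refine Submodule.neg_mem _ (Submodule.sum_mem _ fun a _ => Submodule.subset_span ⟨a, ?_⟩)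
    rw [Matrix.mulVec_mulVec, h1, Matrix.smul_mulVec]
  let b := Module.Basis.ofSpan hS
  let e := b.indexEquiv (Pi.basisFun F (Fin 3))
  let b' := b.reindex e
  have hb : ∀ i, ∃ a : Fˣ, A *ᵥ (b' i) = (a : F) • b' i := by
    intro i
    rw [Module.Basis.reindex_apply]
    exact Module.Basis.ofSpan_subset hS ⟨_, rfl⟩
  choose a ha using hb
  let P : Matrix (Fin 3) (Fin 3) F := Matrix.of fun i j => b' j i
  have hP : IsUnit P := Matrix.linearIndependent_cols_iff_isUnit.1 b'.linearIndependent
  have hPd : P.det ≠ 0 := ((Matrix.isUnit_iff_isUnit_det P).1 hP).ne_zero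
  have hMP : A * P = P * diagonal (fun i => (a i : F)) := by
    ext i j
    rw [Matrix.mul_diagonal]
    have := congrFun (ha j) i
    simp only [Pi.smul_apply, smul_eq_mul] at this
    rw [mul_comm] at this
    exact this
  let d : Fin 3 → F := fun i => if i = 0 then P.det⁻¹ else 1
  have hPd1 : (P * diagonal d).det = 1 := by
    rw [Matrix.det_mul, Matrix.det_diagonal, Fin.prod_univ_three]
    simp [d, hPd]
  have hat : a ∈ Tor F := by
    rw [mem_Tor]
    have h4 := congrArg Matrix.det hMP
    rw [Matrix.det_mul, Matrix.det_mul, Matrix.det_diagonal] at h4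
    have h5 : A.det = 1 := M.det_coe
    rw [h5, one_mul] at h4
    have h6 : P.det * (∏ i, (a i : F)) = P.det * 1 := by rw [← h4, mul_one]
    ext
    rw [Units.coe_prod]
    exact mul_left_cancel₀ hPd h6
  refine ⟨⟨P * diagonal d, hPd1⟩, ⟨a, hat⟩, ?_⟩
  apply Subtype.ext
  change A * (P * diagonal d) = (P * diagonal d) * diagonal (fun i => (a i : F))
  rw [← mul_assoc, hMP, mul_assoc, mul_assoc, Matrix.diagonal_mul_diagonal, Matrix.diagonal_mul_diagonal]
  simp only [mul_comm]

lemma diag_conj {F : Type*} [Field F] [Fintype F] (p E : ℕ) (hp : p.Prime) (hodd : Odd p)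
    (hpq : p ∣ Fintype.card F - 1) (M : SpecialLinearGroup (Fin 3) F) (hM : M ^ p ^ E = 1) :
    ∃ P : SpecialLinearGroup (Fin 3) F, ∃ t : Tor F, M = P * DD t * P⁻¹ := by
  obtain ⟨P, t, h⟩ := diag_exists M (diag_pow p E hp hodd hpq M hM)
  exact ⟨P, t, by rw [← h]; group⟩

end P6d

section P6e
set_option linter.all false
open Matrix Module

lemma trace_of_basis {V : Type*} [AddCommGroup V] [Module ℂ V] [FiniteDimensional ℂ V]
    (f : V →ₗ[ℂ] V) {κ : Type*} [Fintype κ] (y : κ → V) (hli : LinearIndependent ℂ y)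
    (hr : ∀ x, f x ∈ Submodule.span ℂ (Set.range y)) (c : κ → ℂ) (hc : ∀ k, f (y k) = c k • y k) :
    LinearMap.trace ℂ V f = ∑ k, c k := by
  classical
  let b := Basis.span hli
  rw [← LinearMap.trace_restrict_eq_of_forall_mem _ f hr, LinearMap.trace_eq_matrix_trace ℂ b,
    Matrix.trace]
  refine Finset.sum_congr rfl fun k _ => ?_
  rw [Matrix.diag_apply, LinearMap.toMatrix_apply]
  have h1 : (f.restrict (fun x _ => hr x) : Submodule.span ℂ (Set.range y) →ₗ[ℂ] _) (b k) = c k • b k := by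
    apply Subtype.ext
    rw [LinearMap.restrict_coe_apply, Submodule.coe_smul, Basis.span_apply, hc]
  rw [h1]
  simp

variable {F : Type*} [Field F] [Fintype F]

lemma exists_spec (p : ℕ) (hp : p.Prime) (hodd : Odd p)
    (hpq : p ∣ Fintype.card F - 1) :
    ∃ t : Tor F, t ^ p = 1 ∧ Function.Injective (t : Fin 3 → Fˣ) := by
  classical
  have hfact : Fact p.Prime := ⟨hp⟩
  obtain ⟨β, hβ⟩ := exists_prime_orderOf_dvd_card (G := Fˣ) p (by rw [Fintype.card_units]; exact hpq)
  have hβ1 : β ≠ 1 := by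
    rintro rfl
    rw [orderOf_one] at hβ
    exact hp.one_lt.ne hβ
  have hβ2 : β ≠ β⁻¹ := by
    intro h
    have : β ^ 2 = 1 := by rw [sq]; nth_rewrite 2 [h]; simp
    have h2 := orderOf_dvd_of_pow_eq_one this
    rw [hβ] at h2
    have h5 := (Nat.prime_dvd_prime_iff_eq hp Nat.prime_two).1 h2
    subst h5
    exact absurd hodd (by decide)
  have hβp : β ^ p = 1 := by rw [← hβ]; exact pow_orderOf_eq_one β
  refine ⟨⟨![β, 1, β⁻¹], ?_⟩, ?_, ?_⟩
  · rw [mem_Tor, Fin.prod_univ_three]; simp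
  · apply Subtype.ext
    funext i
    fin_cases i <;> simp [hβp]
  · intro i j hij
    fin_cases i <;> fin_cases j <;> simp_all [eq_comm]

variable [Fintype (SpecialLinearGroup (Fin 3) F)] {V : Type*} [AddCommGroup V] [Module ℂ V]
  [FiniteDimensional ℂ V]

/-- highest weight vector -/
def IsHW (ρ : SpecialLinearGroup (Fin 3) F →* (V →ₗ[ℂ] V)) (v : V) (l : Tor F →* ℂˣ) : Prop :=
  v ≠ 0 ∧ (∀ u ∈ UU F, ρ u v = v) ∧ ∀ t, ρ (DD t) v = ((l t : ℂˣ) : ℂ) • v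

lemma norm_DD (p : ℕ) (hp : p.Prime) (hodd : Odd p)
    (hpq : p ∣ Fintype.card F - 1) (t : Tor F) : ∀ u ∈ UU F, DD t * u * (DD t)⁻¹ ∈ UU F := by
  obtain ⟨t0, _, h⟩ := exists_spec (F := F) p hp hodd hpq
  exact norm_UU t0 h (DD t) (by rw [← map_mul, ← map_mul, mul_comm])

lemma exists_hw (ρ : SpecialLinearGroup (Fin 3) F →* (V →ₗ[ℂ] V)) (p : ℕ) (hp : p.Prime) (hodd : Odd p)
    (hpq : p ∣ Fintype.card F - 1) (hdim : ¬ p ∣ finrank ℂ V) :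
    ∃ v l, IsHW ρ v l := by
  classical
  have hne : avg ρ (UU F) ≠ 0 := by
    intro h0
    obtain ⟨t0, ht0, hinj⟩ := exists_spec (F := F) p hp hodd hpq
    have h1 := trace_avg ρ (UU F) (DD t0) (norm_DD p hp hodd hpq t0) (fun h hh hc => cent_UU t0 hinj h hh hc)
    rw [h0, mul_zero, map_zero] at h1
    have h2 := dim_cong ρ p hp 1 (DD t0) (by rw [pow_one, ← map_pow, ht0, map_one])
      (∅ : Finset ℕ) (fun _ => 0) (by simp) (by rw [← h1]; simp)
    apply hdim
    have h3 : (p : ℤ) ∣ (finrank ℂ V : ℤ) := by simpa using h2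
    exact_mod_cast h3
  obtain ⟨w, hw⟩ : ∃ w, avg ρ (UU F) w ≠ 0 := by
    by_contra! h
    exact hne (LinearMap.ext h)
  have hfin := Fintype.ofFinite (Tor F →* ℂˣ)
  let ρT : Tor F →* (V →ₗ[ℂ] V) := ρ.comp DD
  have hsum := sum_isoProj ρT
  obtain ⟨ψ, hψ⟩ : ∃ ψ, isoProj ρT ψ (avg ρ (UU F) w) ≠ 0 := by
    by_contra! h
    apply hw
    have := congrArg (fun f => f (avg ρ (UU F) w)) hsum
    simp only [LinearMap.sum_apply] at this
    rw [Finset.sum_eq_zero fun ψ _ => h ψ] at this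
    exact this.symm
  refine ⟨_, ψ, hψ, ?_, fun t => rho_isoProj_apply ρT ψ t _⟩
  have hcomm : isoProj ρT ψ (avg ρ (UU F) w) = avg ρ (UU F) (isoProj ρT ψ w) := by
    unfold isoProj
    simp only [LinearMap.smul_apply, LinearMap.sum_apply, map_smul, map_sum]
    congr 1
    refine Finset.sum_congr rfl fun t _ => ?_
    congr 1
    exact avg_comm ρ (UU F) (DD t) (norm_DD p hp hodd hpq t) w
  intro u hu
  rw [hcomm]
  exact rho_avg_apply ρ _ u hu _

lemma rho_mul_apply {G : Type*} [Group G] (ρ : G →* (V →ₗ[ℂ] V)) (g h : G) (v : V) :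
    ρ (g * h) v = ρ g (ρ h v) := by rw [map_mul]; rfl

lemma span_top {G : Type*} [Group G] (ρ : G →* (V →ₗ[ℂ] V))
    (hirr : ∀ W : Submodule ℂ V, (∀ g, ∀ w ∈ W, ρ g w ∈ W) → W = ⊥ ∨ W = ⊤)
    (v : V) (hv : v ≠ 0) : Submodule.span ℂ (Set.range fun g => ρ g v) = ⊤ := by
  have hst : ∀ g, ∀ w ∈ Submodule.span ℂ (Set.range fun g => ρ g v),
      ρ g w ∈ Submodule.span ℂ (Set.range fun g => ρ g v) := by
    intro g w hw
    induction hw using Submodule.span_induction with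
    | mem x hx =>
      obtain ⟨h, rfl⟩ := hx
      exact Submodule.subset_span ⟨g * h, rho_mul_apply ρ g h v⟩
    | zero => rw [map_zero]; exact zero_mem _
    | add x y _ _ hx hy => rw [map_add]; exact add_mem hx hy
    | smul c x _ hx => rw [map_smul]; exact Submodule.smul_mem _ _ hx
  rcases hirr _ hst with h | h
  · exfalso
    rw [Submodule.span_eq_bot] at h
    apply hv
    have := h (ρ 1 v) ⟨1, rfl⟩
    rwa [map_one] at this
  · exact h

lemma hw_form (ρ : SpecialLinearGroup (Fin 3) F →* (V →ₗ[ℂ] V)) (v : V) (l : Tor F →* ℂˣ)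
    (hv : IsHW ρ v l) (g) : ∃ u ∈ UU F, ∃ σ, ∃ c : ℂ, ρ g v = c • ρ u (ρ (ww σ) v) := by
  obtain ⟨u, hu, σ, t, u', hu', rfl⟩ := bruhat g
  refine ⟨u, hu, σ, ((l t : ℂˣ) : ℂ), ?_⟩
  rw [rho_mul_apply, rho_mul_apply, rho_mul_apply, hv.2.1 u' hu', hv.2.2, map_smul, map_smul]

lemma hw_ww (ρ : SpecialLinearGroup (Fin 3) F →* (V →ₗ[ℂ] V)) (v : V) (l : Tor F →* ℂˣ)
    (hv : IsHW ρ v l) (t : Tor F) (σ) :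
    ρ (DD t) (ρ (ww σ) v) = ((l (permT σ t) : ℂˣ) : ℂ) • ρ (ww σ) v := by
  rw [← rho_mul_apply, DD_ww, rho_mul_apply, hv.2.2, map_smul]

lemma exists_I (ρ : SpecialLinearGroup (Fin 3) F →* (V →ₗ[ℂ] V)) (p : ℕ) (hp : p.Prime) (hodd : Odd p)
    (hpq : p ∣ Fintype.card F - 1)
    (hirr : ∀ W : Submodule ℂ V, (∀ g, ∀ w ∈ W, ρ g w ∈ W) → W = ⊥ ∨ W = ⊤)
    (v : V) (l : Tor F →* ℂˣ) (hv : IsHW ρ v l) :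
    ∃ I : Finset (Equiv.Perm (Fin 3)), ∀ t : Tor F, Function.Injective (t : Fin 3 → Fˣ) →
      LinearMap.trace ℂ V (ρ (DD t)) = ∑ σ ∈ I, ((l (permT σ t) : ℂˣ) : ℂ) := by
  classical
  let y : Equiv.Perm (Fin 3) → V := fun σ => avg ρ (UU F) (ρ (ww σ) v)
  have hy : ∀ x, avg ρ (UU F) x ∈ Submodule.span ℂ (Set.range y) := by
    intro x
    have hx : x ∈ Submodule.span ℂ (Set.range fun g => ρ g v) := by
      rw [span_top ρ hirr v hv.1]; trivial
    induction hx using Submodule.span_induction with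
    | mem x hx =>
      obtain ⟨g, rfl⟩ := hx
      obtain ⟨u, hu, σ, c, e⟩ := hw_form ρ v l hv g
      simp only
      rw [e, map_smul, avg_rho_apply ρ _ u hu]
      exact Submodule.smul_mem _ _ (Submodule.subset_span ⟨σ, rfl⟩)
    | zero => rw [map_zero]; exact zero_mem _
    | add x y _ _ hx hy => rw [map_add]; exact add_mem hx hy
    | smul c x _ hx => rw [map_smul]; exact Submodule.smul_mem _ _ hx
  have hyt : ∀ t σ, ρ (DD t) (y σ) = ((l (permT σ t) : ℂˣ) : ℂ) • y σ := by
    intro t σ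
    simp only [y]
    rw [avg_comm ρ _ _ (norm_DD p hp hodd hpq t), hw_ww ρ v l hv, map_smul]
  obtain ⟨κ, a, ha, hspan, hli⟩ := exists_linearIndependent' ℂ y
  have : Fintype κ := Fintype.ofInjective a ha
  refine ⟨Finset.univ.image a, fun t ht => ?_⟩
  rw [Finset.sum_image (fun i _ j _ h => ha h),
    ← trace_avg ρ (UU F) (DD t) (norm_DD p hp hodd hpq t) (fun h hh hc => cent_UU t ht h hh hc)]
  refine trace_of_basis _ (y ∘ a) hli ?_ _ ?_
  · intro x
    rw [hspan]
    change ρ (DD t) (avg ρ (UU F) x) ∈ _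
    rw [avg_comm ρ _ _ (norm_DD p hp hodd hpq t)]
    exact hy _
  · intro k
    change ρ (DD t) (avg ρ (UU F) (avg ρ (UU F) _)) = _
    rw [avg_avg_apply]
    exact hyt t (a k)

end P6e

section P6f
set_option linter.all false
open Matrix Module

variable {F : Type*} [Field F] [Fintype F]
variable [Fintype (SpecialLinearGroup (Fin 3) F)] {V : Type*} [AddCommGroup V] [Module ℂ V]
  [FiniteDimensional ℂ V]

lemma step3_core (ρ : SpecialLinearGroup (Fin 3) F →* (V →ₗ[ℂ] V))
    (hirr : ∀ W : Submodule ℂ V, (∀ g, ∀ w ∈ W, ρ g w ∈ W) → W = ⊥ ∨ W = ⊤)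
    (v : V) (l : Tor F →* ℂˣ) (hv : IsHW ρ v l) (s : ℕ) (t : Tor F)
    (U : Subgroup (SpecialLinearGroup (Fin 3) F))
    (hnorm : ∀ g, g * DD t = DD t * g → ∀ h ∈ U, g * h * g⁻¹ ∈ U)
    (hcent : ∀ h ∈ U, h * DD t = DD t * h → h = 1)
    (hdec : ∀ u ∈ UU F, ∃ u2, ∃ u' ∈ U, u2 * DD t = DD t * u2 ∧ u = u2 * u')
    (hl : ∀ σ, l (permT σ t) ^ s = 1) (g) (hg : g * DD t = DD t * g) (hgs : g ^ s = DD t ^ s)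
    (hc1 : ∀ h, h * g = g * h → h * DD t = DD t * h)
    (hc2 : ∀ h, h * g ^ (s + 1) = g ^ (s + 1) * h → h * DD t = DD t * h) :
    LinearMap.trace ℂ V (ρ (g ^ (s + 1))) = LinearMap.trace ℂ V (ρ g) := by
  have hzc : ∀ u, u * DD t = DD t * u → u * DD t ^ s = DD t ^ s * u := fun u hu =>
    (show Commute u (DD t) from hu).pow_right s
  have hz : ∀ x, ρ (DD t ^ s) (avg ρ U x) = avg ρ U x := by
    intro x
    have hx : x ∈ Submodule.span ℂ (Set.range fun g => ρ g v) := by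
      rw [span_top ρ hirr v hv.1]; trivial
    induction hx using Submodule.span_induction with
    | mem x hx =>
      obtain ⟨g, rfl⟩ := hx
      obtain ⟨u, hu, σ, c, e⟩ := hw_form ρ v l hv g
      simp only
      rw [e, map_smul, map_smul]
      obtain ⟨u2, u', hu', hcm, rfl⟩ := hdec u hu
      rw [rho_mul_apply, ← avg_comm ρ U u2 (hnorm u2 hcm), avg_rho_apply ρ U u' hu']
      congr 1
      rw [← rho_mul_apply, ← hzc u2 hcm, rho_mul_apply, avg_comm ρ U (DD t ^ s), ← map_pow,
        hw_ww ρ v l hv, map_pow, map_pow, hl]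
      · simp
      · exact hnorm _ (hzc _ rfl).symm
    | zero => rw [map_zero, map_zero]
    | add x y _ _ hx hy => rw [map_add, map_add, hx, hy]
    | smul c x _ hx => rw [map_smul, map_smul, hx]
  have hg2 : g ^ (s + 1) * DD t = DD t * g ^ (s + 1) := (show Commute g (DD t) from hg).pow_left _
  rw [← trace_avg ρ U (g ^ (s + 1)) (hnorm _ hg2) (fun h hh hc => hcent h hh (hc2 h hc)),
    ← trace_avg ρ U g (hnorm _ hg) (fun h hh hc => hcent h hh (hc1 h hc))]
  congr 1
  ext x
  change ρ (g ^ (s + 1)) (avg ρ U x) = ρ g (avg ρ U x)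
  rw [pow_succ', rho_mul_apply, hgs, hz]

lemma conj_pow' {G : Type*} [Group G] (P x : G) (n : ℕ) : (P⁻¹ * x * P) ^ n = P⁻¹ * x ^ n * P := by
  have := conj_pow (a := P⁻¹) (b := x) (i := n)
  simpa using this

lemma trace_conj {G : Type*} [Group G] (ρ : G →* (V →ₗ[ℂ] V)) (P x : G) :
    LinearMap.trace ℂ V (ρ (P⁻¹ * x * P)) = LinearMap.trace ℂ V (ρ x) := by
  rw [map_mul, LinearMap.trace_mul_comm, ← map_mul]
  congr 2
  group

lemma diag_trich (p E : ℕ) (hp : p.Prime) (hodd : Odd p)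
    (hpq : p ∣ Fintype.card F - 1) (x : SpecialLinearGroup (Fin 3) F) (hx : x ^ p ^ E = 1) :
    ∃ P : SpecialLinearGroup (Fin 3) F, ∃ t : Tor F, P⁻¹ * x * P = DD t ∧
      ((∀ i j, (t : Fin 3 → Fˣ) i = (t : Fin 3 → Fˣ) j) ∨ Function.Injective (t : Fin 3 → Fˣ) ∨
        ((t : Fin 3 → Fˣ) 0 = (t : Fin 3 → Fˣ) 1 ∧ (t : Fin 3 → Fˣ) 0 ≠ (t : Fin 3 → Fˣ) 2)) := by
  obtain ⟨P, t, rfl⟩ := diag_conj p E hp hodd hpq x hx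
  have hσ : ∀ σ : Equiv.Perm (Fin 3), (P * ww σ)⁻¹ * (P * DD t * P⁻¹) * (P * ww σ) = DD (permT σ t) := by
    intro σ
    have := DD_ww σ t
    calc _ = (ww σ)⁻¹ * (DD t * ww σ) := by group
      _ = _ := by rw [this]; group
  by_cases h01 : (t : Fin 3 → Fˣ) 0 = (t : Fin 3 → Fˣ) 1
  · by_cases h02 : (t : Fin 3 → Fˣ) 0 = (t : Fin 3 → Fˣ) 2
    · refine ⟨P, t, by group, Or.inl ?_⟩
      intro i j
      fin_cases i <;> fin_cases j <;> simp [← h01, ← h02]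
    · exact ⟨P, t, by group, Or.inr (Or.inr ⟨h01, h02⟩)⟩
  · by_cases h02 : (t : Fin 3 → Fˣ) 0 = (t : Fin 3 → Fˣ) 2
    · refine ⟨_, _, hσ (Equiv.swap 1 2), Or.inr (Or.inr ?_)⟩
      rw [permT_apply, permT_apply, permT_apply]
      have c1 : (Equiv.swap (1 : Fin 3) 2) 0 = 0 := by decide
      have c2 : (Equiv.swap (1 : Fin 3) 2) 1 = 2 := by decide
      have c3 : (Equiv.swap (1 : Fin 3) 2) 2 = 1 := by decide
      rw [c1, c2, c3]
      exact ⟨h02, h01⟩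
    · by_cases h12 : (t : Fin 3 → Fˣ) 1 = (t : Fin 3 → Fˣ) 2
      · refine ⟨_, _, hσ (Equiv.swap 0 2), Or.inr (Or.inr ?_)⟩
        rw [permT_apply, permT_apply, permT_apply]
        have c1 : (Equiv.swap (0 : Fin 3) 2) 0 = 2 := by decide
        have c2 : (Equiv.swap (0 : Fin 3) 2) 1 = 1 := by decide
        have c3 : (Equiv.swap (0 : Fin 3) 2) 2 = 0 := by decide
        rw [c1, c2, c3]
        exact ⟨h12.symm, fun h => h02 h.symm⟩
      · refine ⟨P, t, by group, Or.inr (Or.inl ?_)⟩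
        intro i j hij
        fin_cases i <;> fin_cases j <;> simp_all [eq_comm]

lemma step3 (ρ : SpecialLinearGroup (Fin 3) F →* (V →ₗ[ℂ] V)) (p : ℕ) (hp : p.Prime) (hodd : Odd p)
    (hpq : p ∣ Fintype.card F - 1)
    (hirr : ∀ W : Submodule ℂ V, (∀ g, ∀ w ∈ W, ρ g w ∈ W) → W = ⊥ ∨ W = ⊤)
    (v : V) (l : Tor F →* ℂˣ) (hv : IsHW ρ v l) (E n' : ℕ)
    (hn : Nat.card (SpecialLinearGroup (Fin 3) F) = p ^ E * n') (hpn : ¬ p ∣ n')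
    (s : ℕ) (hs : n' * p ∣ s)
    (hl : ∀ t : Tor F, t ^ p ^ E = 1 → l t ^ s = 1) (g) :
    LinearMap.trace ℂ V (ρ (g ^ (s + 1))) = LinearMap.trace ℂ V (ρ g) := by
  have hps : p ∣ s := (Dvd.intro_left _ rfl).trans hs
  have hns : n' ∣ s := (Dvd.intro _ rfl).trans hs
  have hord : ∀ y : SpecialLinearGroup (Fin 3) F, y ^ (p ^ E * n') = 1 := by
    intro y; rw [← hn]; exact pow_card_eq_one'
  obtain ⟨d, hd1, hd2⟩ := Nat.chineseRemainder (n := p ^ E) (m := n')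
    (Nat.Coprime.pow_left _ ((Nat.Prime.coprime_iff_not_dvd hp).2 hpn)) 1 0
  have hd3 : n' ∣ d := (Nat.modEq_zero_iff_dvd).1 hd2
  have hcop : Nat.Coprime (s + 1) (p ^ E * n') := by
    refine Nat.Coprime.mul_right (Nat.Coprime.pow_right _ ?_) ?_
    · obtain ⟨k, rfl⟩ := hps; simp
    · obtain ⟨k, rfl⟩ := hns; simp
  have hnpos : 0 < p ^ E * n' := by rw [← hn]; exact Nat.card_pos
  obtain ⟨k, hk1, hk⟩ := exists_inv_pow hnpos hcop
  obtain ⟨P, t, hPt, htri⟩ := diag_trich p E hp hodd hpq (g ^ d) (by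
    obtain ⟨m, rfl⟩ := hd3
    rw [← pow_mul, show n' * m * p ^ E = (p ^ E * n') * m by ring, pow_mul, hord, one_pow])
  rw [← trace_conj ρ P (g ^ (s + 1)), ← trace_conj ρ P g, ← conj_pow']
  rw [← conj_pow'] at hPt
  generalize P⁻¹ * g * P = g at hPt ⊢
  have htE : t ^ p ^ E = 1 := by
    have h1 : DD (t ^ p ^ E) = 1 := by
      rw [map_pow, ← hPt]
      obtain ⟨m, rfl⟩ := hd3
      rw [← pow_mul, show n' * m * p ^ E = (p ^ E * n') * m by ring, pow_mul, hord, one_pow]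
    apply Subtype.ext
    funext i
    have h2 : (DD (t ^ p ^ E)) i i = (1 : SpecialLinearGroup (Fin 3) F) i i := by rw [h1]
    rw [DD_apply, if_pos rfl] at h2
    ext
    simpa using h2
  have hgs : g ^ s = DD t ^ s := by
    rw [← hPt, ← pow_mul, mul_comm, pow_mul]
    have h1 : (g ^ s) ^ p ^ E = 1 := by
      obtain ⟨m, rfl⟩ := hns
      rw [← pow_mul, show n' * m * p ^ E = (p ^ E * n') * m by ring, pow_mul, hord, one_pow]
    have h2 : (g ^ s) ^ d = (g ^ s) ^ 1 :=
      pow_eq_pow_iff_modEq.2 (hd1.of_dvd (orderOf_dvd_of_pow_eq_one h1))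
    rw [h2, pow_one]
  have hg : g * DD t = DD t * g := by rw [← hPt]; exact (Commute.refl g).pow_right d
  have hc1 : ∀ h, h * g = g * h → h * DD t = DD t * h := by
    intro h hh
    rw [← hPt]; exact (show Commute h g from hh).pow_right d
  have hc2 : ∀ h, h * g ^ (s + 1) = g ^ (s + 1) * h → h * DD t = DD t * h := by
    intro h hh
    apply hc1
    have h1 : (g ^ (s + 1)) ^ ((s + 1) ^ (k - 1)) = g := by
      rw [← pow_mul, ← pow_succ', Nat.sub_add_cancel hk1]
      have : g ^ ((s + 1) ^ k) = g ^ 1 :=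
        pow_eq_pow_iff_modEq.2 (hk.of_dvd (orderOf_dvd_of_pow_eq_one (hord g)))
      rw [this, pow_one]
    have h2 := (show Commute h (g ^ (s + 1)) from hh).pow_right ((s + 1) ^ (k - 1))
    rw [h1] at h2
    exact h2
  have hl' : ∀ σ, l (permT σ t) ^ s = 1 := by
    intro σ
    apply hl
    rw [← map_pow, htE, map_one]
  rcases htri with h | h | ⟨h01, h02⟩
  · have h3 : t ^ 3 = 1 := by
      apply Subtype.ext
      funext i
      have := (mem_Tor _).1 t.2
      rw [Fin.prod_univ_three, h 0 i, h 1 i, h 2 i] at this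
      change (t : Fin 3 → Fˣ) i ^ 3 = 1
      rw [← this]
      simp [pow_succ]
    obtain ⟨j, hj, hj2⟩ := (Nat.dvd_prime_pow hp).1 (orderOf_dvd_of_pow_eq_one htE)
    have h4 := orderOf_dvd_of_pow_eq_one h3
    have h5 : orderOf t ∣ s := by
      rw [hj2] at h4 ⊢
      rcases Nat.lt_or_ge j 2 with hj3 | hj3
      · interval_cases j
        · simp
        · simpa using hps
      · exfalso
        have h6 := Nat.le_of_dvd (by norm_num) ((pow_dvd_pow p hj3).trans h4)
        have := hp.two_le
        nlinarith
    rw [pow_succ, hgs, ← map_pow, orderOf_dvd_iff_pow_eq_one.1 h5, map_one, one_mul]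
  · exact step3_core ρ hirr v l hv s t (UU F) (norm_UU t h) (cent_UU t h)
      (fun u hu => ⟨1, u, hu, by simp, by simp⟩) hl' g hg hgs hc1 hc2
  · have h12 : (t : Fin 3 → Fˣ) 1 ≠ (t : Fin 3 → Fˣ) 2 := by rw [← h01]; exact h02
    refine step3_core ρ hirr v l hv s t (UQ F) (norm_UQ t h02 h12) (cent_UQ t h02 h12)
      (fun u hu => ?_) hl' g hg hgs hc1 hc2
    obtain ⟨a, u', hu', rfl⟩ := UU_decomp u hu
    exact ⟨uu a 0 0, u', hu', uu_comm_DD t h01 a, rfl⟩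

end P6f

section P6g
set_option linter.all false
open Matrix Module

lemma eta_pow {M : Type*} [CommGroup M] (p E S : ℕ) (hp : p.Prime) (hodd : Odd p) (hpS : p ∣ S) (z : M)
    (hz : z ^ p ^ E = 1) (h : z ^ (S + 1) ^ p = z) : (z ^ S) ^ p = 1 := by
  obtain ⟨b, hb⟩ := hpS
  have h1 := odd_sq_dvd_geom_sum₂_sub (R := ℤ) (a := 1) (b := b) hodd
  simp only [one_pow, mul_one] at h1
  obtain ⟨W, hW⟩ := h1
  have h2 := geom_sum_mul ((1 : ℤ) + p * b) p
  have hS : ((S : ℕ) : ℤ) = p * b := by rw [hb]; push_cast; ring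
  rw [sub_eq_iff_eq_add.1 hW] at h2
  have h3 : z ^ ((((S : ℤ) + 1) ^ p - 1)) = 1 := by
    rw [_root_.zpow_sub, zpow_one, mul_inv_eq_one, ← h]
    have : (((S : ℤ) + 1) ^ p) = (((S + 1) ^ p : ℕ) : ℤ) := by push_cast; ring
    rw [this, zpow_natCast, h, h]
  have h4 : (((S : ℤ) + 1) ^ p - 1) = ((S * p : ℕ) : ℤ) * (1 + p * W) := by
    rw [hS, add_comm, ← h2]
    push_cast
    rw [hS]
    ring
  rw [h4, _root_.zpow_mul, zpow_natCast, pow_mul] at h3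
  set y := (z ^ S) ^ p with hy
  have h5 : y ^ p ^ E = 1 := by
    rw [hy, pow_right_comm, pow_right_comm z, hz, one_pow, one_pow]
  have h6 : (orderOf y : ℤ) ∣ 1 + p * W := orderOf_dvd_iff_zpow_eq_one.2 h3
  obtain ⟨j, _, hj⟩ := (Nat.dvd_prime_pow hp).1 (orderOf_dvd_of_pow_eq_one h5)
  rcases Nat.eq_zero_or_pos j with h0 | h0
  · rw [h0, pow_zero] at hj
    exact orderOf_eq_one_iff.1 hj
  · exfalso
    have h7 : (p : ℤ) ∣ 1 + p * W := by
      refine dvd_trans ?_ h6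
      rw [hj]
      exact_mod_cast dvd_pow_self p h0.ne'
    have h8 : (p : ℤ) ∣ 1 := (dvd_add_left (Dvd.intro _ rfl)).1 h7
    exact hp.one_lt.ne' (by simpa using Int.isUnit_iff_natAbs_eq.1 (isUnit_of_dvd_one h8))

lemma pow_R {M : Type*} [CommGroup M] (p S : ℕ) (hpS : p ∣ S) (z : M)
    (h : (z ^ S) ^ p = 1) (j : ℕ) : z ^ (S + 1) ^ j = z * (z ^ S) ^ j := by
  have hS : (z ^ S) ^ S = 1 := by
    obtain ⟨b, hb⟩ := hpS
    nth_rewrite 2 [hb]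
    rw [pow_mul, h, one_pow]
  induction j with
  | zero => simp
  | succ j ih =>
    rw [pow_succ, pow_mul, ih, mul_pow, ← pow_mul (z ^ S), mul_comm j, pow_mul (z ^ S), pow_succ (z ^ S) S,
      hS, one_mul, pow_succ z S, pow_succ (z ^ S) j]
    rw [mul_comm (z ^ S) z, mul_assoc, mul_comm (z ^ S)]

lemma fourier_zero_units {ι : Type*} [DecidableEq ι] (I : Finset ι) (p : ℕ) (hp : p.Prime) (Z ω : ι → ℂˣ) (c : ℂ)
    (hω : ∀ w ∈ I, ω w ^ p = 1) (h : ∀ j : ℕ, ∑ w ∈ I, (Z w : ℂ) * (ω w : ℂ) ^ j = c)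
    (ω0 : ℂˣ) (h0 : ω0 ≠ 1) (h0p : ω0 ^ p = 1) [DecidableEq ℂˣ] :
    ∑ w ∈ I with ω w = ω0, (Z w : ℂ) = 0 := by
  have geo : ∀ x : ℂˣ, x ^ p = 1 → x ≠ 1 → ∑ j ∈ Finset.range p, (x : ℂ) ^ j = 0 := by
    intro x hx hx1
    have h1 := mul_geom_sum (x : ℂ) p
    rw [← Units.val_pow_eq_pow_val, hx, Units.val_one, sub_self] at h1
    refine (mul_eq_zero.1 h1).resolve_left fun h => hx1 (Units.ext (sub_eq_zero.1 h))
  have h1 : ∑ j ∈ Finset.range p, ((ω0⁻¹ : ℂˣ) : ℂ) ^ j * ∑ w ∈ I, (Z w : ℂ) * (ω w : ℂ) ^ j = 0 := by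
    simp_rw [h]
    rw [← Finset.sum_mul, geo ω0⁻¹ (by rw [inv_pow, h0p, inv_one]) (by simpa using h0), zero_mul]
  simp_rw [Finset.mul_sum] at h1
  rw [Finset.sum_comm] at h1
  have h2 : ∀ w ∈ I, ∑ j ∈ Finset.range p, ((ω0⁻¹ : ℂˣ) : ℂ) ^ j * ((Z w : ℂ) * (ω w : ℂ) ^ j) =
      if ω w = ω0 then (p : ℂ) * (Z w : ℂ) else 0 := by
    intro w hw
    have e : ∀ j, ((ω0⁻¹ : ℂˣ) : ℂ) ^ j * ((Z w : ℂ) * (ω w : ℂ) ^ j) =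
        (Z w : ℂ) * ((ω w * ω0⁻¹ : ℂˣ) : ℂ) ^ j := by
      intro j; rw [Units.val_mul, mul_pow]; ring
    simp_rw [e]
    rw [← Finset.mul_sum]
    split_ifs with hw0
    · rw [hw0, mul_inv_cancel]; simp [mul_comm]
    · rw [geo, mul_zero]
      · rw [mul_pow, hω w hw, inv_pow, h0p]; simp
      · intro h; exact hw0 (mul_inv_eq_one.1 h)
  rw [Finset.sum_congr rfl h2, ← Finset.sum_filter, ← Finset.mul_sum] at h1
  exact (mul_eq_zero.1 h1).resolve_left (Nat.cast_ne_zero.2 hp.ne_zero)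


lemma comb (I : Finset (Equiv.Perm (Fin 3))) (p : ℕ) (hp : p.Prime) (hodd : Odd p)
    (f : Equiv.Perm (Fin 3) → ℂˣ) (τ : Equiv.Perm (Fin 3)) (hτ : ∀ w, f (τ * w) = (f w)⁻¹)
    [DecidableEq ℂˣ]
    (hfp : ∀ w, f w ^ p = 1)
    (hN : ∀ ω0 : ℂˣ, ω0 ≠ 1 → ω0 ^ p = 1 → p ∣ (I.filter fun w => f w = ω0).card)
    (w0) (hw0 : w0 ∈ I) (h1 : f w0 ≠ 1) : p ∣ I.card := by
  have hp3 : 3 ≤ p := by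
    have := hp.two_le
    rcases Nat.lt_or_ge p 3 with h2 | h2
    · interval_cases p
      exact absurd hodd (by decide)
    · exact h2
  set ω := f w0 with hω
  have hωp : ω ^ p = 1 := hfp w0
  have hωi : ω ≠ ω⁻¹ := by
    intro h
    have h2 : ω ^ 2 = 1 := by rw [sq]; nth_rewrite 2 [h]; simp
    have h3 := Nat.dvd_gcd (orderOf_dvd_of_pow_eq_one h2) (orderOf_dvd_of_pow_eq_one hωp)
    rw [(Nat.coprime_two_left.2 hodd).gcd_eq_one, Nat.dvd_one] at h3
    exact h1 (orderOf_eq_one_iff.1 h3)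
  let A := Finset.univ.filter fun w => f w = ω
  let B := Finset.univ.filter fun w => f w = ω⁻¹
  have hAB : A.card ≤ B.card := by
    refine Finset.card_le_card_of_injOn (fun w => τ * w) ?_ (fun a _ b _ h => mul_left_cancel h)
    intro w hw
    simp only [A, B, Finset.coe_filter, Set.mem_ofPred_eq, Finset.mem_univ, true_and] at hw ⊢
    rw [hτ, hw]
  have hdisj : Disjoint A B := by
    rw [Finset.disjoint_filter]
    intro w _ h1 h2
    exact hωi (h1.symm.trans h2)
  have hcard : (A ∪ B).card = A.card + B.card := Finset.card_union_of_disjoint hdisj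
  have h6 : (A ∪ B).card ≤ 6 := by
    refine (Finset.card_le_univ _).trans ?_
    rw [Fintype.card_perm]; decide
  have hsub : (I.filter fun w => f w = ω).card ≤ A.card :=
    Finset.card_le_card (Finset.filter_subset_filter _ (Finset.subset_univ _))
  have hd := hN ω h1 hωp
  have hpos : 0 < (I.filter fun w => f w = ω).card :=
    Finset.card_pos.2 ⟨w0, Finset.mem_filter.2 ⟨hw0, rfl⟩⟩
  have hle := Nat.le_of_dvd hpos hd
  have hall : A ∪ B = Finset.univ := by
    apply Finset.eq_univ_of_card
    rw [Fintype.card_perm]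
    have : (Fintype.card (Fin 3)).factorial = 6 := by decide
    omega
  have hI : I = (I.filter fun w => f w = ω) ∪ (I.filter fun w => f w = ω⁻¹) := by
    ext w
    have : w ∈ A ∪ B := by rw [hall]; exact Finset.mem_univ _
    simp only [A, B, Finset.mem_union, Finset.mem_filter, Finset.mem_univ, true_and] at this ⊢
    tauto
  rw [hI, Finset.card_union_of_disjoint]
  · exact dvd_add hd (hN ω⁻¹ (by simpa using h1) (by rw [inv_pow, hωp, inv_one]))
  · rw [Finset.disjoint_filter]
    intro w _ h1 h2
    exact hωi (h1.symm.trans h2)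

lemma inj_three {X : Type*} (a b c : X) (h1 : a ≠ b) (h2 : a ≠ c) (h3 : b ≠ c) :
    Function.Injective ![a, b, c] := by
  have e0 : ![a, b, c] 0 = a := rfl
  have e1 : ![a, b, c] 1 = b := rfl
  have e2 : ![a, b, c] 2 = c := rfl
  intro i j hij
  fin_cases i <;> fin_cases j <;> first | rfl | (exfalso; first | exact h1 hij | exact h2 hij | exact h3 hij | exact h1 hij.symm | exact h2 hij.symm | exact h3 hij.symm)

variable {F : Type*} [Field F] [Fintype F]

lemma special_of_ne (p E : ℕ) (hp : p.Prime) (hodd : Odd p) (η : Tor F →* ℂˣ) (t : Tor F)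
    (ht : t ^ p ^ E = 1) (hη : η t ≠ 1) :
    ∃ t' : Tor F, t' ^ p ^ E = 1 ∧ Function.Injective (t' : Fin 3 → Fˣ) ∧
      (∃ τ, permT τ t' = t'⁻¹) ∧ η t' ≠ 1 := by
  have hti : ∀ i, (t : Fin 3 → Fˣ) i ^ p ^ E = 1 := by
    intro i
    have := congrArg (fun x : Tor F => (x : Fin 3 → Fˣ) i) ht
    simpa using this
  have hinv : ∀ a : Fˣ, a ^ p ^ E = 1 → a ≠ 1 → a ≠ a⁻¹ := by
    intro a ha ha1 h
    have h2 : a ^ 2 = 1 := by rw [sq]; nth_rewrite 2 [h]; simp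
    have h3 := Nat.dvd_gcd (orderOf_dvd_of_pow_eq_one h2) (orderOf_dvd_of_pow_eq_one ha)
    rw [(Nat.coprime_two_left.2 hodd.pow).gcd_eq_one, Nat.dvd_one] at h3
    exact ha1 (orderOf_eq_one_iff.1 h3)
  let t1 : Fˣ → Tor F := fun a => ⟨![a, 1, a⁻¹], by rw [mem_Tor, Fin.prod_univ_three]; simp⟩
  let t2 : Fˣ → Tor F := fun a => ⟨![1, a, a⁻¹], by rw [mem_Tor, Fin.prod_univ_three]; simp⟩
  have hprod : t = t1 ((t : Fin 3 → Fˣ) 0) * t2 ((t : Fin 3 → Fˣ) 1) := by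
    have h3 := (mem_Tor _).1 t.2
    rw [Fin.prod_univ_three] at h3
    apply Subtype.ext
    funext i
    fin_cases i
    · simp [t1, t2]
    · simp [t1, t2]
    · have : (t : Fin 3 → Fˣ) 2 = ((t : Fin 3 → Fˣ) 0)⁻¹ * ((t : Fin 3 → Fˣ) 1)⁻¹ := by
        rw [← mul_inv]; exact (inv_eq_of_mul_eq_one_right h3).symm
      simpa [t1, t2] using this
  by_cases h1 : η (t1 ((t : Fin 3 → Fˣ) 0)) = 1
  · have h2 : η (t2 ((t : Fin 3 → Fˣ) 1)) ≠ 1 := by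
      intro h2
      apply hη
      rw [hprod, map_mul, h1, h2, one_mul]
    have ha := hti 1
    generalize (t : Fin 3 → Fˣ) 1 = a at h2 ha
    have ha1 : a ≠ 1 := by
      rintro rfl
      apply h2
      have : t2 1 = 1 := by
        apply Subtype.ext; funext i; fin_cases i <;> simp [t2]
      rw [this, map_one]
    have ha2 := hinv a ha ha1
    refine ⟨t2 a, ?_, ?_, ⟨Equiv.swap 1 2, ?_⟩, h2⟩
    · apply Subtype.ext; funext i; fin_cases i <;> simp [t2, ha]
    · exact inj_three _ _ _ ha1.symm (by simpa [eq_comm] using ha1) ha2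
    · have c1 : (Equiv.swap (1 : Fin 3) 2) 0 = 0 := by decide
      have c2 : (Equiv.swap (1 : Fin 3) 2) 1 = 2 := by decide
      have c3 : (Equiv.swap (1 : Fin 3) 2) 2 = 1 := by decide
      apply Subtype.ext; funext i; fin_cases i <;> simp [permT_apply, t2, c1, c2, c3]
  · have ha := hti 0
    generalize (t : Fin 3 → Fˣ) 0 = a at h1 ha
    have ha1 : a ≠ 1 := by
      rintro rfl
      apply h1
      have : t1 1 = 1 := by
        apply Subtype.ext; funext i; fin_cases i <;> simp [t1]
      rw [this, map_one]
    have ha2 := hinv a ha ha1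
    refine ⟨t1 a, ?_, ?_, ⟨Equiv.swap 0 2, ?_⟩, h1⟩
    · apply Subtype.ext; funext i; fin_cases i <;> simp [t1, ha]
    · exact inj_three _ _ _ ha1 ha2 (by simpa [eq_comm] using ha1)
    · have c1 : (Equiv.swap (0 : Fin 3) 2) 0 = 2 := by decide
      have c2 : (Equiv.swap (0 : Fin 3) 2) 1 = 1 := by decide
      have c3 : (Equiv.swap (0 : Fin 3) 2) 2 = 0 := by decide
      apply Subtype.ext; funext i; fin_cases i <;> simp [permT_apply, t1, c1, c2, c3]

end P6g

section P6h
set_option linter.all false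
open Matrix Module

variable {F : Type*} [Field F] [Fintype F]
variable [Fintype (SpecialLinearGroup (Fin 3) F)] {V : Type*} [AddCommGroup V] [Module ℂ V]
  [FiniteDimensional ℂ V]

lemma permT_mul (σ τ : Equiv.Perm (Fin 3)) (t : Tor F) : permT (σ * τ) t = permT τ (permT σ t) := rfl

lemma permT_one (t : Tor F) : permT 1 t = t := rfl

lemma pow_big {M : Type*} [CommGroup M] (p E s : ℕ) (hps : p ∣ s) (z : M) (hz : z ^ p ^ E = 1) :
    z ^ (s + 1) ^ p ^ E = z := by
  have h1 : ((p : ℕ) : ℤ) ∣ ((s : ℤ) + 1) - 1 := by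
    rw [add_sub_cancel_right]; exact_mod_cast hps
  have h2 := dvd_sub_pow_of_dvd_sub h1 E
  have h3 : ((p ^ E : ℕ) : ℤ) ∣ ((s : ℤ) + 1) ^ p ^ E - 1 := by
    rw [one_pow] at h2
    refine dvd_trans ?_ h2
    push_cast
    exact pow_dvd_pow _ (Nat.le_succ _)
  obtain ⟨c, hc⟩ := h3
  have h4 : z ^ (((s : ℤ) + 1) ^ p ^ E - 1) = 1 := by
    rw [hc, _root_.zpow_mul, zpow_natCast, hz, _root_.one_zpow]
  rw [_root_.zpow_sub, zpow_one, mul_inv_eq_one] at h4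
  have : (((s : ℤ) + 1) ^ p ^ E) = (((s + 1) ^ p ^ E : ℕ) : ℤ) := by push_cast; ring
  rwa [this, zpow_natCast] at h4

lemma trace_iter {G : Type*} [Group G] (ρ : G →* (V →ₗ[ℂ] V)) (N s : ℕ)
    (hyp : ∀ x : G, x ^ N = 1 → LinearMap.trace ℂ V (ρ (x ^ (s + 1))) = LinearMap.trace ℂ V (ρ x))
    (k : ℕ) (x : G) (hx : x ^ N = 1) :
    LinearMap.trace ℂ V (ρ (x ^ (s + 1) ^ k)) = LinearMap.trace ℂ V (ρ x) := by
  induction k with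
  | zero => simp
  | succ k ih =>
    rw [pow_succ, pow_mul, hyp _ (by rw [pow_right_comm, hx, one_pow]), ih]

lemma pow_inj_of_coprime (p E m : ℕ) (t : Tor F) (ht : t ^ p ^ E = 1)
    (hinj : Function.Injective (t : Fin 3 → Fˣ)) (hm : ∃ k, (m * k) ≡ 1 [MOD p ^ E]) :
    Function.Injective ((t ^ m : Tor F) : Fin 3 → Fˣ) := by
  obtain ⟨k, hk⟩ := hm
  have hti : ∀ i, (t : Fin 3 → Fˣ) i ^ p ^ E = 1 := by
    intro i
    have := congrArg (fun x : Tor F => (x : Fin 3 → Fˣ) i) ht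
    simpa using this
  intro i j hij
  apply hinj
  have h1 : (t : Fin 3 → Fˣ) i ^ m = (t : Fin 3 → Fˣ) j ^ m := by simpa using hij
  have h2 : ∀ i, ((t : Fin 3 → Fˣ) i ^ m) ^ k = (t : Fin 3 → Fˣ) i := by
    intro i
    rw [← pow_mul]
    conv_rhs => rw [← pow_one ((t : Fin 3 → Fˣ) i)]
    exact pow_eq_pow_iff_modEq.2 (hk.of_dvd (orderOf_dvd_of_pow_eq_one (hti i)))
  rw [← h2 i, ← h2 j, h1]

lemma step4 (ρ : SpecialLinearGroup (Fin 3) F →* (V →ₗ[ℂ] V)) (p : ℕ) (hp : p.Prime) (hodd : Odd p)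
    (hpq : p ∣ Fintype.card F - 1) (hdim : ¬ p ∣ finrank ℂ V)
    (l : Tor F →* ℂˣ) (I : Finset (Equiv.Perm (Fin 3)))
    (hI : ∀ t : Tor F, Function.Injective (t : Fin 3 → Fˣ) →
      LinearMap.trace ℂ V (ρ (DD t)) = ∑ σ ∈ I, ((l (permT σ t) : ℂˣ) : ℂ))
    (E s : ℕ) (hps : p ∣ s)
    (hyp : ∀ x, x ^ p ^ E = 1 → LinearMap.trace ℂ V (ρ (x ^ (s + 1))) = LinearMap.trace ℂ V (ρ x))
    (t : Tor F) (ht : t ^ p ^ E = 1) : l t ^ s = 1 := by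
  classical
  have hcard : ¬ p ∣ I.card := by
    obtain ⟨t0, ht0, hinj⟩ := exists_spec (F := F) p hp hodd hpq
    have h1 := dim_cong ρ p hp 1 (DD t0) (by rw [pow_one, ← map_pow, ht0, map_one]) I
      (fun σ => ((l (permT σ t0) : ℂˣ) : ℂ))
      (by
        intro σ _
        rw [pow_one, ← Units.val_pow_eq_pow_val, ← map_pow, ← map_pow, ht0, map_one, map_one, Units.val_one])
      (hI t0 hinj)
    intro h
    apply hdim
    have h2 : (p : ℤ) ∣ (finrank ℂ V : ℤ) := (dvd_sub_left (by exact_mod_cast h)).1 h1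
    exact_mod_cast h2
  by_contra hcon
  let P : ℕ → Prop := fun j => ∀ t : Tor F, t ^ p ^ E = 1 → l t ^ (s + 1) ^ p ^ j = l t
  have hP : ∃ j, P j := ⟨E, fun t ht => pow_big p E s hps _ (by rw [← map_pow, ht, map_one])⟩
  have hmin := fun m => Nat.find_min hP (m := m)
  have hj := Nat.find_spec hP
  generalize Nat.find hP = j at hmin hj
  have hj0 : j ≠ 0 := by
    rintro rfl
    apply hcon
    have := hj t ht
    rw [pow_zero, pow_one, pow_succ] at this
    exact mul_eq_right.1 this
  obtain ⟨i, rfl⟩ := Nat.exists_eq_succ_of_ne_zero hj0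
  have hi := hmin i (Nat.lt_succ_self i)
  simp only [P, not_forall] at hi
  obtain ⟨t1, ht1, hne⟩ := hi
  obtain ⟨S, hS, hpS⟩ := dvd_succ_pow_sub hps (p ^ i)
  rw [hS, pow_succ] at hne
  have hη : (l t1) ^ S ≠ 1 := fun h => hne (by rw [h, one_mul])
  have hall : ∀ t : Tor F, t ^ p ^ E = 1 → (l t ^ S) ^ p = 1 := by
    intro t ht
    apply eta_pow p E S hp hodd hpS _ (by rw [← map_pow, ht, map_one])
    have := hj t ht
    rwa [Nat.succ_eq_add_one, pow_succ p, pow_mul, hS] at this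
  obtain ⟨t2, ht2, hinj2, ⟨τ, hτ⟩, hne2⟩ := special_of_ne p E hp hodd ((powMonoidHom S).comp l) t1 ht1 hη
  have hne2' : l t2 ^ S ≠ 1 := hne2
  have hIne : I.Nonempty := by
    rw [Finset.nonempty_iff_ne_empty]
    rintro rfl
    exact hcard (by simp)
  obtain ⟨w0, hw0⟩ := hIne
  let t' : Tor F := permT w0⁻¹ t2
  have ht' : t' ^ p ^ E = 1 := by
    simp only [t']; rw [← map_pow, ht2, map_one]
  have hinj' : Function.Injective (t' : Fin 3 → Fˣ) := hinj2.comp (Equiv.injective _)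
  have hw0t : permT w0 t' = t2 := by
    simp only [t']
    rw [← permT_mul, inv_mul_cancel, permT_one]
  have hperm : ∀ w, (permT w t') ^ p ^ E = 1 := by
    intro w; rw [← map_pow, ht', map_one]
  have hτ' : permT (w0 * τ * w0⁻¹) t' = t'⁻¹ := by
    rw [permT_mul, permT_mul, hw0t, hτ, map_inv]
  let f : Equiv.Perm (Fin 3) → ℂˣ := fun w => l (permT w t') ^ S
  have hfp : ∀ w, f w ^ p = 1 := fun w => hall _ (hperm w)
  have hf : ∀ w, f (w0 * τ * w0⁻¹ * w) = (f w)⁻¹ := by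
    intro w
    simp only [f]
    rw [permT_mul, hτ', map_inv, map_inv, inv_pow]
  have hsum : ∀ k : ℕ, ∑ w ∈ I, ((l (permT w t') : ℂˣ) : ℂ) * ((f w : ℂˣ) : ℂ) ^ k =
      LinearMap.trace ℂ V (ρ (DD t')) := by
    intro k
    have h1 : LinearMap.trace ℂ V (ρ (DD t' ^ (S + 1) ^ k)) = LinearMap.trace ℂ V (ρ (DD t')) := by
      rw [← hS, ← pow_mul]
      exact trace_iter ρ (p ^ E) s hyp _ _ (by rw [← map_pow, ht', map_one])
    have hinjk : Function.Injective ((t' ^ (S + 1) ^ k : Tor F) : Fin 3 → Fˣ) := by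
      apply pow_inj_of_coprime p E _ t' ht' hinj'
      have hcop : ((S + 1) ^ k).Coprime (p ^ E) := by
        apply Nat.Coprime.pow
        rw [Nat.coprime_comm, Nat.Prime.coprime_iff_not_dvd hp]
        intro h
        exact hp.one_lt.ne' (Nat.dvd_one.1 ((Nat.dvd_add_right hpS).1 h))
      obtain ⟨b, hb1, hb⟩ := exists_inv_pow (pow_pos hp.pos E) hcop
      exact ⟨((S + 1) ^ k) ^ (b - 1), by rwa [← pow_succ', Nat.sub_add_cancel hb1]⟩
    rw [← h1, ← map_pow, hI _ hinjk]
    refine Finset.sum_congr rfl fun w _ => ?_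
    rw [map_pow, map_pow, pow_R p S hpS _ (hfp w), Units.val_mul, ← Units.val_pow_eq_pow_val]
  have hN : ∀ ω0 : ℂˣ, ω0 ≠ 1 → ω0 ^ p = 1 → p ∣ (I.filter fun w => f w = ω0).card := by
    intro ω0 h0 h0p
    have h1 := fourier_zero_units I p hp (fun w => l (permT w t')) f _ (fun w _ => hfp w) hsum ω0 h0 h0p
    have h2 := dvd_of_sum_roots_eq_zero (I.filter fun w => f w = ω0) p hp E (fun _ => 1)
      (fun w => ((l (permT w t') : ℂˣ) : ℂ))
      (by
        intro w _
        rw [← Units.val_pow_eq_pow_val, ← map_pow, hperm w, map_one, Units.val_one])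
      (by simpa using h1)
    simp only [Finset.sum_const, nsmul_eq_mul, mul_one] at h2
    exact_mod_cast h2
  refine hcard (comb I p hp hodd f (w0 * τ * w0⁻¹) hf hfp hN w0 hw0 ?_)
  simp only [f]
  rw [hw0t]
  exact hne2'

end P6h

section P7a
set_option linter.all false
open CategoryTheory

lemma fd_hirr {G : Type} [Group G] (V : FDRep ℂ G) (hV : Simple V) (W : Submodule ℂ V)
    (hW : ∀ g, ∀ w ∈ W, V.ρ g w ∈ W) : W = ⊥ ∨ W = ⊤ := by
  let σ : Representation ℂ G W :=
    { toFun := fun g => (V.ρ g).restrict (hW g)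
      map_one' := by ext x; simp
      map_mul' := by intro a b; ext x; simp }
  let f : FDRep.of σ ⟶ V := ⟨InducedCategory.homMk (ModuleCat.ofHom W.subtype), fun g => by
    ext1
    rfl⟩
  have hmono : Mono f := by
    refine ⟨fun a b hab => ?_⟩
    have h1 : ∀ x, f.hom.hom.hom (a.hom.hom.hom x) = f.hom.hom.hom (b.hom.hom.hom x) := by
      intro x
      exact congrArg (fun c => c.hom.hom.hom x) hab
    apply Action.Hom.ext
    apply InducedCategory.hom_ext
    apply ModuleCat.hom_ext
    apply LinearMap.ext
    intro x
    exact Subtype.ext (h1 x)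
  by_cases h0 : f = 0
  · left
    rw [Submodule.eq_bot_iff]
    intro x hx
    exact congrArg (fun c : FDRep.of σ ⟶ V => c.hom.hom.hom (⟨x, hx⟩ : W)) h0
  · right
    have : IsIso f := (hV.mono_isIso_iff_nonzero f).2 h0
    rw [Submodule.eq_top_iff']
    intro x
    have h2 := congrArg (fun c : V ⟶ V => c.hom.hom.hom x) (IsIso.inv_hom_id f)
    have h3 : f.hom.hom.hom ((inv f).hom.hom.hom x) = x := h2
    rw [← h3]
    exact ((inv f).hom.hom.hom x : W).2

lemma fd_norm {G : Type} [Group G] [Fintype G] (V : FDRep ℂ G) (hV : Simple V) :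
    ∑ g, ‖LinearMap.trace ℂ V (V.ρ g)‖ ^ 2 = Fintype.card G := by
  have h := (FDRep.simple_iff_char_is_norm_one V).1 hV
  have h2 : ∑ g, ((‖LinearMap.trace ℂ V (V.ρ g)‖ ^ 2 : ℝ) : ℂ) = ((Fintype.card G : ℝ) : ℂ) := by
    rw [Nat.card_eq_fintype_card] at h
    push_cast
    rw [← h]
    refine Finset.sum_congr rfl fun g _ => ?_
    change _ = LinearMap.trace ℂ V (V.ρ g) * LinearMap.trace ℂ V (V.ρ g⁻¹)
    rw [trace_inv_conj, Complex.mul_conj']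
  exact_mod_cast h2

end P7a


theorem stmt9 (F : Type) [Field F] [Fintype F] [DecidableEq F]
    (p : ℕ) (hp : p.Prime) (hodd : Odd p)
    (V : FDRep ℂ (Matrix.SpecialLinearGroup (Fin 3) F)) (hV : Simple V)
    (hdeg : ¬ p ∣ Module.finrank ℂ V) :
    Property13 V.character p := by
  classical
  have hc0 : Nat.card (Matrix.SpecialLinearGroup (Fin 3) F) ≠ 0 := Nat.card_pos.ne'
  obtain ⟨E, n', hpn, hn⟩ := Nat.exists_eq_pow_mul_and_not_dvd hc0 p hp.ne_one
  refine property13_of_core V.ρ p hp hodd E n' hn hpn ?_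
  intro s hs hne
  by_contra hcon
  push Not at hcon
  obtain ⟨g₀, hg₀⟩ := hne
  apply hg₀
  have hyp : ∀ x : Matrix.SpecialLinearGroup (Fin 3) F, x ^ p ^ E = 1 →
      LinearMap.trace ℂ V (V.ρ (x ^ (s + 1))) = LinearMap.trace ℂ V (V.ρ x) := by
    intro x hx
    obtain ⟨j, _, hj⟩ := (Nat.dvd_prime_pow hp).1 (orderOf_dvd_of_pow_eq_one hx)
    exact hcon x ⟨j, hj⟩
  have hps : p ∣ s := (Dvd.intro_left _ rfl).trans hs
  by_cases h1 : p ∣ Fintype.card F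
  · rw [case_char p E n' hp hodd h1 hn s hs]
  by_cases h2 : p ∣ Fintype.card F - 1
  · have hirr := fd_hirr V hV
    obtain ⟨v, l, hv⟩ := exists_hw V.ρ p hp hodd h2 hdeg
    obtain ⟨I, hI⟩ := exists_I V.ρ p hp hodd h2 hirr v l hv
    exact step3 V.ρ p hp hodd h2 hirr v l hv E n' hn hpn s hs
      (step4 V.ρ p hp hodd h2 hdeg l I hI E s hps hyp) g₀
  · refine thmA V.ρ p hp E n' hn hpn s hs (fd_norm V hV) ?_ ?_ hyp g₀
    · rw [map_one, LinearMap.trace_one]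
      intro h
      apply hdeg
      rw [Nat.cast_eq_zero.1 h]
      exact dvd_zero _
    · intro z hz1 hz x y hx hy
      have hpF : ((p : ℕ) : F) ≠ 0 := by
        intro h
        obtain ⟨r, hr⟩ := CharP.exists F
        have hrp := CharP.char_is_prime F r
        obtain ⟨n, hn1, hn2⟩ := FiniteField.card F r
        have h3 : r ∣ p := (CharP.cast_eq_zero_iff F r p).1 h
        have h4 : r = p := (Nat.prime_dvd_prime_iff_eq hrp hp).1 h3
        apply h1
        rw [hn2, h4]
        exact dvd_pow_self _ n.ne_zero
      have hsep : (z : Matrix (Fin 3) (Fin 3) F).charpoly.Separable := by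
        apply charpoly_separable (z : Matrix (Fin 3) (Fin 3) F) (p ^ E)
        · push_cast; exact pow_ne_zero _ hpF
        · exact Nat.Coprime.pow_left _ ((Nat.Prime.coprime_iff_not_dvd hp).2 h2)
        · rw [← Matrix.SpecialLinearGroup.coe_pow, hz, Matrix.SpecialLinearGroup.coe_one]
        · intro h; exact hz1 (Subtype.ext h)
      have hm : ∀ a b : Matrix.SpecialLinearGroup (Fin 3) F, a * b = b * a →
          (a : Matrix (Fin 3) (Fin 3) F) * b = b * a := by
        intro a b hab
        rw [← Matrix.SpecialLinearGroup.coe_mul, hab, Matrix.SpecialLinearGroup.coe_mul]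
      apply Subtype.ext
      exact comm_of_separable (z : Matrix (Fin 3) (Fin 3) F) _ _ hsep (hm x z hx) (hm y z hy)
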